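/- arXiv:2601.04747 — 2 statements merged into one kernel-verified Lean document; each statement's English description precedes it below -/
import Mathlib

section
/- Let V be a pseudovariety of semigroups such that: some finite semigroup satisfying x·x = x and x·y·x = x·y for all x, y does not belong to V; some finite semigroup satisfying x·x = x and x·y·x = y·x for all x, y does not belong to V; and some finite semigroup possessing a zero element z (i.e. z·s = s·z = z for all s) and satisfying x·x = z and x·y·x = z for all x, y does not belong to V. For N ≥ 1 define C_H(N) as the maximum of c_G(t; Σ) over all members G of V that are groups with |G| ≤ N, all subsets Σ ⊆ G, and all t in the subsemigroup of G generated by Σ. Then there exists a constant c > 0 such that for every S ∈ V, every subset Σ ⊆ S, and every t in the subsemigroup generated by Σ, c_S(t; Σ) ≤ c·(C_H(|S|) + log₂|S| + 1). -/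
/-- A straight-line sequence over `Sig` in a semigroup: every entry is either a
generator from `Sig` or a product of two earlier entries. -/
def IsSLSeq {S : Type*} [Semigroup S] (Sig : Set S) (L : List S) : Prop :=
  ∀ m : Fin L.length, L.get m ∈ Sig ∨
    ∃ i j : Fin L.length, (i : ℕ) < (m : ℕ) ∧ (j : ℕ) < (m : ℕ) ∧ L.get m = L.get i * L.get j

/-- The straight-line cost of `t` over `Sig`: the minimal length of a straight-line
sequence over `Sig` containing `t`. -/
noncomputable def slCost {S : Type*} [Semigroup S] (Sig : Set S) (t : S) : ℕ :=
  sInf { n : ℕ | ∃ L : List S, IsSLSeq Sig L ∧ t ∈ L ∧ L.length = n }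

/-- A pseudovariety of (finite) semigroups: a class of finite semigroups closed under
isomorphism and subsemigroups (via injective homomorphisms), homomorphic images
(via surjective homomorphisms), and finite direct products. -/
structure Pseudovariety : Type 1 where
  mem : ∀ (S : Type) [Semigroup S] [Fintype S], Prop
  closed_sub : ∀ (S T : Type) [Semigroup S] [Fintype S] [Semigroup T] [Fintype T]
    (f : S →ₙ* T), Function.Injective f → mem T → mem S
  closed_hom : ∀ (S T : Type) [Semigroup S] [Fintype S] [Semigroup T] [Fintype T]
    (f : S →ₙ* T), Function.Surjective f → mem S → mem T
  closed_prod : ∀ (S T : Type) [Semigroup S] [Fintype S] [Semigroup T] [Fintype T],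
    mem S → mem T → mem (S × T)

/-- A left-regular band: `x·x = x` and `x·y·x = x·y`. -/
def IsLRB (S : Type*) [Semigroup S] : Prop :=
  (∀ x : S, x * x = x) ∧ ∀ x y : S, x * y * x = x * y

/-- A right-regular band: `x·x = x` and `x·y·x = y·x`. -/
def IsRRB (S : Type*) [Semigroup S] : Prop :=
  (∀ x : S, x * x = x) ∧ ∀ x y : S, x * y * x = y * x

/-- A semigroup with a zero element `z` such that `x·x = z` and `x·y·x = z`. -/
def IsTNil (S : Type*) [Semigroup S] : Prop :=
  ∃ z : S, (∀ s : S, z * s = z ∧ s * z = z) ∧ (∀ x : S, x * x = z) ∧ ∀ x y : S, x * y * x = z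

/-- Auxiliary: there is a group `G` in `V` of size at most `N` witnessing
straight-line cost `m`. -/
def GroupCostAux (V : Pseudovariety) (N m : ℕ) (G : Type) [Group G] [Fintype G] : Prop :=
  V.mem G ∧ Fintype.card G ≤ N ∧
    ∃ (Sig : Set G) (t : G), t ∈ Subsemigroup.closure Sig ∧ slCost Sig t = m

/-- `C_H(N)`: the maximal straight-line cost over all groups in `V` of size at most `N`. -/
noncomputable def groupCost (V : Pseudovariety) (N : ℕ) : ℕ :=
  sSup { m : ℕ | ∃ (G : Type) (iG : Group G) (fG : Fintype G), @GroupCostAux V N m G iG fG }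



namespace SLC

/-- From the available set `A`, with `k` multiplications, everything in `X` can be obtained. -/
inductive Can {M : Type*} [Mul M] : Set M → ℕ → Set M → Prop
  | nil {A : Set M} {k : ℕ} {X : Set M} : X ⊆ A → Can A k X
  | step {A : Set M} {k : ℕ} {X : Set M} (x y : M) :
      x ∈ A → y ∈ A → Can (insert (x * y) A) k X → Can A (k + 1) X

section basic
variable {M : Type*} [Mul M] {A A' X Y Z : Set M} {k l : ℕ}

theorem Can.mono_left (h : Can A k X) : ∀ {A' : Set M}, A ⊆ A' → Can A' k X := by
  induction h with
  | nil h => intro A' hA; exact .nil (h.trans hA)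
  | step x y hx hy _ ih =>
    intro A' hA
    exact .step x y (hA hx) (hA hy) (ih (Set.insert_subset_insert hA))

theorem Can.mono_right (h : Can A k X) : Y ⊆ X → Can A k Y := by
  induction h with
  | nil h => intro hY; exact .nil (hY.trans h)
  | step x y hx hy _ ih => intro hY; exact .step x y hx hy (ih hY)

theorem Can.mono_k (h : Can A k X) : ∀ {l : ℕ}, k ≤ l → Can A l X := by
  induction h with
  | nil h => intro l _; exact .nil h
  | @step A k X x y hx hy _ ih =>
    intro l hl
    obtain ⟨l, rfl⟩ : ∃ l', l = l' + 1 := ⟨l - 1, by omega⟩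
    exact .step x y hx hy (ih (by omega))

theorem Can.keep (h : Can A k X) : Can A k (A ∪ X) := by
  induction h with
  | nil h => exact .nil (Set.union_subset le_rfl h)
  | step x y hx hy _ ih =>
    exact .step x y hx hy (ih.mono_right (Set.union_subset_union_left _ (Set.subset_insert _ _)))

theorem Can.trans' (h : Can A k X) : ∀ {l : ℕ}, Can (A ∪ X) l Y → Can A (k + l) Y := by
  induction h with
  | nil h =>
    intro l h2
    rw [Set.union_eq_left.mpr h] at h2
    exact h2.mono_k (by omega)
  | @step A k X x y hx hy _ ih =>
    intro l h2
    have := ih (h2.mono_left (Set.union_subset_union_left X (Set.subset_insert (x*y) A)))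
    rw [show k + 1 + l = (k + l) + 1 by omega]
    exact .step x y hx hy this

theorem Can.trans (h : Can A k X) (h2 : Can (A ∪ X) l Y) : Can A (k + l) (X ∪ Y) :=
  h.trans' (h2.keep.mono_right (Set.union_subset_union_left _ Set.subset_union_right))

theorem Can.union (h : Can A k X) (h2 : Can A l Y) : Can A (k + l) (X ∪ Y) :=
  h.trans (h2.mono_left Set.subset_union_left)

theorem Can.mul {x y : M} (hx : x ∈ A) (hy : y ∈ A) : Can A 1 {x * y} :=
  .step x y hx hy (.nil (by simp))

theorem Can.mul' {x y : M} (hx : Can A k {x}) (hy : Can A l {y}) : Can A (k + l + 1) {x * y} :=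
  (hx.union hy).trans' (Can.mul (by simp) (by simp))

theorem Can.image {N : Type*} [Mul N] (f : M →ₙ* N) (h : Can A k X) :
    Can (f '' A) k (f '' X) := by
  induction h with
  | nil h => exact .nil (Set.image_mono h)
  | step x y hx hy _ ih =>
    refine .step (f x) (f y) ⟨x, hx, rfl⟩ ⟨y, hy, rfl⟩ ?_
    rwa [Set.image_insert_eq, map_mul] at ih

/-- obtain many things, each within `k` steps -/
theorem Can.biUnion {ι : Type*} (f : ι → Set M) (k : ℕ) (L : List ι)
    (h : ∀ i ∈ L, Can A k (f i)) : Can A (L.length * k) {x | ∃ i ∈ L, x ∈ f i} := by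
  induction L with
  | nil => exact .nil (by simp)
  | cons i L ih =>
    have h1 := (h i (by simp)).union (ih (fun j hj => h j (by simp [hj])))
    refine (h1.mono_k (by simp; ring_nf; rfl)).mono_right ?_
    intro x hx
    obtain ⟨j, hj, hx⟩ := hx
    rcases List.mem_cons.1 hj with rfl | hj
    · exact Or.inl hx
    · exact Or.inr ⟨j, hj, hx⟩
end basic

section slseq
variable {S : Type*} [Semigroup S] {Sig : Set S}

theorem isSLSeq_nil : IsSLSeq Sig ([] : List S) := by
  intro m; exact absurd m.2 (by simp)

theorem isSLSeq_snoc {L : List S} {x : S} :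
    IsSLSeq Sig (L ++ [x]) ↔ IsSLSeq Sig L ∧ (x ∈ Sig ∨ ∃ a ∈ L, ∃ b ∈ L, x = a * b) := by
  constructor
  · intro h
    constructor
    · intro m
      have hm : (m : ℕ) < (L ++ [x]).length := by have := m.2; simp only [List.length_append, List.length_singleton]; omega
      have := h ⟨m, hm⟩
      simp only [List.get_eq_getElem] at this ⊢
      rw [List.getElem_append_left m.2] at this
      rcases this with h | ⟨i, j, hi, hj, h⟩
      · exact Or.inl h
      · right
        have h1 := m.2
        refine ⟨⟨i, by omega⟩, ⟨j, by omega⟩, hi, hj, ?_⟩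
        rwa [List.getElem_append_left (by omega), List.getElem_append_left (by omega)] at h
    · have := h ⟨L.length, by simp⟩
      simp only [List.get_eq_getElem] at this
      rw [List.getElem_append_right le_rfl] at this
      simp only [Nat.sub_self, List.getElem_cons_zero] at this
      rcases this with h | ⟨i, j, hi, hj, h⟩
      · exact Or.inl h
      · right
        rw [List.getElem_append_left hi, List.getElem_append_left hj] at h
        exact ⟨_, List.getElem_mem _, _, List.getElem_mem _, h⟩
  · rintro ⟨h, hx⟩ m
    simp only [List.get_eq_getElem]
    by_cases hm : (m : ℕ) < L.length
    · rw [List.getElem_append_left hm]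
      rcases h ⟨m, hm⟩ with h | ⟨i, j, hi, hj, h⟩
      · exact Or.inl h
      · right
        refine ⟨⟨i, by have := i.2; simp only [List.length_append, List.length_singleton]; omega⟩, ⟨j, by have := j.2; simp only [List.length_append, List.length_singleton]; omega⟩, hi, hj, ?_⟩
        simp only
        rw [List.getElem_append_left i.2, List.getElem_append_left j.2]
        exact h
    · have h1 : (m : ℕ) = L.length := by have := m.2; simp at this; omega
      rw [List.getElem_append_right (by omega)]
      simp only [h1, Nat.sub_self, List.getElem_cons_zero]
      rcases hx with hx | ⟨a, ha, b, hb, hx⟩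
      · exact Or.inl hx
      · right
        obtain ⟨i, hi, rfl⟩ := List.mem_iff_getElem.1 ha
        obtain ⟨j, hj, rfl⟩ := List.mem_iff_getElem.1 hb
        refine ⟨⟨i, by simp only [List.length_append, List.length_singleton]; omega⟩, ⟨j, by simp only [List.length_append, List.length_singleton]; omega⟩, hi, hj, ?_⟩
        simp only
        rw [List.getElem_append_left hi, List.getElem_append_left hj]
        exact hx

theorem isSLSeq_ensure {L : List S} (h : IsSLSeq Sig L) {x : S} (hx : x ∈ Sig ∨ x ∈ L) :
    ∃ L', IsSLSeq Sig L' ∧ L ⊆ L' ∧ x ∈ L' ∧ L'.length ≤ L.length + 1 := by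
  rcases hx with hx | hx
  · exact ⟨L ++ [x], isSLSeq_snoc.2 ⟨h, Or.inl hx⟩, by simp, by simp, by simp⟩
  · exact ⟨L, h, by simp, hx, by omega⟩

theorem can_to_seq {A : Set (WithOne S)} {k : ℕ} {X : Set (WithOne S)} (h : Can A k X) :
    ∀ L : List S, IsSLSeq Sig L → (∀ x ∈ A, x = 1 ∨ ∃ s : S, x = (s : WithOne S) ∧ (s ∈ Sig ∨ s ∈ L)) →
      ∃ L', IsSLSeq Sig L' ∧ L'.length ≤ L.length + 3 * k ∧
        (∀ x ∈ X, x = 1 ∨ ∃ s : S, x = (s : WithOne S) ∧ (s ∈ Sig ∨ s ∈ L')) := by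
  induction h with
  | nil h => intro L hL hA; exact ⟨L, hL, by omega, fun x hx => hA x (h hx)⟩
  | @step A k X x y hx hy _ ih =>
    intro L hL hA
    rcases hA x hx with rfl | ⟨s, rfl, hs⟩
    · obtain ⟨L', h1, h2, h3⟩ := ih L hL (by
        rw [one_mul, Set.insert_eq_of_mem hy]; exact hA)
      exact ⟨L', h1, by omega, h3⟩
    rcases hA y hy with rfl | ⟨s', rfl, hs'⟩
    · obtain ⟨L', h1, h2, h3⟩ := ih L hL (by
        rw [mul_one, Set.insert_eq_of_mem hx]; exact hA)
      exact ⟨L', h1, by omega, h3⟩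
    obtain ⟨L1, a1, a2, a3, a4⟩ := isSLSeq_ensure hL hs
    obtain ⟨L2, b1, b2, b3, b4⟩ := isSLSeq_ensure a1 (x := s') (hs'.imp id (fun h => a2 h))
    have c1 : IsSLSeq Sig (L2 ++ [s * s']) :=
      isSLSeq_snoc.2 ⟨b1, Or.inr ⟨s, b2 a3, s', b3, rfl⟩⟩
    obtain ⟨L', h1, h2, h3⟩ := ih _ c1 (by
      intro x hx
      rcases hx with rfl | hx
      · exact Or.inr ⟨s * s', by simp, by simp⟩
      · rcases hA x hx with h | ⟨s, h, h'⟩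
        · exact Or.inl h
        · refine Or.inr ⟨s, h, h'.imp id fun h => ?_⟩
          exact List.mem_append_left _ (b2 (a2 h)))
    refine ⟨L', h1, ?_, h3⟩
    simp at h2
    omega

theorem slCost_le_of_can {k : ℕ} {t : S}
    (h : Can (insert 1 ((fun s : S => (s : WithOne S)) '' Sig)) k {(t : WithOne S)}) :
    slCost Sig t ≤ 3 * k + 1 := by
  obtain ⟨L, h1, h2, h3⟩ := can_to_seq (Sig := Sig) h [] isSLSeq_nil (by
    rintro x (rfl | ⟨s, hs, rfl⟩)
    · simp
    · exact Or.inr ⟨s, rfl, Or.inl hs⟩)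
  rcases h3 _ rfl with h3 | ⟨s, h3, h4⟩
  · exact absurd h3 (WithOne.coe_ne_one)
  obtain rfl := WithOne.coe_inj.1 h3
  obtain ⟨L', c1, c2, c3, c4⟩ := isSLSeq_ensure h1 h4
  have h5 : slCost Sig t ≤ L'.length := Nat.sInf_le ⟨L', c1, c3, rfl⟩
  simp at h2; omega

theorem can_of_seq (L : List S) (h : IsSLSeq Sig L) :
    Can (Sig ∩ {x | x ∈ L}) L.length {x | x ∈ L} := by
  induction L using List.reverseRecOn with
  | nil => exact .nil (by simp)
  | append_singleton L x ih =>
    rw [isSLSeq_snoc] at h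
    have h1 := (ih h.1).mono_left (A' := Sig ∩ {y | y ∈ L ++ [x]}) (by
      intro y hy; exact ⟨hy.1, by have := hy.2; simp at this ⊢; exact Or.inl this⟩)
    have h2 : Can ((Sig ∩ {y | y ∈ L ++ [x]}) ∪ {y | y ∈ L}) 1 {x} := by
      rcases h.2 with hx | ⟨a, ha, b, hb, rfl⟩
      · exact .nil (by simp [hx])
      · exact Can.mul (by simp [ha]) (by simp [hb])
    have h3 := h1.trans h2
    simp only [List.length_append, List.length_singleton]
    refine h3.mono_right ?_
    intro y hy
    simp at hy ⊢
    tauto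
end slseq

section mon
variable {M : Type*} [Monoid M] {A : Set M}

theorem can_list (h1 : (1 : M) ∈ A) (l : List M) (hl : ∀ x ∈ l, x ∈ A) :
    Can A l.length {l.prod} := by
  induction l with
  | nil => exact .nil (by simpa)
  | cons x l ih =>
    have := Can.mul' (Can.nil (k := 0) (A := A) (X := {x}) (by simp [hl x])) (ih (fun y hy => hl y (by simp [hy])))
    simpa using this

theorem can_suffix (h1 : (1 : M) ∈ A) (l : List M) (hl : ∀ x ∈ l, x ∈ A) :
    Can A l.length {x | ∃ s, s <:+ l ∧ x = s.prod} := by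
  induction l with
  | nil => exact .nil (by simpa)
  | cons x l ih =>
    have h2 := (ih (fun y hy => hl y (by simp [hy]))).trans (Can.mul (x := x) (y := l.prod)
      (by simp [hl]) (Or.inr ⟨l, List.suffix_rfl, rfl⟩))
    refine h2.mono_right ?_
    rintro y ⟨s, hs, rfl⟩
    rcases List.suffix_cons_iff.1 hs with rfl | hs
    · right; simp
    · left; exact ⟨s, hs, rfl⟩

theorem can_pow (x : M) (k : ℕ) (hk : k ≠ 0) (hx : x ∈ A) : Can A (2 * Nat.log 2 k) {x ^ k} := by
  induction k using Nat.strong_induction_on with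
  | _ k ih =>
    by_cases h1 : k = 1
    · subst h1; exact .nil (by simpa)
    have hk2 : 2 ≤ k := by omega
    have h2 := ih (k / 2) (by omega) (by omega)
    have hlog : Nat.log 2 k = Nat.log 2 (k / 2) + 1 := Nat.log_of_one_lt_of_le (by omega) hk2
    have h3 : Can A (2 * Nat.log 2 (k/2) + 1) {x ^ (k/2) * x ^ (k/2)} :=
      h2.trans' (Can.mul (by simp) (by simp))
    rw [← pow_add] at h3
    rw [hlog]
    rcases Nat.even_or_odd' k with ⟨m, rfl | rfl⟩
    · rw [show 2 * m / 2 = m by omega] at h3 ⊢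
      rw [two_mul m]
      exact h3.mono_k (by omega)
    · rw [show (2 * m + 1) / 2 = m by omega] at h3 ⊢
      rw [two_mul m, pow_succ]
      exact (Can.mul' h3 (Can.nil (k := 0) (X := {x}) (by simpa))).mono_k (by omega)

/-- cost of a product of powers -/
theorem can_pows (h1 : (1 : M) ∈ A) (l : List (M × ℕ)) (hl : ∀ p ∈ l, p.2 ≠ 0 → p.1 ∈ A) :
    Can A (3 * (l.map (fun p => Nat.log 2 (p.2 + 1))).sum) {(l.map (fun p => p.1 ^ p.2)).prod} := by
  induction l with
  | nil => exact .nil (by simpa)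
  | cons p l ih =>
    have ih' := ih (fun q hq => hl q (by simp [hq]))
    by_cases hp : p.2 = 0
    · simp only [List.map_cons, List.prod_cons, hp, pow_zero, one_mul, List.sum_cons]
      simpa using ih'
    · have h3 := Can.mul' (can_pow p.1 p.2 hp (hl p (by simp) hp)) ih'
      simp only [List.map_cons, List.prod_cons, List.sum_cons]
      refine h3.mono_k ?_
      have h4 : Nat.log 2 p.2 ≤ Nat.log 2 (p.2 + 1) := Nat.log_mono_right (by omega)
      have h5 : 1 ≤ Nat.log 2 (p.2 + 1) := Nat.log_pos (by omega) (by omega)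
      omega
end mon

section grp
variable {G : Type*} [Group G] {A : Set G}

theorem can_inv_aux (l : List G) (hl : ∀ x ∈ l, x ∈ A)
    (hs : ∀ s, s <:+ l → s.prod ∈ A) : ∀ B : Set G, A ⊆ B → l.prod⁻¹ ∈ B →
    Can B (2 * l.length) {x | x⁻¹ ∈ l} := by
  induction l with
  | nil => intro B hB _; exact .nil (by simp)
  | cons x l ih =>
    intro B hB hi
    have e1 : l.prod⁻¹ = (x :: l).prod⁻¹ * x := by simp
    have e2 : x⁻¹ = l.prod * (x :: l).prod⁻¹ := by simp
    have c1 : Can B 1 {l.prod⁻¹} := by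
      rw [e1]; exact Can.mul hi (hB (hl x (by simp)))
    have c2 : Can B 1 {x⁻¹} := by
      rw [e2]; exact Can.mul (hB (hs l (List.suffix_cons _ _))) hi
    have c3 := ih (fun y hy => hl y (by simp [hy]))
      (fun s h => hs s (h.trans (List.suffix_cons _ _))) (B ∪ ({l.prod⁻¹} ∪ {x⁻¹}))
      (hB.trans Set.subset_union_left) (by simp)
    refine (((c1.union c2).trans c3).mono_k (by simp; omega)).mono_right ?_
    intro y hy
    rcases List.mem_cons.1 hy with h | h
    · left; right; simp [← h]
    · right; exact h

/-- batch inversion -/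
theorem can_inv [Finite G] (h1 : (1 : G) ∈ A) (l : List G) (hl : ∀ x ∈ l, x ∈ A) :
    Can A (3 * l.length + 2 * Nat.log 2 (Nat.card G)) {x | x⁻¹ ∈ l} := by
  have c1 := can_suffix h1 l hl
  have hE : l.prod⁻¹ = l.prod ^ (Nat.card G - 1) := by
    have : 0 < Nat.card G := Nat.card_pos
    rw [inv_eq_iff_mul_eq_one, ← pow_succ', Nat.sub_add_cancel this, pow_card_eq_one']
  have c2 : Can (A ∪ {x | ∃ s, s <:+ l ∧ x = s.prod}) (2 * Nat.log 2 (Nat.card G)) {l.prod⁻¹} := by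
    rw [hE]
    by_cases h0 : Nat.card G - 1 = 0
    · rw [h0]; exact .nil (by simp [h1])
    · have hm : l.prod ∈ A ∪ {x | ∃ s, s <:+ l ∧ x = s.prod} := Or.inr ⟨l, List.suffix_rfl, rfl⟩
      exact (can_pow _ _ h0 hm).mono_k
        (Nat.mul_le_mul_left _ (Nat.log_mono_right (by omega)))
  have c3 := c1.trans c2
  refine ((c3.trans' (can_inv_aux (A := A ∪ {x | ∃ s, s <:+ l ∧ x = s.prod}) l
    (fun x hx => Or.inl (hl x hx)) (fun s hs => Or.inr ⟨s, hs, rfl⟩) _ ?_ ?_))).mono_k (by omega)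
  · rw [← Set.union_assoc]; exact Set.subset_union_left
  · simp
end grp
end SLC


namespace SLC

/-- the identity `x_0 ⋯ x_{n-1} = v` holds for elements different from `1` -/
def Ident (M : Type*) [Monoid M] (n : ℕ) (v : List ℕ) : Prop :=
  ∀ φ : ℕ → M, (∀ i, φ i ≠ 1) → ((List.range n).map φ).prod = (v.map φ).prod

/-- `1` is irreducible -/
def OneIrr (M : Type*) [Monoid M] : Prop := ∀ x y : M, x * y = 1 → x = 1 ∧ y = 1

def NoL (M : Type*) [Monoid M] : Prop := ∀ e a b : M, e ≠ 1 → a ≠ 1 → b ≠ 1 →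
  e * e = e → e * a = a → a * e = a → e * b = b → b * e = b → a * b = a → b * a = b → a = b

def NoR (M : Type*) [Monoid M] : Prop := ∀ e a b : M, e ≠ 1 → a ≠ 1 → b ≠ 1 →
  e * e = e → e * a = a → a * e = a → e * b = b → b * e = b → a * b = b → b * a = a → a = b

/-- `x` is `J`-above `h` -/
def Ab {M : Type*} [Monoid M] (h x : M) : Prop := ∃ a b, h = a * x * b

def Jc {M : Type*} [Monoid M] (h x : M) : Prop := Ab x h ∧ Ab h x

section
variable {M : Type*} [Monoid M]

theorem Ab.refl (h : M) : Ab h h := ⟨1, 1, by simp⟩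
theorem Ab.one (h : M) : Ab h 1 := ⟨h, 1, by simp⟩
theorem Ab.trans {x y z : M} (h1 : Ab x y) (h2 : Ab y z) : Ab x z := by
  obtain ⟨a, b, rfl⟩ := h1
  obtain ⟨c, d, rfl⟩ := h2
  exact ⟨a * c, d * b, by simp only [mul_assoc]⟩
theorem Ab.left {h x y : M} (h1 : Ab h (x * y)) : Ab h x :=
  h1.trans ⟨1, y, by simp⟩
theorem Ab.right {h x y : M} (h1 : Ab h (x * y)) : Ab h y :=
  h1.trans ⟨x, 1, by simp⟩
theorem ab_mul_left (x y : M) : Ab (x * y) x := ⟨1, y, by simp⟩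
theorem ab_mul_right (x y : M) : Ab (x * y) y := ⟨x, 1, by simp⟩
theorem ab_pow (x : M) {k : ℕ} (hk : k ≠ 0) : Ab (x ^ k) x := by
  obtain ⟨k, rfl⟩ := Nat.exists_eq_succ_of_ne_zero hk
  rw [pow_succ]; exact ab_mul_right _ _
theorem ab_prod {l : List M} {x : M} (hx : x ∈ l) : Ab l.prod x := by
  obtain ⟨s, t, rfl⟩ := List.append_of_mem hx
  exact ⟨s.prod, t.prod, by simp [mul_assoc]⟩

theorem OneIrr.ne_left (h1 : OneIrr M) {x : M} (y : M) (hx : x ≠ 1) : x * y ≠ 1 :=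
  fun h => hx (h1 x y h).1
theorem OneIrr.ne_right (h1 : OneIrr M) (x : M) {y : M} (hy : y ≠ 1) : x * y ≠ 1 :=
  fun h => hy (h1 x y h).2
theorem OneIrr.ne_pow (h1 : OneIrr M) {x : M} (hx : x ≠ 1) {k : ℕ} (hk : k ≠ 0) : x ^ k ≠ 1 := by
  obtain ⟨k, rfl⟩ := Nat.exists_eq_succ_of_ne_zero hk
  rw [pow_succ]; exact h1.ne_right _ hx
theorem OneIrr.ne_of_ab (h1 : OneIrr M) {x y : M} (hx : y ≠ 1) (h : Ab x y) : x ≠ 1 := by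
  obtain ⟨a, b, rfl⟩ := h
  exact h1.ne_left _ (h1.ne_right _ hx)

/-- existence of idempotent powers with bounded exponent -/
theorem exists_idem_pow [Finite M] (x : M) : ∃ m, 1 ≤ m ∧ m ≤ (Nat.card M + 1) ^ 2 ∧
    x ^ m * x ^ m = x ^ m := by
  have : ∃ i j : Fin (Nat.card M + 1), i ≠ j ∧ x ^ (i + 1 : ℕ) = x ^ (j + 1 : ℕ) := by
    have := Fintype.ofFinite M
    have h := Fintype.exists_ne_map_eq_of_card_lt
      (fun i : Fin (Nat.card M + 1) => x ^ (i + 1 : ℕ)) (by simp)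
    obtain ⟨i, j, h1, h2⟩ := h
    exact ⟨i, j, h1, h2⟩
  obtain ⟨i, j, hij, h⟩ := this
  wlog hlt : (i : ℕ) < j generalizing i j
  · exact this j i hij.symm h.symm (by
      have : (i : ℕ) ≠ j := fun h => hij (Fin.ext h)
      omega)
  obtain ⟨p, hp⟩ : ∃ p : ℕ, (j : ℕ) = i + p := ⟨j - i, by omega⟩
  have hi := i.2
  have hj := j.2
  have key : ∀ q r : ℕ, x ^ (i + 1 + r : ℕ) = x ^ (i + 1 + r + q * p : ℕ) := by
    intro q r
    induction q with
    | zero => simp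
    | succ q ih =>
      rw [ih, show (i + 1 + r + q * p : ℕ) = (i + 1) + (r + q * p) by ring, pow_add, h, hp,
        ← pow_add]
      congr 1; ring
  refine ⟨p * (i + 1), Nat.mul_pos (by omega) (by omega), ?_, ?_⟩
  · rw [sq]; exact Nat.mul_le_mul (by omega) (by omega)
  · have h1 : (i + 1 : ℕ) ≤ p * (i + 1) := Nat.le_mul_of_pos_left _ (by omega)
    obtain ⟨r, hr⟩ := Nat.exists_eq_add_of_le h1
    rw [← pow_add]
    have := key (i + 1) r
    rw [← hr] at this
    rw [this, mul_comm p]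

theorem idem_pow {e : M} (he : e * e = e) {k : ℕ} (hk : k ≠ 0) : e ^ k = e := by
  obtain ⟨k, rfl⟩ := Nat.exists_eq_succ_of_ne_zero hk
  induction k with
  | zero => simp
  | succ k ih => rw [pow_succ, ih (by omega), he]

theorem idem_unique {x : M} {a b : ℕ} (ha : a ≠ 0) (hb : b ≠ 0) (h1 : x ^ a * x ^ a = x ^ a)
    (h2 : x ^ b * x ^ b = x ^ b) : x ^ a = x ^ b := by
  rw [← idem_pow h1 hb, ← idem_pow h2 ha, ← pow_mul, ← pow_mul, mul_comm]

/-- a uniform idempotent exponent -/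
theorem exists_exp [Finite M] : ∃ E : ℕ, 1 ≤ E ∧ ∀ x : M, x ^ E * x ^ E = x ^ E := by
  have := Fintype.ofFinite M
  choose m h1 h2 h3 using fun x : M => exists_idem_pow x
  refine ⟨∏ x, m x, Nat.one_le_iff_ne_zero.2 (Finset.prod_ne_zero_iff.2 fun x _ => by
    have := h1 x; omega), fun x => ?_⟩
  obtain ⟨k, hk⟩ := Finset.dvd_prod_of_mem m (Finset.mem_univ x)
  have hk0 : k ≠ 0 := by
    rintro rfl
    have : ∏ x, m x ≠ 0 := Finset.prod_ne_zero_iff.2 fun x _ => by have := h1 x; omega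
    exact this (by rw [hk, mul_zero])
  rw [hk, pow_mul, idem_pow (h3 x) hk0, h3]

/-- repeated letter -/
def Rep (v : List ℕ) (i : ℕ) : Prop := ∃ v1 v2 v3, v = v1 ++ i :: (v2 ++ i :: v3)

theorem range_map_three {n i : ℕ} (hi : i < n) {e x f : M} (he : e * e = e) (hf : f * f = f)
    (hx : e * x = x) (hx' : x * f = x) :
    ((List.range n).map (fun j => if j < i then e else if j = i then x else f)).prod = x := by
  obtain ⟨m, rfl⟩ : ∃ m, n = i + 1 + m := ⟨n - i - 1, by omega⟩
  clear hi
  rw [List.range_add, List.range_add]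
  simp only [List.map_append, List.prod_append, List.map_map]
  have h1 : (List.map (fun j => if j < i then e else if j = i then x else f) (List.range i)) =
      List.replicate i e := by
    rw [List.eq_replicate_iff]; simp only [List.length_map, List.length_range, List.mem_map, List.mem_range, true_and]
    rintro b ⟨a, ha, rfl⟩; simp [ha]
  have h2 : (List.map ((fun j => if j < i then e else if j = i then x else f) ∘ fun x => i + 1 + x)
      (List.range m)) = List.replicate m f := by
    rw [List.eq_replicate_iff]; simp only [List.length_map, List.length_range, List.mem_map, List.mem_range, true_and]
    rintro b ⟨a, ha, rfl⟩
    simp only [Function.comp]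
    rw [if_neg (by omega), if_neg (by omega)]
  rw [h1, h2]
  simp only [List.prod_replicate, List.range_one, List.map_cons, List.map_nil, List.prod_singleton, Function.comp,
    add_zero, lt_irrefl, if_false, if_true]
  have h3 : e ^ i * x = x := by
    clear h1 h2
    induction i with
    | zero => simp
    | succ i ih => rw [pow_succ, mul_assoc, hx, ih]
  have h4 : x * f ^ m = x := by
    clear h2
    induction m with
    | zero => simp
    | succ i ih => rw [pow_succ, ← mul_assoc, ih, hx']
  rw [h3, h4]

/-- applying the identity to `e ⋯ e x f ⋯ f` -/
theorem ident_three {n i : ℕ} {v : List ℕ} (hId : Ident M n v) (hi : i < n) (hr : Rep v i)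
    {e x f : M} (he1 : e ≠ 1) (hx1 : x ≠ 1) (hf1 : f ≠ 1)
    (he : e * e = e) (hf : f * f = f) (hx : e * x = x) (hx' : x * f = x) :
    ∃ (V1 V3 : M) (l : List M), (∀ z ∈ l, z = e ∨ z = x ∨ z = f) ∧
      x = V1 * x * (l.prod * x * V3) := by
  obtain ⟨v1, v2, v3, rfl⟩ := hr
  have h1 := hId (fun j => if j < i then e else if j = i then x else f) (by
    intro j; split_ifs <;> assumption)
  rw [range_map_three hi he hf hx hx'] at h1
  simp only [List.map_append, List.map_cons, List.prod_append, List.prod_cons, lt_irrefl, if_false, if_true] at h1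
  refine ⟨(v1.map (fun j => if j < i then e else if j = i then x else f)).prod,
    (v3.map (fun j => if j < i then e else if j = i then x else f)).prod,
    v2.map (fun j => if j < i then e else if j = i then x else f), ?_, ?_⟩
  · intro z hz
    obtain ⟨j, _, rfl⟩ := List.mem_map.1 hz
    split_ifs <;> simp
  · simpa only [mul_assoc] using h1

theorem factor_aux {f r f' : M} (hf' : f' * f' = f') (hr : f * r = r) (l : List M)
    (hl : ∀ z ∈ l, z = f ∨ z = r ∨ z = f') : Ab (f' * l.prod * f) (f' * f) := by
  induction l with
  | nil => simpa using Ab.refl _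
  | cons z l ih =>
    rw [List.prod_cons]
    rcases hl z (by simp) with rfl | rfl | rfl
    · exact ⟨1, l.prod * z, by simp only [mul_assoc, one_mul]⟩
    · refine ⟨1, z * l.prod * f, ?_⟩
      simp only [mul_assoc, one_mul]
      rw [← mul_assoc f z, hr]
    · rw [← mul_assoc, hf']
      exact ih (fun y hy => hl y (by simp [hy]))

end

/-- the standing hypotheses for the non-permutation case -/
structure Hyp (M : Type*) [Monoid M] (n : ℕ) (v : List ℕ) (i E : ℕ) : Prop where
  irr : OneIrr M
  idt : Ident M n v
  lt : i < n
  rep : Rep v i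
  noL : NoL M
  noR : NoR M
  one_le : 1 ≤ E
  idem : ∀ x : M, x ^ E * x ^ E = x ^ E

section
variable {M : Type*} [Monoid M] {n i E : ℕ} {v : List ℕ} 

/-- C1 -/
theorem Hyp.ab_mul (H : Hyp M n v i E) {h x y : M} (hh : h * h = h)
    (hx : Ab h x) (hy : Ab h y) : Ab h (y * x) := by
  by_cases h1 : h = 1
  · subst h1
    obtain ⟨a, b, h⟩ := hx
    obtain ⟨c, d, h'⟩ := hy
    have e1 := (H.irr _ _ (H.irr _ _ h.symm).1).2
    have e2 := (H.irr _ _ (H.irr _ _ h'.symm).1).2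
    rw [e1, e2]; simpa using Ab.one _
  obtain ⟨a0, b0, h2⟩ := hx
  obtain ⟨c0, d0, h3⟩ := hy
  obtain ⟨a, ha⟩ : ∃ a, a = h * a0 := ⟨_, rfl⟩
  obtain ⟨b, hb⟩ : ∃ b, b = b0 * h := ⟨_, rfl⟩
  obtain ⟨c, hc⟩ : ∃ c, c = h * c0 := ⟨_, rfl⟩
  obtain ⟨d, hd⟩ : ∃ d, d = d0 * h := ⟨_, rfl⟩
  have ha' : h * a = a := by rw [ha, ← mul_assoc, hh]
  have hb' : b * h = b := by rw [hb, mul_assoc, hh]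
  have hc' : h * c = c := by rw [hc, ← mul_assoc, hh]
  have hd' : d * h = d := by rw [hd, mul_assoc, hh]
  have ea : a * (x * b) = h := by
    have : a * (x * b) = h * (a0 * x * b0) * h := by rw [ha, hb]; simp only [mul_assoc]
    rw [this, ← h2, hh, hh]
  have ec : c * (y * d) = h := by
    have : c * (y * d) = h * (c0 * y * d0) * h := by rw [hc, hd]; simp only [mul_assoc]
    rw [this, ← h3, hh, hh]
  have ea2 : ∀ z, a * (x * (b * z)) = h * z := fun z => by rw [← ea]; simp only [mul_assoc]
  have ec2 : ∀ z, c * (y * (d * z)) = h * z := fun z => by rw [← ec]; simp only [mul_assoc]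
  have hb2 : ∀ z, b * (h * z) = b * z := fun z => by rw [← mul_assoc, hb']
  have hd2 : ∀ z, d * (h * z) = d * z := fun z => by rw [← mul_assoc, hd']
  have na : a ≠ 1 := by rw [ha]; exact H.irr.ne_left _ h1
  have nc : c ≠ 1 := by rw [hc]; exact H.irr.ne_left _ h1
  obtain ⟨V1, V3, l, hl, h4⟩ := ident_three (e := x * b * a) (x := x * b * (c * y)) (f := d * c * y) H.idt H.lt H.rep
    (H.irr.ne_right _ na) (H.irr.ne_right _ (H.irr.ne_left _ nc))
    (H.irr.ne_left _ (H.irr.ne_right _ nc))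
    (by simp only [mul_assoc, ea2, hb2]) 
    (by simp only [mul_assoc, ec2, hd2])
    (by simp only [mul_assoc, ea2, hb2])
    (by
      simp only [mul_assoc, ec2]
      rw [← mul_assoc h c, hc'])
  have h5 := factor_aux (f := x * b * a) (r := x * b * (c * y)) (f' := d * c * y)
    (by simp only [mul_assoc, ec2, hd2]) (by simp only [mul_assoc, ea2, hb2]) l hl
  have h6 : Ab (x * b * (c * y)) (d * c * y * l.prod * (x * b * a)) := by
    refine ⟨V1 * (x * b * (c * y)), x * b * (c * y) * V3, ?_⟩
    conv_lhs => rw [h4]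
    have q1 : x * b * (c * y) * (d * c * y) = x * b * (c * y) := by
      simp only [mul_assoc, ec2]
      rw [← mul_assoc h c, hc']
    have q2 : (x * b * a) * (x * b * (c * y)) = x * b * (c * y) := by simp only [mul_assoc, ea2, hb2]
    calc _ = V1 * (x * b * (c * y) * (d * c * y)) * (l.prod * ((x * b * a) * (x * b * (c * y))) * V3) := by rw [q1, q2]
      _ = _ := by simp only [mul_assoc]
  have h7 : Ab h (x * b * (c * y)) := by
    refine ⟨a, d, ?_⟩
    simp only [mul_assoc, ec, ea2, hb2, hb', hh]
  have h8 := (h7.trans h6).trans h5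
  have h9 : Ab (d * c * y * (x * b * a)) (y * x) := ⟨d * c, b * a, by simp only [mul_assoc]⟩
  exact h8.trans h9

theorem Hyp.ab_prod (H : Hyp M n v i E) {h : M} (hh : h * h = h) (l : List M)
    (hl : ∀ x ∈ l, Ab h x) : Ab h l.prod := by
  induction l with
  | nil => exact Ab.one h
  | cons x l ih =>
    rw [List.prod_cons]
    exact H.ab_mul hh (ih fun y hy => hl y (by simp [hy])) (hl x (by simp))

theorem Hyp.ab_pow (H : Hyp M n v i E) {h x : M} (hh : h * h = h) (hx : Ab h x) (k : ℕ) :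
    Ab h (x ^ k) := by
  induction k with
  | zero => simpa using Ab.one h
  | succ k ih => rw [pow_succ]; exact H.ab_mul hh hx ih

theorem Hyp.E_ne (H : Hyp M n v i E) : E ≠ 0 := by have := H.one_le; omega

theorem Hyp.idem_le (H : Hyp M n v i E) {h k : M} (hh : h * h = h) (kk : k * k = k)
    (h1 : h * k = k) (h2 : k * h = k) (h3 : Ab h k) : k = h := by
  obtain ⟨a, b, h3⟩ := h3
  have e1 : (h * a * k) * (k * b * h) = h := by
    have : (h * a * k) * (k * b * h) = h * (a * (k * k) * b) * h := by simp only [mul_assoc]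
    rw [this, kk, ← h3, hh, hh]
  have e2 : (h * a * k) * h = h * a * k := by rw [mul_assoc, h2]
  have e3 : ∀ j : ℕ, (h * a * k) ^ (j + 1) * (k * b * h) ^ (j + 1) = h := by
    intro j
    induction j with
    | zero => simpa using e1
    | succ j ih =>
      rw [pow_succ' (h * a * k), pow_succ (k * b * h), mul_assoc, ← mul_assoc (_ ^ (j+1)), ih,
        ← mul_assoc, e2, e1]
  obtain ⟨j, hj⟩ := Nat.exists_eq_succ_of_ne_zero H.E_ne
  have e4 := e3 j
  rw [← Nat.succ_eq_add_one, ← hj] at e4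
  have e5 : (h * a * k) ^ E * h = (h * a * k) ^ E := by
    rw [hj, pow_succ, mul_assoc, e2]
  have e6 : (h * a * k) ^ E = h := by
    have : (h * a * k) ^ E * h = h := by
      have e8 := H.idem (h * a * k)
      generalize (h * a * k) ^ E = x at *
      generalize (k * b * h) ^ E = y at *
      calc x * h = x * (x * y) := by rw [e4]
        _ = (x * x) * y := (mul_assoc ..).symm
        _ = h := by rw [e8, e4]
    rw [← e5, this]
  have e7 : (h * a * k) ^ E * k = (h * a * k) ^ E := by
    rw [hj, pow_succ, mul_assoc, mul_assoc (h * a) k k, kk]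
  rw [← h1]
  rw [e6] at e7; exact e7

/-- C2 -/
theorem Hyp.c2 (H : Hyp M n v i E) {h x : M} (hh : h * h = h) (hx : Ab h x) :
    (h * x * h) ^ E = h := by
  obtain ⟨j, hj⟩ := Nat.exists_eq_succ_of_ne_zero H.E_ne
  refine H.idem_le hh (H.idem _) ?_ ?_ (H.ab_pow hh ?_ _)
  · rw [hj, pow_succ', ← mul_assoc, ← mul_assoc, ← mul_assoc, hh]
  · rw [hj, pow_succ, mul_assoc, mul_assoc (h * x), hh]
  · exact H.ab_mul hh (Ab.refl h) (H.ab_mul hh hx (Ab.refl h))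

theorem Jc.mul_right (H : Hyp M n v i E) {h x y : M} (hh : h * h = h) (hx : Jc h x) (hy : Ab h y) :
    Jc h (x * y) := ⟨(ab_mul_left x y).trans hx.1, H.ab_mul hh hy hx.2⟩
theorem Jc.mul_left (H : Hyp M n v i E) {h x y : M} (hh : h * h = h) (hx : Ab h x) (hy : Jc h y) :
    Jc h (x * y) := ⟨(ab_mul_right x y).trans hy.1, H.ab_mul hh hy.2 hx⟩
theorem Jc.pow (H : Hyp M n v i E) {h x : M} (hh : h * h = h) (hx : Jc h x) {k : ℕ} (hk : k ≠ 0) :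
    Jc h (x ^ k) := ⟨(SLC.ab_pow x hk).trans hx.1, H.ab_pow hh hx.2 k⟩

theorem conj_pow (a h b : M) (m : ℕ) (hh : h * h = h) :
    (a * h * b) ^ (m + 1) = a * (h * (b * a) * h) ^ m * (h * b) := by
  induction m with
  | zero => simp [mul_assoc]
  | succ m ih =>
    rw [pow_succ, ih, pow_succ]
    have hh2 : ∀ z, h * (h * z) = h * z := fun z => by rw [← mul_assoc, hh]
    simp only [mul_assoc, hh2]

/-- C3' -/
theorem Hyp.jc_pow (H : Hyp M n v i E) {h x : M} (hh : h * h = h) (hx : Jc h x) :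
    x ^ E * x = x := by
  obtain ⟨⟨a, b, h1⟩, h2⟩ := hx
  have h3 : Ab h (b * a) := by
    have := H.ab_mul hh h2 h2
    rw [h1] at this
    refine this.trans ⟨a * h, h * b, by simp only [mul_assoc]⟩
  rw [← pow_succ, h1, conj_pow _ _ _ _ hh, H.c2 hh h3]
  rw [mul_assoc, ← mul_assoc h h, hh, mul_assoc]

theorem Hyp.jc_pow' (H : Hyp M n v i E) {h x : M} (hh : h * h = h) (hx : Jc h x) :
    x * x ^ E = x := by
  rw [← pow_succ', pow_succ, H.jc_pow hh hx]

theorem idem_comm_pow {a b : M} (ha : a * a = a) (m : ℕ) : (a * b * a) ^ (m + 1) = (a * b) ^ (m + 1) * a := by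
  induction m with
  | zero => simp
  | succ m ih =>
    rw [pow_succ, ih, pow_succ (a * b) (m + 1)]
    generalize (a * b) ^ (m + 1) = x
    calc x * a * (a * b * a) = x * ((a * a) * b * a) := by simp only [mul_assoc]
      _ = _ := by rw [ha]; simp only [mul_assoc]

theorem mul_pow_shift (a b : M) (m : ℕ) : a * (b * a) ^ m = (a * b) ^ m * a := by
  induction m with
  | zero => simp
  | succ m ih =>
    rw [pow_succ, ← mul_assoc, ih, pow_succ]; simp only [mul_assoc]

/-- C4: the idempotent of the `J`-class in a local monoid is unique -/
theorem Hyp.local_unique (H : Hyp M n v i E) {h e k1 k2 : M} (h1 : h ≠ 1)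
    (e1 : e ≠ 1) (ee : e * e = e) (i1 : k1 * k1 = k1) (i2 : k2 * k2 = k2)
    (a1 : e * k1 = k1) (a2 : k1 * e = k1) (b1 : e * k2 = k2) (b2 : k2 * e = k2)
    (j1 : Jc h k1) (j2 : Jc h k2) : k1 = k2 := by
  obtain ⟨j, hj⟩ := Nat.exists_eq_succ_of_ne_zero H.E_ne
  have n1 : k1 ≠ 1 := H.irr.ne_of_ab h1 j1.1
  have n2 : k2 ≠ 1 := H.irr.ne_of_ab h1 j2.1
  have c1 := H.c2 i1 (j1.1.trans j2.2)
  have c2 := H.c2 i2 (j2.1.trans j1.2)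
  have n3 : (k1 * k2) ^ E ≠ 1 := H.irr.ne_pow (H.irr.ne_left _ n1) H.E_ne
  have p1 : e * (k1 * k2) ^ E = (k1 * k2) ^ E := by
    rw [hj, pow_succ', ← mul_assoc, ← mul_assoc, a1]
  have p2 : (k1 * k2) ^ E * e = (k1 * k2) ^ E := by
    rw [hj, pow_succ, mul_assoc, mul_assoc, b2]
  have q1 : k1 * (k1 * k2) ^ E = (k1 * k2) ^ E := by
    rw [hj, pow_succ', ← mul_assoc, ← mul_assoc, i1]
  have q2 : (k1 * k2) ^ E * k2 = (k1 * k2) ^ E := by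
    rw [hj, pow_succ, mul_assoc, mul_assoc, i2]
  have q3 : (k1 * k2) ^ E * k1 = k1 := by
    rw [hj, Nat.succ_eq_add_one, ← idem_comm_pow i1, ← Nat.succ_eq_add_one, ← hj, c1]
  have q4 : k2 * (k1 * k2) ^ E = k2 := by
    rw [mul_pow_shift, hj, Nat.succ_eq_add_one, ← idem_comm_pow i2, ← Nat.succ_eq_add_one, ← hj, c2]
  have r1 := H.noR e k1 _ e1 n1 n3 ee a1 a2 p1 p2 q1 q3
  have r2 := H.noL e k2 _ e1 n2 n3 ee b1 b2 p1 p2 q4 q2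
  rw [r1, ← r2]

/-- the idempotent `k(e)` and its replacement property -/
theorem Hyp.exists_k (H : Hyp M n v i E) {h e : M} (h1 : h ≠ 1) (hh : h * h = h)
    (e1 : e ≠ 1) (ee : e * e = e) (he : Ab h e) :
    ∃ k, k * k = k ∧ Jc h k ∧ e * k = k ∧ k * e = k ∧
      (∀ X, Jc h X → X * e = X * k) ∧ (∀ X, Jc h X → e * X = k * X) := by
  obtain ⟨j, hj⟩ := Nat.exists_eq_succ_of_ne_zero H.E_ne
  have gen : ∀ x, Jc h x → Jc h ((e * x * e) ^ E) ∧ e * (e * x * e) ^ E = (e * x * e) ^ E ∧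
      (e * x * e) ^ E * e = (e * x * e) ^ E := by
    intro x hx
    refine ⟨Jc.pow H hh (Jc.mul_right H hh (Jc.mul_left H hh he hx) he) H.E_ne, ?_, ?_⟩
    · rw [hj, pow_succ', ← mul_assoc, ← mul_assoc, ← mul_assoc, ee]
    · rw [hj, pow_succ, mul_assoc, mul_assoc (e * x), ee]
  have hJ : Jc h h := ⟨Ab.refl h, Ab.refl h⟩
  obtain ⟨g1, g2, g3⟩ := gen h hJ
  refine ⟨(e * h * e) ^ E, H.idem _, g1, g2, g3, ?_, ?_⟩
  · have key : ∀ x, x * x = x → Jc h x → x * e = x * (e * h * e) ^ E := by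
      intro x xx hx
      obtain ⟨f1, f2, f3⟩ := gen x hx
      have hu := H.local_unique h1 e1 ee (H.idem (e * x * e)) (H.idem (e * h * e)) f2 f3 g2 g3 f1 g1
      have aux : ∀ m : ℕ, (x * e * x) ^ m * (x * e) = x * e * (e * x * e) ^ m := by
        intro m
        induction m with
        | zero => simp
        | succ m ih =>
          rw [pow_succ', mul_assoc, ih, pow_succ']
          have x2 : ∀ z, x * (x * z) = x * z := fun z => by rw [← mul_assoc, xx]
          have e2 : ∀ z, e * (e * z) = e * z := fun z => by rw [← mul_assoc, ee]
          simp only [mul_assoc, x2, e2]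
      have := aux E
      rw [H.c2 xx (hx.1.trans he), ← mul_assoc, xx, hu, mul_assoc, g2] at this
      exact this
    intro X hX
    conv_lhs => rw [← H.jc_pow' hh hX]
    rw [mul_assoc, key _ (H.idem X) (Jc.pow H hh hX H.E_ne), ← mul_assoc, H.jc_pow' hh hX]
  · have key : ∀ x, x * x = x → Jc h x → e * x = (e * h * e) ^ E * x := by
      intro x xx hx
      obtain ⟨f1, f2, f3⟩ := gen x hx
      have hu := H.local_unique h1 e1 ee (H.idem (e * x * e)) (H.idem (e * h * e)) f2 f3 g2 g3 f1 g1
      have aux : ∀ m : ℕ, (e * x) * (x * e * x) ^ m = (e * x * e) ^ m * (e * x) := by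
        intro m
        induction m with
        | zero => simp
        | succ m ih =>
          rw [pow_succ, ← mul_assoc, ih, pow_succ]
          have x2 : ∀ z, x * (x * z) = x * z := fun z => by rw [← mul_assoc, xx]
          have e2 : ∀ z, e * (e * z) = e * z := fun z => by rw [← mul_assoc, ee]
          simp only [mul_assoc, x2, e2]
      have := aux E
      rw [H.c2 xx (hx.1.trans he), mul_assoc, xx, hu, ← mul_assoc, g3] at this
      exact this
    intro X hX
    conv_lhs => rw [← H.jc_pow hh hX]
    rw [← mul_assoc, key _ (H.idem X) (Jc.pow H hh hX H.E_ne), mul_assoc, H.jc_pow hh hX]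

/-- D -/
theorem Hyp.dformula (H : Hyp M n v i E) {h p e q z X Y : M} (h1 : h ≠ 1) (hh : h * h = h)
    (e1 : e ≠ 1) (ee : e * e = e) (hw : Ab h (p * e * q)) (hz : z * (h * (p * e * q) * h) = h)
    (zh : h * z = z) (hX : Jc h X) (hY : Jc h Y) :
    X * (p * e * q) * h * z * (h * (p * e * q) * Y) = X * (p * e * q) * Y := by
  have hp : Ab h p := hw.left.left
  have hq : Ab h q := hw.right
  have he : Ab h e := hw.left.right
  have hJ : Jc h h := ⟨Ab.refl h, Ab.refl h⟩
  obtain ⟨k, kk, kJ, ek, ke, kX, kY⟩ := H.exists_k h1 hh e1 ee he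
  have s : ∀ X Y, Jc h X → Jc h Y → X * (p * e * q) * Y = (X * p * k) * (q * Y) := by
    intro X Y hX _
    rw [← kX _ (Jc.mul_right H hh hX hp)]; simp only [mul_assoc]
  have s' : ∀ X Y, Jc h X → Jc h Y → X * (p * e * q) * Y = (X * p) * (k * (q * Y)) := by
    intro X Y hX hY
    rw [s X Y hX hY]; simp only [mul_assoc]
  have t1 : z * ((h * p * k) * (k * q * h)) = h := by
    rw [s' h h hJ hJ] at hz
    have : (h * p * k) * (k * q * h) = (h * p) * (k * k * (q * h)) := by simp only [mul_assoc]
    rw [this, kk]; exact hz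
  have t2 : (k * q * h) * z * (h * p * k) = k := by
    have hk' : ∀ w, k * (k * w) = k * w := fun w => by rw [← mul_assoc, kk]
    have hz' : ∀ w, h * (z * w) = z * w := fun w => by rw [← mul_assoc, zh]
    refine H.idem_le kk ?_ ?_ ?_ (kJ.1.trans ?_)
    · calc _ = (k * q * h) * (z * ((h * p * k) * (k * q * h))) * z * (h * p * k) := by simp only [mul_assoc]
        _ = _ := by rw [t1]; simp only [mul_assoc, hz']
    · simp only [mul_assoc, hk']
    · simp only [mul_assoc, kk]
    · refine ⟨z * (h * p * k), k * q * h, ?_⟩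
      calc h = h * h := hh.symm
        _ = (z * ((h * p * k) * (k * q * h))) * (z * ((h * p * k) * (k * q * h))) := by rw [t1]
        _ = _ := by simp only [mul_assoc]
  rw [s X h hX hJ, s' h Y hJ hY, s X Y hX hY]
  calc _ = X * p * ((k * q * h) * z * (h * p * k)) * (q * Y) := by simp only [mul_assoc]
    _ = _ := by rw [t2]

/-- left absorption: `x p e q h = p e q h` -/
theorem Hyp.left_absorb (H : Hyp M n v i E) {h p e q R g : M} (h1 : h ≠ 1) (hh : h * h = h)
    (e1 : e ≠ 1) (ee : e * e = e) (hg : g = p * e * q * R) (gJ : Jc h g) :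
    g ^ E * (p * e * q) * h = p * e * q * h := by
  obtain ⟨j, hj⟩ := Nat.exists_eq_succ_of_ne_zero H.E_ne
  have hA := gJ.2
  rw [hg] at hA
  have hR : Ab h R := hA.right
  have hq : Ab h q := hA.left.right
  have he : Ab h e := hA.left.left.right
  have hp : Ab h p := hA.left.left.left
  have hJ : Jc h h := ⟨Ab.refl h, Ab.refl h⟩
  obtain ⟨k, kk, kJ, ek, ke, kX, kY⟩ := H.exists_k h1 hh e1 ee he
  have xJ := Jc.pow H hh gJ H.E_ne
  have u1 : g = p * (k * (q * R * g ^ E)) := by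
    rw [← kY _ (Jc.mul_left H hh (H.ab_mul hh hR hq) xJ)]
    calc g = g * g ^ E := (H.jc_pow' hh gJ).symm
      _ = (p * e * q * R) * g ^ E := congrArg (fun y => y * g ^ E) hg
      _ = _ := by simp only [mul_assoc]
  have u2' : ∀ w : M, w ^ E = k → w * w ^ j = k := fun w hw => by
    rw [← pow_succ', ← Nat.succ_eq_add_one, ← hj, hw]
  have u2 := u2' _ (H.c2 kk (kJ.1.trans (Jc.mul_left H hh (H.ab_mul hh hR hq) xJ).2))
  have u3 : g ^ E * (p * k) = p * k := by
    have h2 := H.jc_pow hh gJ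
    generalize g ^ E = x at *
    have : p * k = g * (k * (k * (q * R * x) * k) ^ j) := by
      rw [u1]
      conv_lhs => rw [← u2]
      simp only [mul_assoc]
    rw [this, ← mul_assoc, h2]
  have u4 : e * (q * h) = k * (q * h) := kY _ (Jc.mul_left H hh hq hJ)
  have u5 : p * e * q * h = p * k * (q * h) := by
    rw [mul_assoc, mul_assoc, u4, mul_assoc]
  rw [mul_assoc, u5, ← mul_assoc, u3]

theorem Hyp.right_absorb (H : Hyp M n v i E) {h p e q R g : M} (h1 : h ≠ 1) (hh : h * h = h)
    (e1 : e ≠ 1) (ee : e * e = e) (hg : g = R * (p * e * q)) (gJ : Jc h g) :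
    h * (p * e * q) * g ^ E = h * (p * e * q) := by
  obtain ⟨j, hj⟩ := Nat.exists_eq_succ_of_ne_zero H.E_ne
  have hA := gJ.2
  rw [hg] at hA
  have hR : Ab h R := hA.left
  have hq : Ab h q := hA.right.right
  have he : Ab h e := hA.right.left.right
  have hp : Ab h p := hA.right.left.left
  have hJ : Jc h h := ⟨Ab.refl h, Ab.refl h⟩
  obtain ⟨k, kk, kJ, ek, ke, kX, kY⟩ := H.exists_k h1 hh e1 ee he
  have xJ := Jc.pow H hh gJ H.E_ne
  have RJ : Jc h (g ^ E * (R * p)) := Jc.mul_right H hh xJ (H.ab_mul hh hp hR)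
  have u1 : g = (g ^ E * (R * p)) * k * q := by
    rw [← kX _ RJ]
    calc g = g ^ E * g := (H.jc_pow hh gJ).symm
      _ = g ^ E * (R * (p * e * q)) := congrArg (fun y => g ^ E * y) hg
      _ = _ := by simp only [mul_assoc]
  have u2' : ∀ w : M, w ^ E = k → w ^ j * w = k := fun w hw => by
    rw [← pow_succ, ← Nat.succ_eq_add_one, ← hj, hw]
  have u2 := u2' _ (H.c2 kk (kJ.1.trans RJ.2))
  have u3 : k * q * g ^ E = k * q := by
    have h2 := H.jc_pow' hh gJ
    generalize g ^ E = x at *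
    have : k * q = (k * (x * (R * p)) * k) ^ j * k * g := by
      rw [u1]
      conv_lhs => rw [← u2]
      simp only [mul_assoc]
    rw [this, mul_assoc, h2]
  have u4 : h * p * e = h * p * k := kX _ (Jc.mul_right H hh hJ hp)
  have u5 : h * (p * e * q) = h * p * (k * q) := by
    rw [← mul_assoc, ← mul_assoc, u4, mul_assoc]
  rw [u5, mul_assoc, u3]

/-- elements of `e M f` are in a group -/
theorem Hyp.regular (H : Hyp M n v i E) {e f g : M} (e1 : e ≠ 1) (f1 : f ≠ 1) (g1 : g ≠ 1)
    (ee : e * e = e) (ff : f * f = f) (eg : e * g = g) (gf : g * f = g) : g ^ E * g = g := by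
  obtain ⟨V1, V3, l, -, h⟩ := ident_three H.idt H.lt H.rep e1 g1 f1 ee ff eg gf
  obtain ⟨j, hj⟩ := Nat.exists_eq_succ_of_ne_zero H.E_ne
  have it : ∀ m : ℕ, g = V1 ^ m * g * (l.prod * g * V3) ^ m := by
    intro m
    induction m with
    | zero => simp
    | succ m ih =>
      rw [pow_succ, pow_succ']
      calc g = V1 ^ m * (V1 * g * (l.prod * g * V3)) * (l.prod * g * V3) ^ m := by rw [← h]; exact ih
        _ = _ := by simp only [mul_assoc]
  have h2 : g * (l.prod * g * V3) ^ E = g := by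
    have i1 := it E
    have i2 := H.idem (l.prod * g * V3)
    generalize (l.prod * g * V3) ^ E = x at *
    generalize V1 ^ E = y at *
    calc g * x = (y * g * x) * x := congrArg (fun w => w * x) i1
      _ = y * g * (x * x) := mul_assoc _ _ _
      _ = g := by rw [i2]; exact i1.symm
  refine H.jc_pow (H.idem (l.prod * g * V3)) ⟨⟨g, 1, by rw [h2, mul_one]⟩, ?_⟩
  exact (SLC.ab_pow _ H.E_ne).trans ⟨l.prod, V3, rfl⟩

end
end SLC


namespace SLC

section
variable {M : Type*} [Monoid M]

/-- `x` is `1` or belongs to `T` -/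
def In1 (T : Subsemigroup M) (x : M) : Prop := x = 1 ∨ x ∈ T

theorem In1.mul {T : Subsemigroup M} {x y : M} (hx : In1 T x) (hy : In1 T y) : In1 T (x * y) := by
  rcases hx with rfl | hx
  · simpa using hy
  · rcases hy with rfl | hy
    · right; simpa using hx
    · right; exact T.mul_mem hx hy

theorem In1.mul_mem {T : Subsemigroup M} {x y : M} (hx : In1 T x) (hy : y ∈ T) : x * y ∈ T := by
  rcases hx with rfl | hx
  · simpa using hy
  · exact T.mul_mem hx hy

theorem In1.mem_mul {T : Subsemigroup M} {x y : M} (hx : x ∈ T) (hy : In1 T y) : x * y ∈ T := by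
  rcases hy with rfl | hy
  · simpa using hx
  · exact T.mul_mem hx hy

theorem in1_prod {T : Subsemigroup M} (l : List M) (hl : ∀ x ∈ l, x ∈ T) : In1 T l.prod := by
  induction l with
  | nil => left; simp
  | cons x l ih =>
    rw [List.prod_cons]
    exact In1.mul (Or.inr (hl x (by simp))) (ih fun y hy => hl y (by simp [hy]))

theorem mem_prod {T : Subsemigroup M} (l : List M) (h0 : l ≠ []) (hl : ∀ x ∈ l, x ∈ T) :
    l.prod ∈ T := by
  cases l with
  | nil => exact absurd rfl h0
  | cons x l =>
    rw [List.prod_cons]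
    exact In1.mem_mul (hl x (by simp)) (in1_prod l fun y hy => hl y (by simp [hy]))

theorem in1_pow {T : Subsemigroup M} {x : M} (hx : x ∈ T) (k : ℕ) : In1 T (x ^ k) := by
  induction k with
  | zero => left; simp
  | succ k ih => rw [pow_succ]; exact ih.mul (Or.inr hx)

theorem mem_pow {T : Subsemigroup M} {x : M} (hx : x ∈ T) {k : ℕ} (hk : 1 ≤ k) : x ^ k ∈ T := by
  obtain ⟨k, rfl⟩ := Nat.exists_eq_add_of_le' hk
  rw [pow_succ]; exact (in1_pow hx k).mul_mem hx

/-- the set-up for pumping -/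
structure Pump (M : Type*) [Monoid M] (n : ℕ) (v : List ℕ) (T : Subsemigroup M) : Prop where
  idt : Ident M n v
  one : (1 : M) ∉ T
  ent : ∀ i ∈ v, i < n
  len : n < v.length

variable {n : ℕ} {v : List ℕ} {T : Subsemigroup M}

theorem map_getD_range (w : List M) (d : M) : (List.range w.length).map (fun i => w.getD i d) = w := by
  apply List.ext_getElem
  · simp
  · intro i h1 h2
    simp [List.getD_eq_getElem?_getD, h2]

theorem map_getD_range_le (w : List M) (d : M) {j : ℕ} (hj : j ≤ w.length) :
    (List.range j).map (fun i => w.getD i d) = w.take j := by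
  conv_rhs => rw [← map_getD_range w d]
  rw [← List.map_take, List.take_range, min_eq_left hj]

theorem Pump.apply (H : Pump M n v T) {w : List M} (hw : w.length = n) (hT : ∀ x ∈ w, x ∈ T)
    {d : M} (hd : d ∈ T) : w.prod = (v.map (fun i => w.getD i d)).prod := by
  have := H.idt (fun i => w.getD i d) (by
    intro i h
    apply H.one
    rw [← h, List.getD_eq_getElem?_getD]
    by_cases hi : i < w.length
    · rw [List.getElem?_eq_getElem hi]; exact hT _ (List.getElem_mem hi)
    · rw [List.getElem?_eq_none (by omega)]; exact hd)
  rw [← this, ← hw, map_getD_range]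

theorem getD_mem {w : List M} (hT : ∀ x ∈ w, x ∈ T) {d : M} (hd : d ∈ T) (i : ℕ) :
    w.getD i d ∈ T := by
  rw [List.getD_eq_getElem?_getD]
  by_cases hi : i < w.length
  · rw [List.getElem?_eq_getElem hi]; exact hT _ (List.getElem_mem hi)
  · rw [List.getElem?_eq_none (by omega)]; exact hd

theorem first_diff (v : List ℕ) (n : ℕ) (hlen : n < v.length) :
    (∃ z, z ≠ [] ∧ v = List.range n ++ z) ∨
      ∃ j l0 v', j < n ∧ l0 ≠ j ∧ v = List.range j ++ l0 :: v' := by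
  induction n with
  | zero => left; exact ⟨v, by rintro rfl; simp at hlen, by simp⟩
  | succ n ih =>
    rcases ih (by omega) with ⟨z, hz, hv⟩ | ⟨j, l0, v', h1, h2, h3⟩
    · obtain ⟨l0, v', rfl⟩ := List.exists_cons_of_ne_nil hz
      by_cases h : l0 = n
      · subst h
        left
        refine ⟨v', ?_, by rw [hv, List.range_succ]; simp⟩
        rintro rfl
        rw [hv] at hlen; simp at hlen
      · right; exact ⟨n, l0, v', by omega, h, hv⟩
    · right; exact ⟨j, l0, v', by omega, h2, h3⟩

/-- Left pumping lemma -/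
theorem Pump.left [Finite M] (H : Pump M n v T) (l : List M) (hl : ∀ x ∈ l, x ∈ T)
    (hn : n ≤ l.length) (h0 : l ≠ []) :
    ∃ e ∈ T, ∃ i γ, i ≤ n ∧ In1 T γ ∧ e * e = e ∧ l.prod = (l.take i).prod * e * γ := by
  obtain ⟨d, l', rfl⟩ := List.exists_cons_of_ne_nil h0
  have hd : d ∈ T := hl d (by simp)
  generalize hL : d :: l' = l at *
  have htake : ∀ j, ∀ x ∈ l.take j, x ∈ T := fun j x hx => hl x (List.mem_of_mem_take hx)
  have hdrop : ∀ j, ∀ x ∈ l.drop j, x ∈ T := fun j x hx => hl x (List.mem_of_mem_drop hx)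
  rcases first_diff v n H.len with ⟨z, hz, hv⟩ | ⟨j, l0, v', hj, hne, hv⟩
  · -- case (i)
    have hw := H.apply (w := l.take n) (by simp [hn]) (htake n) hd
    set φ := fun i => (l.take n).getD i d with hφ
    rw [hv, List.map_append, List.prod_append, hφ, map_getD_range_le _ _ (by simp [hn]), List.take_take, min_self,
      ← hφ] at hw
    have hZ : (z.map φ).prod ∈ T := mem_prod _ (by simpa using hz) (by
      intro x hx
      obtain ⟨i, _, rfl⟩ := List.mem_map.1 hx
      exact getD_mem (htake n) hd i)
    generalize (z.map φ).prod = Z at *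
    obtain ⟨m, h1, -, h2⟩ := exists_idem_pow Z
    have hp : ∀ m, (l.take n).prod = (l.take n).prod * Z ^ m := by
      intro m
      induction m with
      | zero => simp
      | succ m ih => rw [pow_succ, ← mul_assoc, ← ih, ← hw]
    refine ⟨Z ^ m, mem_pow hZ h1, n, (l.drop n).prod, le_rfl, in1_prod _ (hdrop n), h2, ?_⟩
    rw [← hp, ← List.prod_append, List.take_append_drop]
  · have hl0 : l0 < n := H.ent l0 (by rw [hv]; simp)
    have hlen := H.len
    rcases Nat.lt_or_gt_of_ne hne with hlt | hgt
    · -- case (ii)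
      have hv' : n - j ≤ v'.length := by
        rw [hv] at hlen; simp at hlen; omega
      set B := l.getD l0 d with hB
      have hBT : B ∈ T := getD_mem hl hd l0
      have claim : ∀ k : ℕ, ∃ k', k ≤ k' ∧ ∃ γ : List M, (∀ x ∈ γ, x ∈ T) ∧ n - j ≤ γ.length ∧
          l.prod = (l.take j).prod * B ^ k' * γ.prod := by
        intro k
        induction k with
        | zero =>
          refine ⟨0, le_rfl, l.drop j, hdrop j, by simp; omega, ?_⟩
          rw [pow_zero, mul_one, ← List.prod_append, List.take_append_drop]
        | succ k ih =>
          obtain ⟨k', hk', γ, hγ, hγl, hprod⟩ := ih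
          obtain ⟨j', rfl⟩ : ∃ j', j = j' + 1 := ⟨j - 1, by omega⟩
          have hj'l : j' < l.length := by omega
          set C := l[j'] * B ^ k' with hC
          have hCT : C ∈ T := In1.mem_mul (hl _ (List.getElem_mem hj'l)) (in1_pow hBT k')
          obtain ⟨w1, hw1⟩ : ∃ w1, w1 = l.take j' ++ [C] := ⟨_, rfl⟩
          have hw1l : w1.length = j' + 1 := by simp [hw1]; omega
          have hw1p : w1.prod = (l.take (j' + 1)).prod * B ^ k' := by
            rw [hw1, List.prod_append, List.prod_singleton, hC, ← List.take_concat_get' _ _ hj'l, List.prod_append,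
              List.prod_singleton, mul_assoc]
          obtain ⟨w, hwd⟩ : ∃ w, w = w1 ++ γ.take (n - (j' + 1)) := ⟨_, rfl⟩
          have hwT : ∀ x ∈ w, x ∈ T := by
            intro x hx
            simp only [hwd, hw1, List.mem_append, List.mem_singleton] at hx
            rcases hx with (hx | rfl) | hx
            · exact htake _ _ hx
            · exact hCT
            · exact hγ _ (List.mem_of_mem_take hx)
          have hwl : w.length = n := by
            rw [hwd, List.length_append, hw1l, List.length_take]; omega
          have hap := H.apply hwl hwT hd
          set φ := fun i => w.getD i d with hφ
          rw [hv, List.map_append, List.prod_append, List.map_cons, List.prod_cons, hφ,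
            map_getD_range_le _ _ (by omega)] at hap
          rw [← hφ] at hap
          have ht : w.take (j' + 1) = w1 := by rw [hwd, ← hw1l, List.take_left]
          rw [ht, hw1p] at hap
          have hφ0 : ∃ s, 1 ≤ s ∧ w.getD l0 d = B ^ s := by
            by_cases h : l0 < j'
            · refine ⟨1, le_rfl, ?_⟩
              rw [pow_one, hB, List.getD_eq_getElem?_getD, List.getD_eq_getElem?_getD, hwd, hw1, List.append_assoc,
                List.getElem?_append_left (by simp; omega), List.getElem?_take_of_lt h]
            · have : l0 = j' := by omega
              refine ⟨1 + k', by omega, ?_⟩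
              rw [List.getD_eq_getElem?_getD, hwd, List.getElem?_append_left (by omega), hw1, List.getElem?_append_right
                (by simp; omega)]
              have h2 : B = l[j'] := by
                rw [hB, this, List.getD_eq_getElem?_getD, List.getElem?_eq_getElem hj'l]; rfl
              rw [this, List.length_take, min_eq_left hj'l.le, pow_add, pow_one, h2] 
              simp [hC, h2]
          obtain ⟨s, hs, hs'⟩ := hφ0
          rw [show φ l0 = B ^ s from hs'] at hap
          refine ⟨k' + s, by omega, v'.map φ ++ γ.drop (n - (j' + 1)), ?_, ?_, ?_⟩
          · intro x hx
            rcases List.mem_append.1 hx with hx | hx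
            · obtain ⟨i, _, rfl⟩ := List.mem_map.1 hx
              exact getD_mem hwT hd i
            · exact hγ _ (List.mem_of_mem_drop hx)
          · simp; omega
          · have : l.prod = w.prod * (γ.drop (n - (j' + 1))).prod := by
              rw [hprod, hwd, List.prod_append, hw1p, mul_assoc _ (γ.take _).prod, ← List.prod_append,
                List.take_append_drop]
            rw [this, hap, List.prod_append, pow_add]; simp only [mul_assoc]
      obtain ⟨m, h1, -, h2⟩ := exists_idem_pow B
      obtain ⟨k', hk', γ, hγ, -, hp⟩ := claim m
      refine ⟨B ^ m, mem_pow hBT h1, j, B ^ (k' - m) * γ.prod, hj.le, (in1_pow hBT _).mul (in1_prod _ hγ), h2, ?_⟩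
      rw [hp, ← mul_assoc, mul_assoc _ (B ^ m), ← pow_add, Nat.add_sub_cancel' hk']
    · -- case (iii)
      have claim : ∀ L : ℕ, ∃ w : List M, L ≤ w.length ∧ n - j ≤ w.length ∧ (∀ x ∈ w, x ∈ T) ∧
          l.prod = (l.take j).prod * w.prod := by
        intro L
        induction L with
        | zero =>
          refine ⟨l.drop j, by omega, by simp; omega, hdrop j, ?_⟩
          rw [← List.prod_append, List.take_append_drop]
        | succ L ih =>
          obtain ⟨w, hL1, hw1, hwT, hp⟩ := ih
          obtain ⟨u, hu⟩ : ∃ u, u = l.take j ++ w.take (n - j) := ⟨_, rfl⟩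
          have huT : ∀ x ∈ u, x ∈ T := by
            intro x hx
            rw [hu] at hx
            rcases List.mem_append.1 hx with hx | hx
            · exact htake _ _ hx
            · exact hwT _ (List.mem_of_mem_take hx)
          have hul : u.length = n := by simp [hu]; omega
          have hap := H.apply hul huT hd
          set φ := fun i => u.getD i d with hφ
          rw [hv, List.map_append, List.prod_append, hφ, map_getD_range_le _ _ (by omega), ← hφ] at hap
          have ht : u.take j = l.take j := by
            rw [hu, List.take_append_of_le_length (by simp; omega), List.take_take, min_self]
          rw [ht] at hap
          have hlen2 : j + 1 + v'.length > n := by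
            rw [hv] at hlen; simp at hlen; omega
          refine ⟨(l0 :: v').map φ ++ w.drop (n - j), ?_, ?_, ?_, ?_⟩
          · simp; omega
          · simp; omega
          · intro x hx
            rcases List.mem_append.1 hx with hx | hx
            · obtain ⟨i, _, rfl⟩ := List.mem_map.1 hx
              exact getD_mem huT hd i
            · exact hwT _ (List.mem_of_mem_drop hx)
          · have : l.prod = u.prod * (w.drop (n - j)).prod := by
              rw [hp, hu, List.prod_append, mul_assoc, ← List.prod_append (l₁ := w.take _), List.take_append_drop]
            rw [this, hap, List.prod_append]; simp only [mul_assoc]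
      obtain ⟨w, hL1, -, hwT, hp⟩ := claim (Nat.card M + 1)
      have pig : ∃ a b : ℕ, a < b ∧ b ≤ w.length ∧ (w.take a).prod = (w.take b).prod := by
        have := Fintype.ofFinite M
        obtain ⟨a, b, h1, h2⟩ := Fintype.exists_ne_map_eq_of_card_lt
          (fun i : Fin (Nat.card M + 1) => (w.take i).prod) (by simp)
        have h1' : (a : ℕ) ≠ b := fun h => h1 (Fin.ext h)
        have ha := a.2
        have hb := b.2
        rcases Nat.lt_or_gt_of_ne h1' with h | h
        · exact ⟨a, b, h, by omega, h2⟩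
        · exact ⟨b, a, h, by omega, h2.symm⟩
      obtain ⟨a, b, hab, hb, hpr⟩ := pig
      have hsplit : w.take b = w.take a ++ (w.take b).drop a := by
        conv_lhs => rw [← List.take_append_drop a (w.take b)]
        rw [List.take_take, min_eq_left hab.le]
      obtain ⟨Z, hZd⟩ : ∃ Z, Z = ((w.take b).drop a).prod := ⟨_, rfl⟩
      have hZ : Z ∈ T := by
        rw [hZd]
        refine mem_prod _ ?_ (fun x hx => hwT _ (List.mem_of_mem_take (List.mem_of_mem_drop hx)))
        intro h
        have := congrArg List.length h
        simp at this; omega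
      rw [hsplit, List.prod_append, ← hZd] at hpr
      obtain ⟨A, hA⟩ : ∃ A, A = (w.take a).prod := ⟨_, rfl⟩
      obtain ⟨D, hD⟩ : ∃ D, D = (w.drop a).prod := ⟨_, rfl⟩
      have hA1 : In1 T A := by rw [hA]; exact in1_prod _ fun x hx => hwT _ (List.mem_of_mem_take hx)
      have hD1 : In1 T D := by rw [hD]; exact in1_prod _ fun x hx => hwT _ (List.mem_of_mem_drop hx)
      have hwp : w.prod = A * D := by rw [hA, hD, ← List.prod_append, List.take_append_drop]
      rw [← hA] at hpr
      have hAm : ∀ m, A = A * Z ^ m := by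
        intro m
        induction m with
        | zero => simp
        | succ m ih => rw [pow_succ, ← mul_assoc, ← ih, ← hpr]
      obtain ⟨m, h1, -, h2⟩ := exists_idem_pow Z
      have heT := mem_pow hZ h1
      have hAe := hAm m
      generalize Z ^ m = e at *
      obtain ⟨u, hu⟩ : ∃ u, u = l.take j ++ ((A * e) :: (List.replicate (n - j - 2) e ++ [e * D])) := ⟨_, rfl⟩
      have huT : ∀ x ∈ u, x ∈ T := by
        intro x hx
        simp only [hu, List.mem_append, List.mem_cons, List.mem_replicate, List.not_mem_nil, or_false] at hx
        rcases hx with hx | rfl | ⟨_, rfl⟩ | rfl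
        · exact htake _ _ hx
        · exact hA1.mul_mem heT
        · exact heT
        · exact In1.mem_mul heT hD1
      have hul : u.length = n := by simp [hu]; omega
      have hup : u.prod = l.prod := by
        rw [hp, hwp, hu]
        have : ∀ k x, e ^ k * (e * x) = e * x := by
          intro k x
          induction k with
          | zero => simp
          | succ k ih => rw [pow_succ, mul_assoc, ← mul_assoc e e, h2, ih]
        simp only [List.prod_append, List.prod_cons, List.prod_replicate, List.prod_nil, mul_one, this]
        rw [mul_assoc A e, ← mul_assoc e e, h2, ← mul_assoc A e, ← hAe]
      have hap := H.apply hul huT hd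
      set φ := fun i => u.getD i d with hφ
      rw [hv, List.map_append, List.prod_append, hφ, map_getD_range_le _ _ (by omega), ← hφ, List.map_cons,
        List.prod_cons] at hap
      have ht : u.take j = l.take j := by
        rw [hu, List.take_append_of_le_length (by simp; omega), List.take_take, min_self]
      rw [ht, hup] at hap
      have hφ0 : ∃ y, In1 T y ∧ φ l0 = e * y := by
        obtain ⟨r, hr⟩ : ∃ r, l0 = j + 1 + r := ⟨l0 - j - 1, by omega⟩
        have h3 : (l.take j).length = j := by simp; omega
        have h4 : u[l0]? = (List.replicate (n - j - 2) e ++ [e * D])[r]? := by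
          rw [hu, List.getElem?_append_right (by omega), h3, hr, show j + 1 + r - j = r + 1 by omega,
            List.getElem?_cons_succ]
        by_cases h5 : r < n - j - 2
        · refine ⟨1, Or.inl rfl, ?_⟩
          simp only [hφ]
          rw [List.getD_eq_getElem?_getD, h4, List.getElem?_append_left (by simpa using h5)]
          simp [h5]
        · refine ⟨D, hD1, ?_⟩
          simp only [hφ]
          rw [List.getD_eq_getElem?_getD, h4, List.getElem?_append_right (by simpa using h5)]
          have : r - (n - j - 2) = 0 := by omega
          simp [this]
      obtain ⟨y, hy, hy'⟩ := hφ0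
      refine ⟨e, heT, j, y * (v'.map φ).prod, hj.le, hy.mul (in1_prod _ ?_), h2, ?_⟩
      · intro x hx
        obtain ⟨i, _, rfl⟩ := List.mem_map.1 hx
        exact getD_mem huT hd i
      · rw [hap, hy']; simp only [mul_assoc]

open MulOpposite in
theorem Pump.right [Finite M] (H : Pump M n v T) (l : List M) (hl : ∀ x ∈ l, x ∈ T)
    (hn : n ≤ l.length) (h0 : l ≠ []) :
    ∃ e ∈ T, ∃ (q : List M) (γ : M), q.length ≤ n ∧ (∀ x ∈ q, x ∈ l) ∧ In1 T γ ∧ e * e = e ∧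
      l.prod = γ * e * q.prod := by
  have H' : Pump Mᵐᵒᵖ n (v.map (fun i => n - 1 - i)).reverse T.op := by
    refine ⟨?_, ?_, ?_, by simpa using H.len⟩
    · intro φ hφ
      have := H.idt (fun i => unop (φ (n - 1 - i))) (fun i h => hφ (n - 1 - i) (unop_injective h))
      apply unop_injective
      rw [unop_list_prod, unop_list_prod]
      have hrr : (List.range n).reverse = (List.range n).map (fun i => n - 1 - i) := by
        apply List.ext_getElem
        · simp
        · intro i h1 h2
          simp
      simp only [← List.map_reverse, List.reverse_reverse, hrr]
      simp only [List.map_map]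
      exact this
    · exact H.one
    · intro i hi
      simp only [List.mem_reverse, List.mem_map] at hi
      obtain ⟨k, hk, rfl⟩ := hi
      have := H.ent k hk
      omega
  have : Finite Mᵐᵒᵖ := Finite.of_equiv M opEquiv
  obtain ⟨e, he, i, γ, hi, hγ, hee, hp⟩ := H'.left (l.map op).reverse (by
    intro x hx
    simp only [List.mem_reverse, List.mem_map] at hx
    obtain ⟨y, hy, rfl⟩ := hx
    exact hl y hy) (by simpa using hn) (by simpa using h0)
  refine ⟨unop e, he, (((l.map op).reverse.take i).map unop).reverse, unop γ, by simp; omega, ?_, ?_, ?_, ?_⟩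
  · intro x hx
    simp only [List.mem_reverse, List.mem_map] at hx
    obtain ⟨y, hy, rfl⟩ := hx
    have := List.mem_of_mem_take hy
    simp only [List.mem_reverse, List.mem_map] at this
    obtain ⟨z, hz, rfl⟩ := this
    exact hz
  · rcases hγ with h | h
    · left; rw [h]; rfl
    · right; exact h
  · rw [← unop_mul, hee]
  · have h3 := congrArg unop hp
    rw [unop_list_prod, unop_mul, unop_mul, unop_list_prod] at h3
    rw [← List.map_reverse, List.reverse_reverse, List.map_map] at h3
    have h4 : List.map (unop ∘ op) l = l := by
      have : (unop ∘ op : M → M) = id := rfl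
      rw [this, List.map_id]
    rw [h4] at h3
    rw [h3, mul_assoc]

/-- blocks contain idempotents -/
theorem Pump.block [Finite M] (H : Pump M n v T) (l : List M) (hl : ∀ x ∈ l, x ∈ T)
    (hn : n ≤ l.length) (h0 : l ≠ []) :
    ∃ p e q : M, e ≠ 1 ∧ e * e = e ∧ l.prod = p * e * q := by
  obtain ⟨e, he, i, γ, hi, hγ, hee, hp⟩ := H.left l hl hn h0
  exact ⟨_, e, _, fun h => H.one (h ▸ he), hee, hp⟩

theorem Pump.split [Finite M] (H : Pump M n v T) (l : List M) (hl : ∀ x ∈ l, x ∈ T)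
    (hn : 2 * n ≤ l.length) (hn0 : 1 ≤ n) :
    ∃ p q : List M, p.length ≤ n ∧ q.length ≤ n ∧ (∀ x ∈ p, x ∈ l) ∧ (∀ x ∈ q, x ∈ l) ∧
      ∃ e ∈ T, ∃ f ∈ T, ∃ γ, In1 T γ ∧ e * e = e ∧ f * f = f ∧
        l.prod = p.prod * (e * γ * f) * q.prod := by
  obtain ⟨e, he, i, γ, hi, hγ, hee, hp⟩ := H.left (l.take n)
    (fun x hx => hl _ (List.mem_of_mem_take hx)) (by simp; omega) (by
      intro h; have := congrArg List.length h; simp only [List.length_take, List.length_nil] at this; omega)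
  obtain ⟨f, hf, q, γ', hq, hql, hγ', hff, hp'⟩ := H.right (l.drop n)
    (fun x hx => hl _ (List.mem_of_mem_drop hx)) (by simp; omega) (by
      intro h; have := congrArg List.length h; simp only [List.length_drop, List.length_nil] at this; omega)
  refine ⟨(l.take n).take i, q, by rw [List.length_take]; omega, hq, fun x hx => List.mem_of_mem_take (List.mem_of_mem_take hx),
    fun x hx => List.mem_of_mem_drop (hql x hx), e, he, f, hf, γ * γ', hγ.mul hγ', hee, hff, ?_⟩
  conv_lhs => rw [← List.take_append_drop n l, List.prod_append, hp, hp']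
  simp only [mul_assoc]

end
end SLC


namespace SLC

theorem exists_group {M : Type} [Monoid M] (h : M) (hh : h * h = h) :
    ∃ (G : Type) (_ : Group G) (ι : G →ₙ* M), Function.Injective ι ∧ ι 1 = h ∧
      ∀ x y, h * x = x → x * h = x → h * y = y → y * h = y → x * y = h → y * x = h →
        ∃ u, ι u = x := by
  let K : Type := {x : M // h * x = x ∧ x * h = x}
  let _ : Monoid K :=
    { mul := fun a b => ⟨a.1 * b.1, by rw [← mul_assoc, a.2.1], by rw [mul_assoc, b.2.2]⟩
      one := ⟨h, hh, hh⟩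
      mul_assoc := fun a b c => Subtype.ext (mul_assoc a.1 b.1 c.1)
      one_mul := fun a => Subtype.ext a.2.1
      mul_one := fun a => Subtype.ext a.2.2 }
  refine ⟨Kˣ, inferInstance, ⟨fun u => u.val.val, fun a b => rfl⟩, ?_, rfl, ?_⟩
  · intro a b hab
    exact Units.ext (Subtype.ext hab)
  · intro x y h1 h2 h3 h4 h5 h6
    exact ⟨⟨⟨x, h1, h2⟩, ⟨y, h3, h4⟩, Subtype.ext h5, Subtype.ext h6⟩, rfl⟩

/-- the group costs below `M` are bounded by `C` -/
def GB (M : Type) [Monoid M] (C : ℕ) : Prop :=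
  ∀ (G : Type) [Group G] (ι : G →ₙ* M), Function.Injective ι → (∀ x, ι x ≠ 1) →
    ∀ (Γ : Set G) (t : G), t ∈ Subsemigroup.closure Γ → ∃ L : List G, IsSLSeq Γ L ∧ t ∈ L ∧ L.length ≤ C

theorem exists_blocks {M : Type*} (n : ℕ) (hn : 1 ≤ n) (k : ℕ) : ∀ l : List M, l.length ≤ k → n ≤ l.length →
    ∃ bs : List (List M), bs ≠ [] ∧ bs.flatten = l ∧ ∀ b ∈ bs, n ≤ b.length ∧ b.length ≤ 2 * n := by
  induction k with
  | zero => intro l h1 h2; omega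
  | succ k ih =>
    intro l h1 h2
    by_cases h3 : l.length ≤ 2 * n
    · exact ⟨[l], by simp, by simp, by simp; omega⟩
    · obtain ⟨bs, h4, h5, h6⟩ := ih (l.drop n) (by simp; omega) (by simp; omega)
      refine ⟨l.take n :: bs, by simp, by simp [h5], ?_⟩
      intro b hb
      rcases List.mem_cons.1 hb with rfl | hb
      · rw [List.length_take]; omega
      · exact h6 b hb

section
variable {M : Type} [Monoid M] {n i E : ℕ} {v : List ℕ} {T : Subsemigroup M}

open Classical in
/-- choice of `h` -/
theorem Hyp.exists_h [Finite M] (H : Hyp M n v i E) (lg : List M) :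
    ∃ B : Finset M, (∀ s ∈ B, s ∈ lg) ∧ (∀ s ∈ lg, Ab (B.toList.prod ^ E) s) ∧
      2 ^ B.card ≤ Nat.card M := by
  let P : Finset M → Prop := fun B => (∀ s ∈ B, s ∈ lg) ∧ (∀ s ∈ lg, Ab (B.toList.prod ^ E) s)
  have abF : ∀ (B : Finset M), ∀ s ∈ B, Ab (B.toList.prod ^ E) s := fun B s hs =>
    (SLC.ab_pow _ H.E_ne).trans (SLC.ab_prod (by simpa using hs))
  have hex : ∃ k, ∃ B, P B ∧ B.card = k :=
    ⟨_, lg.toFinset, ⟨by simp, fun s hs => abF _ s (by simpa using hs)⟩, rfl⟩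
  obtain ⟨B, hB, hcard⟩ := Nat.find_spec hex
  have hmin : ∀ B', P B' → B.card ≤ B'.card := by
    intro B' hB'
    rw [hcard]
    exact Nat.find_min' hex ⟨B', hB', rfl⟩
  refine ⟨B, hB.1, hB.2, ?_⟩
  have key : ∀ C D, C ⊆ B → D ⊆ B → C.toList.prod ^ E = D.toList.prod ^ E → C ⊆ D := by
    intro C D hC hD hCD b hb
    by_contra hbD
    have hlt : (D ∪ (B \ C)).card < B.card := by
      apply Finset.card_lt_card
      refine Finset.ssubset_iff_subset_ne.2 ⟨Finset.union_subset hD Finset.sdiff_subset, ?_⟩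
      intro h
      have : b ∈ D ∪ (B \ C) := by rw [h]; exact hC hb
      simp [hbD, hb] at this
    refine absurd (hmin (D ∪ (B \ C)) ⟨?_, ?_⟩) (by omega)
    · intro s hs
      rcases Finset.mem_union.1 hs with hs | hs
      · exact hB.1 s (hD hs)
      · exact hB.1 s (Finset.mem_sdiff.1 hs).1
    · have hid := H.idem (D ∪ (B \ C)).toList.prod
      have hD2 : Ab ((D ∪ (B \ C)).toList.prod ^ E) (D.toList.prod ^ E) :=
        H.ab_pow hid (H.ab_prod hid _ (fun x hx => abF _ x (by
          rw [Finset.mem_union]; left; simpa using hx))) _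
      have hB2 : ∀ s ∈ B, Ab ((D ∪ (B \ C)).toList.prod ^ E) s := by
        intro s hs
        by_cases hsC : s ∈ C
        · rw [← hCD] at hD2
          exact hD2.trans (abF C s hsC)
        · exact abF _ s (by simp [hs, hsC])
      have hBB : Ab ((D ∪ (B \ C)).toList.prod ^ E) (B.toList.prod ^ E) :=
        H.ab_pow hid (H.ab_prod hid _ (fun x hx => hB2 x (by simpa using hx))) _
      exact fun s hs => hBB.trans (hB.2 s hs)
  have := Fintype.ofFinite M
  rw [Nat.card_eq_fintype_card, ← Finset.card_powerset, ← Finset.card_univ]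
  refine Finset.card_le_card_of_injOn (fun C => C.toList.prod ^ E) (fun _ _ => by simp) ?_
  intro C hC D hD hCD
  simp only [Finset.coe_powerset, Set.mem_preimage, Set.mem_powerset_iff, Finset.coe_subset] at hC hD
  exact Finset.Subset.antisymm (key C D hC hD hCD) (key D C hD hC hCD.symm)

/-- the elements of the group which need to be computed -/
def Gam {G : Type} [Group G] (ι : G →ₙ* M) (h : M) (W : Set M) : Set G :=
  {u | (∃ w ∈ W, ι u = h * w * h) ∨ (∃ w ∈ W, ∃ w' ∈ W, ι u = h * (w * w') * h) ∨
    ∃ w ∈ W, ι u⁻¹ = h * w * h}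

theorem Hyp.exists_unit (H : Hyp M n v i E) {h : M} (hh : h * h = h) {G : Type} [Group G] {ι : G →ₙ* M}
    (hu : ∀ x y, h * x = x → x * h = x → h * y = y → y * h = y → x * y = h → y * x = h →
        ∃ u, ι u = x) {w : M} (hw : Ab h w) : ∃ u, ι u = h * w * h := by
  obtain ⟨j, hj⟩ := Nat.exists_eq_add_of_le' H.one_le
  have hc := H.c2 hh hw
  have l1 : h * (h * w * h) = h * w * h := by rw [← mul_assoc, ← mul_assoc, hh]
  have l2 : (h * w * h) * h = h * w * h := by rw [mul_assoc, hh]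
  generalize h * w * h = x at *
  have hk : x ^ (2 * j + 1) * x = h := by
    rw [← pow_succ, show 2 * j + 1 + 1 = E + E by omega, pow_add, hc, hh]
  refine hu x (x ^ (2 * j + 1)) l1 l2 ?_ ?_ ?_ hk
  · rw [pow_succ', ← mul_assoc, l1]
  · rw [pow_succ, mul_assoc, l2]
  · rw [← pow_succ', pow_succ, hk]

/-- algebraic part -/
theorem Hyp.gam (H : Hyp M n v i E) {h g : M} (h1 : h ≠ 1) (hh : h * h = h) {G : Type} [Group G]
    {ι : G →ₙ* M} (hone : ι 1 = h)
    (hu : ∀ x y, h * x = x → x * h = x → h * y = y → y * h = y → x * y = h → y * x = h →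
        ∃ u, ι u = x) (W : Set M) (hW : ∀ w ∈ W, Ab h w)
    (hWb : ∀ w ∈ W, ∃ p e q, e ≠ 1 ∧ e * e = e ∧ w = p * e * q)
    (ws : List M) (hws : ∀ w ∈ ws, w ∈ W) (hws0 : ws ≠ []) (hg : g = ws.prod) (gJ : Jc h g) :
    ∃ w ∈ W, ∃ w' ∈ W, ∃ y ∈ Subsemigroup.closure (Gam ι h W), g = w * ι y * w' := by
  have hJ : Jc h h := ⟨Ab.refl h, Ab.refl h⟩
  have hι1 : ∀ u, h * ι u = ι u := fun u => by rw [← hone, ← map_mul, one_mul]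
  have hι2 : ∀ u, ι u * h = ι u := fun u => by rw [← hone, ← map_mul, mul_one]
  have eu : ∀ w, Ab h w → ∃ u, ι u = h * w * h := fun w hw => H.exists_unit hh hu hw
  have df : ∀ w ∈ W, ∀ u, ι u = h * w * h → ∀ X Y, Jc h X → Jc h Y →
      X * w * h * ι u⁻¹ * (h * w * Y) = X * w * Y := by
    intro w hw u huw X Y hX hY
    have hAb := hW w hw
    obtain ⟨p, e, q, e1, ee, rfl⟩ := hWb w hw
    exact H.dformula h1 hh e1 ee hAb (by rw [← huw, ← map_mul, inv_mul_cancel, hone]) (hι1 _) hX hY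
  have aP : ∀ l : List M, (∀ w ∈ l, w ∈ W) → Ab h l.prod := fun l hl => H.ab_prod hh l fun w hw => hW w (hl w hw)
  have claim : ∀ (l : List M) (w : M), w ∈ W → (∀ w ∈ l, w ∈ W) →
      ∃ u ∈ Subsemigroup.closure (Gam ι h W), ι u = h * (w * l.prod) * h := by
    intro l
    induction l with
    | nil =>
      intro w hw _
      obtain ⟨u, hu⟩ := eu w (hW w hw)
      exact ⟨u, Subsemigroup.subset_closure (Or.inl ⟨w, hw, hu⟩), by simpa using hu⟩
    | cons w2 R ih =>
      intro w hw hl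
      have hw2 : w2 ∈ W := hl w2 (by simp)
      have hR : ∀ w ∈ R, w ∈ W := fun w hw => hl w (by simp [hw])
      obtain ⟨u, hu, hu'⟩ := ih w2 hw2 hR
      obtain ⟨u1, hu1⟩ := eu (w * w2) (H.ab_mul hh (hW _ hw2) (hW _ hw))
      obtain ⟨u2, hu2⟩ := eu w2 (hW _ hw2)
      refine ⟨u1 * u2⁻¹ * u, Subsemigroup.mul_mem _ (Subsemigroup.mul_mem _
        (Subsemigroup.subset_closure (Or.inr (Or.inl ⟨w, hw, w2, hw2, hu1⟩)))
        (Subsemigroup.subset_closure (Or.inr (Or.inr ⟨w2, hw2, by rw [inv_inv, hu2]⟩)))) hu, ?_⟩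
      rw [map_mul, map_mul, hu1, hu']
      have := df w2 hw2 u2 hu2 (h * w) (R.prod * h) (Jc.mul_right H hh hJ (hW _ hw))
        (Jc.mul_left H hh (aP R hR) hJ)
      simpa only [mul_assoc, List.prod_cons] using this
  have xg := H.jc_pow hh gJ
  have gx := H.jc_pow' hh gJ
  have xJ := Jc.pow H hh gJ H.E_ne
  obtain ⟨w1, R, hw1R⟩ := List.exists_cons_of_ne_nil hws0
  have hw1 : w1 ∈ W := hws w1 (by simp [hw1R])
  have hR : ∀ w ∈ R, w ∈ W := fun w hw => hws w (by simp [hw1R, hw])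
  obtain ⟨R', w2, hw2R⟩ : ∃ R' w2, ws = R' ++ [w2] :=
    ⟨ws.dropLast, ws.getLast hws0, (List.dropLast_append_getLast hws0).symm⟩
  have hw2 : w2 ∈ W := hws w2 (by simp [hw2R])
  have hR' : ∀ w ∈ R', w ∈ W := fun w hw => hws w (by simp [hw2R, hw])
  have hg1 : g = w1 * R.prod := by rw [hg, hw1R, List.prod_cons]
  have hg2 : g = R'.prod * w2 := by rw [hg, hw2R]; simp
  obtain ⟨u, huΓ, hu'⟩ := claim R w1 hw1 hR
  rw [← hg1] at hu'
  obtain ⟨u1, hu1⟩ := eu w1 (hW _ hw1)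
  obtain ⟨u2, hu2⟩ := eu w2 (hW _ hw2)
  have la : g ^ E * w1 * h = w1 * h := by
    obtain ⟨p, e, q, e1, ee, hpe⟩ := hWb w1 hw1
    have := H.left_absorb (R := R.prod) h1 hh e1 ee (by rw [hg1, hpe]) gJ
    rw [hpe]; exact this
  have ra : h * w2 * g ^ E = h * w2 := by
    obtain ⟨p, e, q, e1, ee, hpe⟩ := hWb w2 hw2
    have := H.right_absorb (R := R'.prod) h1 hh e1 ee (by rw [hg2, hpe]) gJ
    rw [hpe]; exact this
  have d1 := df w1 hw1 u1 hu1 (g ^ E) (R.prod * g ^ E) xJ (Jc.mul_left H hh (aP R hR) xJ)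
  have d2 := df w2 hw2 u2 hu2 (g ^ E * R'.prod) (g ^ E) (Jc.mul_right H hh xJ (aP R' hR')) xJ
  generalize g ^ E = x at *
  have k1 : w1 * ι u1⁻¹ * (h * g) = g := by
    have e1 : x * w1 * h * ι u1⁻¹ * (h * w1 * (R.prod * x)) = w1 * (h * ι u1⁻¹) * (h * ((w1 * R.prod) * x)) := by
      rw [la]; simp only [mul_assoc]
    have e2 : x * w1 * (R.prod * x) = x * ((w1 * R.prod) * x) := by simp only [mul_assoc]
    rw [e1, e2, ← hg1, gx, xg, hι1] at d1
    exact d1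
  have k2 : (g * h) * ι u2⁻¹ * w2 = g := by
    have e1 : x * R'.prod * w2 * h * ι u2⁻¹ * (h * w2 * x) = (x * (R'.prod * w2)) * h * (ι u2⁻¹ * h) * w2 := by
      rw [ra]; simp only [mul_assoc]
    have e2 : x * R'.prod * w2 * x = (x * (R'.prod * w2)) * x := by simp only [mul_assoc]
    rw [e1, e2, ← hg2, xg, gx, hι2] at d2
    exact d2
  refine ⟨w1, hw1, w2, hw2, u1⁻¹ * u * u2⁻¹, Subsemigroup.mul_mem _ (Subsemigroup.mul_mem _
        (Subsemigroup.subset_closure (Or.inr (Or.inr ⟨w1, hw1, by rw [inv_inv, hu1]⟩))) huΓ)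
        (Subsemigroup.subset_closure (Or.inr (Or.inr ⟨w2, hw2, by rw [inv_inv, hu2]⟩))), ?_⟩
  rw [map_mul, map_mul, hu']
  calc g = w1 * ι u1⁻¹ * (h * ((g * h) * ι u2⁻¹ * w2)) := by rw [k2, k1]
    _ = _ := by simp only [mul_assoc]


theorem log_m {N m : ℕ} (hm : m ≤ (N + 1) ^ 2) : Nat.log 2 m ≤ 2 * Nat.log 2 N + 2 := by
  have h1 : N < 2 ^ (Nat.log 2 N + 1) := Nat.lt_pow_succ_log_self (by norm_num) N
  have h2 : m ≤ 2 ^ (2 * Nat.log 2 N + 2) := by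
    refine hm.trans ((Nat.pow_le_pow_left (Nat.succ_le_of_lt h1) 2).trans ?_)
    rw [← pow_mul]; apply le_of_eq; congr 1; ring
  calc Nat.log 2 m ≤ Nat.log 2 (2 ^ (2 * Nat.log 2 N + 2)) := Nat.log_mono_right h2
    _ = _ := Nat.log_pow (by norm_num) _

open Classical in
/-- cost of an element of a block group -/
theorem Hyp.core [Finite M] (H : Hyp M n v i E) (P : Pump M n v T) (hn0 : 1 ≤ n) {C : ℕ}
    (hGB : GB M C) (A : Set M) (h1A : (1 : M) ∈ A) (lg : List M) (hA : ∀ s ∈ lg, s ∈ A)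
    (hT : ∀ s ∈ lg, s ∈ T) (hlen : n ≤ lg.length) (hreg : lg.prod ^ E * lg.prod = lg.prod) :
    Can A ((4 * n + 6) * C + 7 * Nat.log 2 (Nat.card M) + (4 * n + 6)) {lg.prod} := by
  obtain ⟨B, hB1, hB2, hB3⟩ := H.exists_h lg
  have hlg0 : lg ≠ [] := by rintro rfl; simp at hlen; omega
  obtain ⟨m, hm1, hm2, hm3⟩ := exists_idem_pow B.toList.prod
  have hhm : B.toList.prod ^ E = B.toList.prod ^ m :=
    idem_unique H.E_ne (by omega) (H.idem _) hm3
  have hh := H.idem B.toList.prod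
  obtain ⟨h, hhd⟩ : ∃ h, h = B.toList.prod ^ E := ⟨_, rfl⟩
  have c1 : Can A (5 * Nat.log 2 (Nat.card M) + 4) {h} := by
    rw [hhd, hhm]
    have d1 := can_list h1A B.toList (fun x hx => hA x (hB1 x (by simpa using hx)))
    have d2 := can_pow (A := A ∪ {B.toList.prod}) B.toList.prod m (by omega) (by simp)
    refine (d1.trans' d2).mono_k ?_
    have := log_m hm2
    have : B.card ≤ Nat.log 2 (Nat.card M) := Nat.le_log_of_pow_le (by norm_num) hB3
    rw [Finset.length_toList]
    omega
  have hAbs : ∀ s ∈ lg, Ab h s := by rw [hhd]; exact hB2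
  have hgx : Ab (lg.prod ^ E) h := by
    rw [hhd]
    refine H.ab_pow (H.idem _) (H.ab_prod (H.idem _) _ ?_) _
    intro x hx
    exact (SLC.ab_pow _ H.E_ne).trans (SLC.ab_prod (hB1 x (by simpa using hx)))
  rw [← hhd] at hh
  have gJ : Jc h lg.prod := by
    refine ⟨?_, H.ab_prod hh lg hAbs⟩
    have : Ab lg.prod (lg.prod ^ E) := by
      conv_lhs => rw [← hreg]
      exact ab_mul_left _ _
    exact this.trans hgx
  have h1 : h ≠ 1 := by
    obtain ⟨s, l, hs⟩ := List.exists_cons_of_ne_nil hlg0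
    have hs' : s ∈ lg := by simp [hs]
    refine H.irr.ne_of_ab ?_ (hAbs s hs')
    rintro rfl
    exact P.one (hT _ hs')
  obtain ⟨G, _, ι, hinj, hone, hu⟩ := exists_group h hh
  have : Finite G := Finite.of_injective ι hinj
  let W : Set M := {w | ∃ s : List M, (∀ x ∈ s, x ∈ lg) ∧ n ≤ s.length ∧ s.length ≤ 2 * n ∧ w = s.prod}
  obtain ⟨bs, hbs0, hbsf, hbs⟩ := exists_blocks n hn0 lg.length lg le_rfl hlen
  obtain ⟨w, hw, w', hw', y, hy, hg⟩ := H.gam (g := lg.prod) h1 hh hone hu W (by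
      rintro w ⟨s, hs, -, -, rfl⟩
      exact H.ab_prod hh s fun x hx => hAbs x (hs x hx))
    (by
      rintro w ⟨s, hs, hs1, -, rfl⟩
      exact P.block s (fun x hx => hT x (hs x hx)) hs1 (by rintro rfl; simp at hs1; omega))
    (bs.map List.prod) (by
      intro w hw
      obtain ⟨b, hb, rfl⟩ := List.mem_map.1 hw
      refine ⟨b, fun x hx => ?_, (hbs b hb).1, (hbs b hb).2, rfl⟩
      rw [← hbsf]; exact List.mem_flatten.2 ⟨b, hb, hx⟩) (by simpa using hbs0)
    (by rw [← hbsf, List.prod_flatten]) gJ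
  have hne : ∀ x, ι x ≠ 1 := by
    intro x hx
    have : ι x = h * ι x := by rw [← hone, ← map_mul, one_mul]
    rw [hx] at this
    rw [mul_one] at this
    exact h1 this.symm
  obtain ⟨L, hL1, hL2, hL3⟩ := hGB G ι hinj hne (Gam ι h W) y hy
  have hδ : ∀ γ : G, ∃ δ : G, γ ∈ Gam ι h W → (δ = γ ∨ δ⁻¹ = γ) ∧ ∃ s : List M, (∀ x ∈ s, x ∈ A) ∧
      s.length ≤ 4 * n ∧ ι δ = h * s.prod * h := by
    intro γ
    by_cases hγ : γ ∈ Gam ι h W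
    · rcases hγ with ⟨w, ⟨s, hs, _, hs2, rfl⟩, hw⟩ | ⟨w, ⟨s, hs, _, hs2, rfl⟩, w', ⟨s', hs', _, hs2', rfl⟩, hw⟩ |
        ⟨w, ⟨s, hs, _, hs2, rfl⟩, hw⟩
      · exact ⟨γ, fun _ => ⟨Or.inl rfl, s, fun x hx => hA _ (hs x hx), by omega, hw⟩⟩
      · refine ⟨γ, fun _ => ⟨Or.inl rfl, s ++ s', fun x hx => ?_, by simp; omega, by simpa using hw⟩⟩
        rcases List.mem_append.1 hx with hx | hx
        · exact hA _ (hs x hx)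
        · exact hA _ (hs' x hx)
      · exact ⟨γ⁻¹, fun _ => ⟨Or.inr (inv_inv γ), s, fun x hx => hA _ (hs x hx), by omega, hw⟩⟩
    · exact ⟨1, fun h => absurd h hγ⟩
  choose δ hδ using hδ
  obtain ⟨L', hL'⟩ : ∃ L', L' = L.filter (fun γ => γ ∈ Gam ι h W) := ⟨_, rfl⟩
  have hL'len : L'.length ≤ C := by rw [hL']; exact (List.length_filter_le _ _).trans hL3
  have hL'mem : ∀ γ, γ ∈ L' ↔ γ ∈ L ∧ γ ∈ Gam ι h W := by intro γ; rw [hL']; simp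
  -- the elements `ι (δ γ)`
  have c2 : Can (A ∪ {h}) (C * (4 * n + 2)) {x | ∃ γ ∈ L', x = ι (δ γ)} := by
    have := Can.biUnion (A := A ∪ {h}) (fun γ => {ι (δ γ)}) (4 * n + 2) L' (by
      intro γ hγ
      obtain ⟨-, s, hs, hs2, hs3⟩ := hδ γ ((hL'mem γ).1 hγ).2
      rw [hs3]
      have d1 : Can (A ∪ {h}) s.length {s.prod} := can_list (by simp [h1A]) s (fun x hx => Or.inl (hs x hx))
      have d0 : Can (A ∪ {h}) 0 {h} := .nil (by simp)
      exact ((d0.mul' d1).mul' d0).mono_k (by omega))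
    exact (this.mono_k (Nat.mul_le_mul_right _ hL'len)).mono_right (by
      rintro x ⟨γ, hγ, rfl⟩
      exact ⟨γ, hγ, rfl⟩)
  have c3 : Can (A ∪ {h} ∪ {x | ∃ γ ∈ L', x = ι (δ γ)}) (3 * C + 2 * Nat.log 2 (Nat.card M))
      (ι '' {x | x⁻¹ ∈ L'.map δ}) := by
    have := (can_inv (A := insert 1 {x | ∃ γ ∈ L', x = δ γ}) (Set.mem_insert _ _) (L'.map δ) (by
      intro x hx
      obtain ⟨γ, hγ, rfl⟩ := List.mem_map.1 hx
      exact Or.inr ⟨γ, hγ, rfl⟩)).image ι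
    refine (this.mono_left ?_).mono_k ?_
    · rintro _ ⟨x, rfl | ⟨γ, hγ, rfl⟩, rfl⟩
      · left; right; exact hone
      · right; exact ⟨γ, hγ, rfl⟩
    · have h3 : Nat.log 2 (Nat.card G) ≤ Nat.log 2 (Nat.card M) :=
        Nat.log_mono_right (Nat.card_le_card_of_injective ι hinj)
      rw [List.length_map]
      omega
  have c4 : Can (A ∪ {h} ∪ {x | ∃ γ ∈ L', x = ι (δ γ)} ∪ (ι '' {x | x⁻¹ ∈ L'.map δ})) C {ι y} := by
    have := ((can_of_seq L hL1).image ι).mono_right (Y := {ι y}) (by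
      rintro _ rfl
      exact ⟨y, hL2, rfl⟩)
    refine (this.mono_left ?_).mono_k hL3
    rintro _ ⟨γ, ⟨hγ1, hγ2⟩, rfl⟩
    have hγ' := (hL'mem γ).2 ⟨hγ2, hγ1⟩
    rcases (hδ γ hγ1).1 with h5 | h5
    · left; right; exact ⟨γ, hγ', by rw [h5]⟩
    · right
      refine ⟨γ, ?_, rfl⟩
      refine List.mem_map.2 ⟨γ, hγ', ?_⟩
      rw [← h5, inv_inv, h5]
  have c5 := c1.trans' (c2.trans' (c3.trans' c4))
  obtain ⟨s, hs, -, hs2, rfl⟩ := hw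
  obtain ⟨s', hs', -, hs2', rfl⟩ := hw'
  have d1 := can_list h1A s (fun x hx => hA x (hs x hx))
  have d2 := can_list h1A s' (fun x hx => hA x (hs' x hx))
  rw [hg]
  refine ((d1.mul' c5).mul' d2).mono_k ?_
  have : (4 * n + 6) * C = C * (4 * n + 2) + 4 * C := by ring
  omega

/-- main bound in the non-permutation case -/
theorem Hyp.caseB [Finite M] (H : Hyp M n v i E) (P : Pump M n v T) (hn0 : 1 ≤ n) {C : ℕ}
    (hGB : GB M C) (Sig : Set M) (hT : T = Subsemigroup.closure Sig) (t : M) (ht : t ∈ T) :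
    Can (insert 1 Sig) ((4 * n + 6) * C + 7 * Nat.log 2 (Nat.card M) + (6 * n + 8)) {t} := by
  have hlist : ∀ t ∈ T, ∃ l : List M, l ≠ [] ∧ (∀ x ∈ l, x ∈ Sig) ∧ l.prod = t := by
    intro t ht
    rw [hT] at ht
    induction ht using Subsemigroup.closure_induction with
    | mem x hx => exact ⟨[x], by simp, by simpa using hx, by simp⟩
    | mul x y _ _ h1 h2 =>
      obtain ⟨l1, a1, b1, rfl⟩ := h1
      obtain ⟨l2, a2, b2, rfl⟩ := h2
      refine ⟨l1 ++ l2, by simp [a1], fun x hx => ?_, by simp⟩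
      rcases List.mem_append.1 hx with hx | hx
      · exact b1 x hx
      · exact b2 x hx
  have hST : ∀ x ∈ Sig, x ∈ T := fun x hx => by rw [hT]; exact Subsemigroup.subset_closure hx
  obtain ⟨l, hl0, hl, rfl⟩ := hlist t ht
  by_cases hlen : l.length < 2 * n
  · exact (can_list (Set.mem_insert 1 Sig) l (fun x hx => Or.inr (hl x hx))).mono_k (by omega)
  obtain ⟨p, q, hp, hq, hp', hq', e, he, f, hf, γ, hγ, ee, ff, hprod⟩ :=
    P.split l (fun x hx => hST x (hl x hx)) (by omega) hn0
  have e1 : e ≠ 1 := fun h => P.one (h ▸ he)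
  have f1 : f ≠ 1 := fun h => P.one (h ▸ hf)
  have hreg := H.regular (e := e) (f := f) (g := e * γ * f) e1 f1 (H.irr.ne_right _ f1) ee ff
    (by rw [← mul_assoc, ← mul_assoc, ee]) (by rw [mul_assoc, ff])
  obtain ⟨le, hle0, hle, hlep⟩ := hlist e he
  obtain ⟨lr, hlr0, hlr, hlrp⟩ := hlist (γ * f) (hγ.mul_mem hf)
  have hG : ((List.replicate n le).flatten ++ lr).prod = e * γ * f := by
    rw [List.prod_append, List.prod_flatten, List.map_replicate, List.prod_replicate, hlep, hlrp,
      idem_pow ee (by omega), mul_assoc]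
  have hmem : ∀ x ∈ (List.replicate n le).flatten ++ lr, x ∈ Sig := by
    intro x hx
    rcases List.mem_append.1 hx with hx | hx
    · obtain ⟨b, hb, hx⟩ := List.mem_flatten.1 hx
      rw [(List.mem_replicate.1 hb).2] at hx
      exact hle x hx
    · exact hlr x hx
  have hc := H.core P hn0 hGB (insert 1 Sig) (Set.mem_insert _ _) ((List.replicate n le).flatten ++ lr)
    (fun x hx => Or.inr (hmem x hx)) (fun x hx => hST x (hmem x hx))
    (by
      have : 1 ≤ le.length := List.length_pos_iff.2 hle0
      simp only [List.length_append, List.length_flatten, List.map_replicate, List.sum_replicate, smul_eq_mul]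
      nlinarith)
    (by rw [hG]; exact hreg)
  rw [hG] at hc
  have d1 := can_list (Set.mem_insert 1 Sig) p (fun x hx => Or.inr (hl x (hp' x hx)))
  have d2 := can_list (Set.mem_insert 1 Sig) q (fun x hx => Or.inr (hl x (hq' x hx)))
  rw [hprod]
  exact ((d1.mul' hc).mul' d2).mono_k (by omega)

end
end SLC


namespace SLC

theorem first_diff' (v : List ℕ) (n : ℕ) (hlen : n ≤ v.length) :
    (∃ z, v = List.range n ++ z) ∨
      ∃ j l0 v', j < n ∧ l0 ≠ j ∧ v = List.range j ++ l0 :: v' := by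
  induction n with
  | zero => left; exact ⟨v, by simp⟩
  | succ n ih =>
    rcases ih (by omega) with ⟨z, hv⟩ | ⟨j, l0, v', h1, h2, h3⟩
    · cases z with
      | nil => rw [hv] at hlen; simp at hlen
      | cons l0 v' =>
        by_cases h : l0 = n
        · subst h
          left
          exact ⟨v', by rw [hv, List.range_succ]; simp⟩
        · right; exact ⟨n, l0, v', by omega, h, hv⟩
    · right; exact ⟨j, l0, v', by omega, h2, h3⟩

theorem descent {v : List ℕ} {n : ℕ} (hv : v.Perm (List.range n)) (hne : v ≠ List.range n) :
    ∃ l α β γ, l + 1 < n ∧ v = α ++ (l + 1) :: (β ++ l :: γ) := by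
  have hl : v.length = n := by simpa using hv.length_eq
  rcases first_diff' v n hl.ge with ⟨z, hz⟩ | ⟨j, l0, v', h1, h2, h3⟩
  · exfalso
    have : z = [] := by
      have := congrArg List.length hz
      simp [hl] at this
      exact this
    subst this
    exact hne (by simpa using hz)
  · have nd : v.Nodup := hv.nodup_iff.2 List.nodup_range
    have hl0 : l0 < n := by
      have : l0 ∈ v := by rw [h3]; simp
      simpa using hv.subset this
    have hgt : j < l0 := by
      by_contra hlt
      rw [h3, List.nodup_append] at nd
      exact nd.2.2 l0 (by simp; omega) l0 (by simp) rfl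
    obtain ⟨l, rfl⟩ : ∃ l, l0 = l + 1 := ⟨l0 - 1, by omega⟩
    have hm : l ∈ v := hv.symm.subset (by simp; omega)
    rw [h3] at hm
    have : l ∈ v' := by
      simp at hm
      rcases hm with h | h
      · omega
      · exact h
    obtain ⟨β, γ, rfl⟩ := List.append_of_mem this
    exact ⟨l, List.range j, β, γ, hl0, h3⟩

section
variable {M : Type*} [Monoid M] {n : ℕ} {v : List ℕ} {T : Subsemigroup M}

theorem exists_assign {v : List ℕ} (nd : v.Nodup) {w : List M} (hw : w.length = v.length)
    (hT : ∀ x ∈ w, x ∈ T) {d : M} (hd : d ∈ T) :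
    ∃ φ : ℕ → M, (∀ i, φ i ∈ T) ∧ v.map φ = w := by
  refine ⟨fun i => w.getD (v.idxOf i) d, fun i => getD_mem hT hd _, ?_⟩
  apply List.ext_getElem
  · simp [hw]
  · intro i h1 h2
    have h3 : i < v.length := by omega
    simp only [List.getElem_map]
    rw [nd.idxOf_getElem i h3]
    simp [h2]

theorem slide (idt : Ident M n v) (one : (1 : M) ∉ T) {l : ℕ} {α β γ : List ℕ} (hl : l + 1 < n)
    (hv : v = α ++ (l + 1) :: (β ++ l :: γ)) (nd : v.Nodup) (φ : ℕ → M) (hφ : ∀ i, φ i ∈ T)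
    {y : M} (hy : y ∈ T) :
    (α.map φ).prod * (φ (l + 1) * (β.map φ).prod * φ l) * y * (γ.map φ).prod =
    (α.map φ).prod * y * (φ (l + 1) * (β.map φ).prod * φ l) * (γ.map φ).prod := by
  have hne : ∀ {x}, x ∈ T → x ≠ 1 := fun hx h => one (h ▸ hx)
  obtain ⟨φ1, h1⟩ : ∃ φ1, φ1 = Function.update φ l (φ l * y) := ⟨_, rfl⟩
  obtain ⟨φ2, h2⟩ : ∃ φ2, φ2 = Function.update φ (l + 1) (y * φ (l + 1)) := ⟨_, rfl⟩
  have e1 := idt φ1 (by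
    intro i; rw [h1]; by_cases h : i = l
    · subst h; simpa using hne (T.mul_mem (hφ _) hy)
    · simpa [h] using hne (hφ i))
  have e2 := idt φ2 (by
    intro i; rw [h2]; by_cases h : i = l + 1
    · subst h; simpa using hne (T.mul_mem hy (hφ _))
    · simpa [h] using hne (hφ i))
  have up : ∀ (w : List ℕ) (a : ℕ) (z : M), a ∉ w → w.map (Function.update φ a z) = w.map φ := by
    intro w a z ha
    apply List.map_congr_left
    intro i hi
    rw [Function.update_of_ne]
    rintro rfl; exact ha hi
  have hr : List.range n = List.range l ++ l :: (l + 1) :: (List.range (n - (l + 2))).map (l + 2 + ·) := by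
    conv_lhs => rw [show n = l + (2 + (n - (l + 2))) by omega, List.range_add, List.range_add]
    simp [List.range_succ, Function.comp_def, add_assoc]
  have e3 : ((List.range n).map φ1).prod = ((List.range n).map φ2).prod := by
    rw [hr, h1, h2]
    simp only [List.map_append, List.map_cons, List.prod_append, List.prod_cons]
    rw [up _ _ _ (by simp), up _ _ _ (by simp; omega), up _ _ _ (by simp),
      up _ _ _ (by simp; omega)]
    simp [mul_assoc]
  rw [hv] at nd
  simp only [List.nodup_append, List.nodup_cons, List.mem_cons, List.mem_append] at nd
  have a1 : l ∉ α := fun h => nd.2.2 l h l (by simp) rfl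
  have a2 : l + 1 ∉ α := fun h => nd.2.2 (l + 1) h (l + 1) (by simp) rfl
  have b1 : l ∉ β := fun h => nd.2.1.2.2.2 l h l (by simp) rfl
  have b2 : l + 1 ∉ β := fun h => nd.2.1.1 (Or.inl h)
  have c1 : l ∉ γ := nd.2.1.2.2.1.1
  have c2 : l + 1 ∉ γ := fun h => nd.2.1.1 (Or.inr (Or.inr h))
  rw [e1, e2, hv, h1, h2] at e3
  simp only [List.map_append, List.map_cons, List.prod_append, List.prod_cons] at e3
  rw [up _ _ _ a1, up _ _ _ b1, up _ _ _ c1, up _ _ _ a2, up _ _ _ b2, up _ _ _ c2] at e3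
  simpa [mul_assoc] using e3

theorem slide_list (idt : Ident M n v) (one : (1 : M) ∉ T) (hv : v.Perm (List.range n))
    (hne : v ≠ List.range n) (p b q : List M) (hp : ∀ x ∈ p, x ∈ T) (hb : ∀ x ∈ b, x ∈ T)
    (hq : ∀ x ∈ q, x ∈ T) (lp : n ≤ p.length) (lb : n ≤ b.length) (lq : n ≤ q.length) {y : M}
    (hy : y ∈ T) : p.prod * b.prod * y * q.prod = p.prod * y * b.prod * q.prod := by
  have nd : v.Nodup := hv.nodup_iff.2 List.nodup_range
  obtain ⟨l, α, β, γ, hl, h⟩ := descent hv hne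
  have hlen : α.length + β.length + γ.length + 2 = n := by
    have := hv.length_eq
    rw [h] at this; simp at this; omega
  obtain ⟨b0, b', rfl⟩ : ∃ b0 b', b = b0 :: b' := by
    cases b with
    | nil => simp at lb; omega
    | cons b0 b' => exact ⟨_, _, rfl⟩
  obtain ⟨a, ha⟩ : ∃ a, a = α.length := ⟨_, rfl⟩
  obtain ⟨w1, hw1⟩ : ∃ w1, w1 = p.drop (p.length - a) := ⟨_, rfl⟩
  obtain ⟨p', hp'⟩ : ∃ p', p' = p.take (p.length - a) := ⟨_, rfl⟩
  obtain ⟨w2, hw2⟩ : ∃ w2, w2 = b'.take β.length := ⟨_, rfl⟩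
  obtain ⟨w2', hw2'⟩ : ∃ w2, w2 = b'.drop β.length := ⟨_, rfl⟩
  obtain ⟨w3, hw3⟩ : ∃ w3, w3 = q.take γ.length := ⟨_, rfl⟩
  obtain ⟨q', hq'⟩ : ∃ q', q' = q.drop γ.length := ⟨_, rfl⟩
  have ep : p = p' ++ w1 := by rw [hp', hw1, List.take_append_drop]
  have eb : b' = w2 ++ w2' := by rw [hw2, hw2', List.take_append_drop]
  have eq : q = w3 ++ q' := by rw [hw3, hq', List.take_append_drop]
  have l1 : w1.length = α.length := by rw [hw1]; simp; omega
  have l2 : w2.length = β.length := by rw [hw2]; simp at lb ⊢; omega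
  have l2' : w2' ≠ [] := by
    intro h; have := congrArg List.length h; rw [hw2'] at this; simp at this lb; omega
  have l3 : w3.length = γ.length := by rw [hw3]; simp; omega
  clear hw1 hp' hw2 hw2' hw3 hq'
  subst ep eb eq
  obtain ⟨φ, f1, f2⟩ := exists_assign (T := T) nd (w := w1 ++ b0 :: (w2 ++ w2'.prod :: w3)) (by
    rw [h]; simp; omega) (by
    intro x hx
    simp only [List.mem_append, List.mem_cons] at hx
    rcases hx with hx | rfl | hx | rfl | hx
    · exact hp _ (by simp [hx])
    · exact hb _ (by simp)
    · exact hb _ (by simp [hx])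
    · exact mem_prod _ l2' fun x hx => hb _ (by simp [hx])
    · exact hq _ (by simp [hx])) hy
  have := slide idt one hl h nd φ f1 hy
  rw [h, List.map_append, List.map_cons, List.map_append, List.map_cons] at f2
  obtain ⟨g1, g2⟩ := List.append_inj f2 (by simp [l1])
  obtain ⟨g2, g3⟩ := List.cons_eq_cons.1 g2
  obtain ⟨g3, g4⟩ := List.append_inj g3 (by simp [l2])
  obtain ⟨g4, g5⟩ := List.cons_eq_cons.1 g4
  rw [g1, g2, g3, g4, g5] at this
  simp only [List.prod_append, List.prod_cons]
  calc _ = p'.prod * (w1.prod * (b0 * w2.prod * w2'.prod) * y * w3.prod) * q'.prod := by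
        simp only [mul_assoc]
    _ = _ := by rw [this]; simp only [mul_assoc]

theorem swap_list (idt : Ident M n v) (one : (1 : M) ∉ T) (hv : v.Perm (List.range n))
    (hne : v ≠ List.range n) (p q : List M) (hp : ∀ x ∈ p, x ∈ T)
    (hq : ∀ x ∈ q, x ∈ T) (lp : n ≤ p.length) (lq : 2 * n ≤ q.length) {y z : M}
    (hy : y ∈ T) (hz : z ∈ T) : p.prod * y * z * q.prod = p.prod * z * y * q.prod := by
  obtain ⟨b, hb⟩ : ∃ b, b = q.take n := ⟨_, rfl⟩
  obtain ⟨q', hq'⟩ : ∃ b, b = q.drop n := ⟨_, rfl⟩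
  have eq : q = b ++ q' := by rw [hb, hq', List.take_append_drop]
  have lb : n ≤ b.length := by rw [hb]; simp; omega
  have lq' : n ≤ q'.length := by rw [hq']; simp; omega
  clear hb hq'
  subst eq
  have s1 := slide_list idt one hv hne p (z :: b) q' hp (by
    intro x hx; rcases List.mem_cons.1 hx with rfl | hx
    · exact hz
    · exact hq _ (by simp [hx])) (fun x hx => hq _ (by simp [hx])) lp (by simp; omega) lq' hy
  have s2 := slide_list idt one hv hne (p ++ [z]) b q' (by
    intro x hx; rcases List.mem_append.1 hx with hx | hx
    · exact hp _ hx
    · simp at hx; rw [hx]; exact hz) (fun x hx => hq _ (by simp [hx]))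
    (fun x hx => hq _ (by simp [hx])) (by simp; omega) lb lq' hy
  simp only [List.prod_append, List.prod_cons, List.prod_nil, mul_one, mul_assoc] at s1 s2 ⊢
  rw [← s2, s1]

theorem perm_list (idt : Ident M n v) (one : (1 : M) ∉ T) (hv : v.Perm (List.range n))
    (hne : v ≠ List.range n) (q : List M) (hq : ∀ x ∈ q, x ∈ T) (lq : 2 * n ≤ q.length)
    {l l' : List M} (h : l.Perm l') : ∀ (_ : ∀ x ∈ l, x ∈ T) (p : List M) (_ : ∀ x ∈ p, x ∈ T)
    (_ : n ≤ p.length), p.prod * l.prod * q.prod = p.prod * l'.prod * q.prod := by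
  induction h with
  | nil => intros; rfl
  | cons x h ih =>
    intro hl p hp lp
    have := ih (fun y hy => hl y (by simp [hy])) (p ++ [x]) (by
      intro y hy; rcases List.mem_append.1 hy with hy | hy
      · exact hp _ hy
      · simp at hy; rw [hy]; exact hl _ (by simp)) (by simp; omega)
    simpa [mul_assoc] using this
  | swap x y l =>
    intro hl p hp lp
    have := swap_list idt one hv hne p (l ++ q) hp (by
      intro z hz; rcases List.mem_append.1 hz with hz | hz
      · exact hl _ (by simp [hz])
      · exact hq _ hz) lp (by simp; omega) (hl x (by simp)) (hl y (by simp))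
    simpa [mul_assoc] using this.symm
  | trans h1 h2 ih1 ih2 =>
    intro hl p hp lp
    rw [ih1 hl p hp lp]
    exact ih2 (fun x hx => hl x (h1.mem_iff.2 hx)) p hp lp

end

section
variable {M : Type*} [Monoid M] {k : ℕ}

def word (e : Fin k → M) (f : Fin k → ℕ) : List M :=
  (List.finRange k).flatMap fun i => List.replicate (f i) (e i)

def wp (e : Fin k → M) (f : Fin k → ℕ) : M :=
  ((List.finRange k).map fun i => e i ^ f i).prod

theorem word_prod (e : Fin k → M) (f : Fin k → ℕ) : (word e f).prod = wp e f := by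
  unfold word wp
  induction List.finRange k with
  | nil => simp
  | cons a l ih => simp [ih]

theorem word_count [DecidableEq M] (e : Fin k → M) (he : Function.Injective e) (f : Fin k → ℕ)
    (j : Fin k) : (word e f).count (e j) = f j := by
  unfold word
  rw [List.count_flatMap]
  have : (List.count (e j) ∘ fun i => List.replicate (f i) (e i)) =
      fun i => if i = j then f i else 0 := by
    funext i
    simp [List.count_replicate, he.eq_iff]
  rw [this, ← List.ofFn_eq_map, List.sum_ofFn]
  simp

theorem word_mem (e : Fin k → M) (f : Fin k → ℕ) {x : M} (hx : x ∈ word e f) :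
    ∃ i, f i ≠ 0 ∧ e i = x := by
  unfold word at hx
  simp only [List.mem_flatMap, List.mem_replicate] at hx
  obtain ⟨i, _, h1, h2⟩ := hx
  exact ⟨i, h1, h2.symm⟩

theorem sum_log_le (l : List ℕ) (hl : ∀ x ∈ l, x ≠ 0) : (l.map (Nat.log 2)).sum ≤ Nat.log 2 l.prod := by
  have : 2 ^ (l.map (Nat.log 2)).sum ≤ l.prod := by
    induction l with
    | nil => simp
    | cons a l ih =>
      simp only [List.map_cons, List.sum_cons, List.prod_cons, pow_add]
      exact Nat.mul_le_mul (Nat.pow_log_le_self 2 (hl a (by simp))) (ih fun x hx => hl x (by simp [hx]))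
  exact Nat.le_log_of_pow_le (by norm_num) this

theorem closure_list {Sig : Set M} {t : M} (ht : t ∈ Subsemigroup.closure Sig) :
    ∃ l : List M, l ≠ [] ∧ (∀ x ∈ l, x ∈ Sig) ∧ l.prod = t := by
  induction ht using Subsemigroup.closure_induction with
  | mem x hx => exact ⟨[x], by simp, by simpa using hx, by simp⟩
  | mul x y _ _ hx hy =>
    obtain ⟨l1, a1, b1, rfl⟩ := hx
    obtain ⟨l2, a2, b2, rfl⟩ := hy
    refine ⟨l1 ++ l2, by simp [a1], ?_, by simp⟩
    intro x hx
    rcases List.mem_append.1 hx with h | h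
    · exact b1 x h
    · exact b2 x h

theorem caseA [Finite M] {n : ℕ} {v : List ℕ} {T : Subsemigroup M} (idt : Ident M n v)
    (one : (1 : M) ∉ T) (hv : v.Perm (List.range n))
    (hne : v ≠ List.range n) (Sig : Set M) (hT : T = Subsemigroup.closure Sig) (t : M)
    (ht : t ∈ T) : Can (insert 1 Sig) (3 * Nat.log 2 (Nat.card M) + (3 * n + 2)) {t} := by
  classical
  have hST : ∀ x ∈ Sig, x ∈ T := fun x hx => hT ▸ Subsemigroup.subset_closure hx
  rw [hT] at ht
  obtain ⟨l, -, l1, rfl⟩ := closure_list ht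
  by_cases hlen : l.length < 3 * n
  · exact (can_list (A := insert 1 Sig) (by simp) l fun x hx => by simp [l1 x hx]).mono_k (by omega)
  obtain ⟨p, hp⟩ : ∃ p, p = l.take n := ⟨_, rfl⟩
  obtain ⟨m0, hm0⟩ : ∃ p, p = (l.drop n).take (l.length - 3 * n) := ⟨_, rfl⟩
  obtain ⟨q, hq⟩ : ∃ p, p = (l.drop n).drop (l.length - 3 * n) := ⟨_, rfl⟩
  have el : l = p ++ (m0 ++ q) := by rw [hp, hm0, hq]; simp [List.take_append_drop]
  have lp : p.length = n := by rw [hp]; simp; omega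
  have lq : q.length = 2 * n := by rw [hq]; simp; omega
  clear hp hm0 hq
  subst el
  have sp : ∀ x ∈ p, x ∈ Sig := fun x hx => l1 x (by simp [hx])
  have sm : ∀ x ∈ m0, x ∈ Sig := fun x hx => l1 x (by simp [hx])
  have sq : ∀ x ∈ q, x ∈ Sig := fun x hx => l1 x (by simp [hx])
  have key : ∀ {l l' : List M}, l.Perm l' → (∀ x ∈ l, x ∈ Sig) →
      p.prod * l.prod * q.prod = p.prod * l'.prod * q.prod := fun h hl =>
    perm_list idt one hv hne q (fun x hx => hST _ (sq x hx)) lq.ge h (fun x hx => hST _ (hl x hx)) p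
      (fun x hx => hST _ (sp x hx)) lp.ge
  obtain ⟨k, hk⟩ : ∃ k, k = Nat.card M := ⟨_, rfl⟩
  obtain ⟨e⟩ : Nonempty (Fin k ≃ M) := ⟨hk ▸ (Finite.equivFin M).symm⟩
  obtain ⟨A, hA⟩ : ∃ A : Set (Lex (Fin k → ℕ)), A = {f : Lex (Fin k → ℕ) | (∀ i, ofLex f i ≠ 0 → e i ∈ Sig) ∧
    p.prod * wp e (ofLex f) * q.prod = p.prod * m0.prod * q.prod} := ⟨_, rfl⟩
  have hA0 : A.Nonempty := by
    refine ⟨toLex fun i => m0.count (e i), ?_⟩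
    rw [hA]
    refine ⟨fun i hi => sm _ (List.count_pos_iff.1 (Nat.pos_of_ne_zero hi)), ?_⟩
    rw [ofLex_toLex, ← word_prod]
    symm
    apply key _ sm
    rw [List.perm_iff_count]
    intro x
    obtain ⟨j, rfl⟩ := e.surjective x
    rw [word_count _ e.injective]
  have wf : WellFounded ((· < ·) : Lex (Fin k → ℕ) → Lex (Fin k → ℕ) → Prop) := wellFounded_lt
  obtain ⟨m, hm, hmin⟩ := wf.has_min A hA0
  rw [hA] at hm
  obtain ⟨hm1, hm2⟩ := hm
  have lt_of : ∀ f f' : Fin k → ℕ, f ≤ ofLex m → f' ≤ ofLex m → wp e f = wp e f' →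
      ¬ toLex f' < toLex f := by
    intro f f' hf hf' hw hlt
    have hlt2 : toLex (ofLex m - f) + toLex f' < toLex (ofLex m - f) + toLex f :=
      add_lt_add_right hlt _
    have e1 : toLex (ofLex m - f) + toLex f = m := by
      rw [← toLex_add, tsub_add_cancel_of_le hf, toLex_ofLex]
    rw [e1] at hlt2
    refine hmin _ ?_ hlt2
    rw [hA]
    have hs : ∀ g : Fin k → ℕ, g ≤ ofLex m → ∀ i, g i ≠ 0 → e i ∈ Sig := fun g hg i hi =>
      hm1 i (fun h0 => hi (Nat.le_zero.1 ((hg i).trans h0.le)))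
    have hs1 := hs _ hf
    have hs2 := hs _ hf'
    have hs3 := hs (ofLex m - f) tsub_le_self
    have ww : ∀ g : Fin k → ℕ, (∀ i, g i ≠ 0 → e i ∈ Sig) → ∀ x ∈ word e g, x ∈ Sig := by
      intro g hg x hx
      obtain ⟨i, h1, rfl⟩ := word_mem _ _ hx
      exact hg i h1
    have wadd : ∀ g g' : Fin k → ℕ, (∀ i, g i ≠ 0 → e i ∈ Sig) → (∀ i, g' i ≠ 0 → e i ∈ Sig) →
        p.prod * wp e (g + g') * q.prod = p.prod * (wp e g * wp e g') * q.prod := by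
      intro g g' hg hg'
      rw [← word_prod, ← word_prod, ← word_prod, ← List.prod_append (l₁ := word e g)]
      symm
      apply key
      · rw [List.perm_iff_count]
        intro x
        obtain ⟨j, rfl⟩ := e.surjective x
        rw [List.count_append, word_count _ e.injective, word_count _ e.injective,
          word_count _ e.injective]; rfl
      · intro x hx
        rcases List.mem_append.1 hx with h | h
        · exact ww _ hg x h
        · exact ww _ hg' x h
    refine ⟨?_, ?_⟩
    · intro i hi
      by_cases h : f' i = 0
      · apply hs3 i
        intro h3
        exact hi (by change (ofLex m - f) i + f' i = 0; omega)
      · exact hs2 i h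
    · change p.prod * wp e ((ofLex m - f) + f') * q.prod = _
      rw [wadd _ _ hs3 hs2, ← hw, ← wadd _ _ hs3 hs1, tsub_add_cancel_of_le hf, hm2]
  have inj : Set.InjOn (wp e) (Finset.Iic (ofLex m) : Finset (Fin k → ℕ)) := by
    intro f hf f' hf' hw
    simp at hf hf'
    rcases lt_trichotomy (toLex f) (toLex f') with h | h | h
    · exact absurd h (lt_of _ _ hf' hf hw.symm)
    · exact toLex.injective h
    · exact absurd h (lt_of _ _ hf hf' hw)
  have hcard : ∏ i, (ofLex m i + 1) ≤ Nat.card M := by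
    have := Fintype.ofFinite M
    have h1 := Finset.card_le_card_of_injOn (s := Finset.Iic (ofLex m)) (t := (Finset.univ : Finset M)) (wp e)
      (by intro x _; simp) inj
    rw [Pi.card_Iic] at h1
    simpa [Nat.card_eq_fintype_card] using h1
  have c1 := can_pows (A := insert 1 Sig) (by simp) ((List.finRange k).map fun i => (e i, ofLex m i)) (by
    intro x hx
    obtain ⟨i, _, rfl⟩ := List.mem_map.1 hx
    intro h; right; exact hm1 i h)
  have c2 := can_list (A := insert 1 Sig) (by simp) p fun x hx => by simp [sp x hx]
  have c3 := can_list (A := insert 1 Sig) (by simp) q fun x hx => by simp [sq x hx]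
  simp only [List.map_map, Function.comp_def] at c1
  change Can _ _ {wp e (ofLex m)} at c1
  have := (c2.mul' c1).mul' c3
  rw [hm2] at this
  rw [List.prod_append, List.prod_append, ← mul_assoc]
  refine this.mono_k ?_
  have h5 := sum_log_le ((List.finRange k).map fun i => ofLex m i + 1) (by simp)
  rw [List.map_map] at h5
  have h6 : ((List.finRange k).map fun i => ofLex m i + 1).prod = ∏ i, (ofLex m i + 1) := by
    rw [← List.ofFn_eq_map, List.prod_ofFn]
  rw [h6] at h5
  have h7 := h5.trans (Nat.log_mono_right hcard)
  simp only [Function.comp_def] at h7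
  omega
end
end SLC


namespace SLC

section birkhoff
variable (V : Pseudovariety)

theorem mem_inst {S : Type} [Semigroup S] (f1 f2 : Fintype S) (h : @Pseudovariety.mem V S _ f1) :
    @Pseudovariety.mem V S _ f2 :=
  @Pseudovariety.closed_hom V S S _ f1 _ f2 (MulHom.id S) (fun x => ⟨x, rfl⟩) h

theorem mem_pow_fin {S : Type} [Semigroup S] [Fintype S] [Nonempty S] (hS : V.mem S) (k : ℕ) :
    V.mem (Fin k → S) := by
  induction k with
  | zero =>
    refine V.closed_hom S (Fin 0 → S) ⟨fun _ => Fin.elim0, ?_⟩ ?_ hS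
    · intro x y; exact Subsingleton.elim _ _
    · intro x; exact ⟨Classical.arbitrary S, Subsingleton.elim _ _⟩
  | succ k ih =>
    refine V.closed_hom (S × (Fin k → S)) (Fin (k + 1) → S) ⟨fun p => Fin.cons p.1 p.2, ?_⟩ ?_
      (V.closed_prod _ _ hS ih)
    · intro x y
      funext i
      refine Fin.cases ?_ (fun j => ?_) i <;> simp
    · intro f
      exact ⟨(f 0, fun i => f i.succ), Fin.cons_self_tail f⟩

theorem mem_pow_type {S : Type} [Semigroup S] [Fintype S] [Nonempty S] (hS : V.mem S) (X : Type)
    [Finite X] [Fintype (X → S)] : V.mem (X → S) := by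
  obtain ⟨k, ⟨e⟩⟩ := Finite.exists_equiv_fin X
  refine V.closed_hom (Fin k → S) (X → S) ⟨fun f x => f (e x), ?_⟩ ?_ (mem_pow_fin V hS k)
  · intro f g; rfl
  · intro f; exact ⟨fun i => f (e.symm i), by funext x; simp⟩

theorem birkhoff {S : Type} [Semigroup S] [Fintype S] [Nonempty S] (hS : V.mem S) {T : Type}
    [Semigroup T] [Fintype T]
    (h : ∀ α β : FreeSemigroup T, (∀ φ : T → S, FreeSemigroup.lift φ α = FreeSemigroup.lift φ β) →
      FreeSemigroup.lift (id : T → T) α = FreeSemigroup.lift (id : T → T) β) : V.mem T := by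
  classical
  let F : FreeSemigroup T →ₙ* ((T → S) → S) :=
    ⟨fun α φ => FreeSemigroup.lift φ α, by intro x y; funext φ; simp⟩
  have hR : V.mem (MulHom.srange F) :=
    V.closed_sub _ _ (MulMemClass.subtype (MulHom.srange F)) Subtype.val_injective
      (mem_pow_type V hS (T → S))
  have ex : ∀ r : MulHom.srange F, ∃ α, F α = r := fun r => r.2
  choose g hg using ex
  have hg2 : ∀ (α : FreeSemigroup T) (r : MulHom.srange F), F α = r →
      FreeSemigroup.lift (id : T → T) (g r) = FreeSemigroup.lift (id : T → T) α := by
    intro α r hr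
    apply h
    intro φ
    have : F (g r) = F α := by rw [hg, hr]
    exact congrFun this φ
  refine V.closed_hom (MulHom.srange F) T ⟨fun r => FreeSemigroup.lift (id : T → T) (g r), ?_⟩ ?_ hR
  · intro x y
    rw [← map_mul]
    apply hg2
    rw [map_mul, hg, hg]; rfl
  · intro t
    refine ⟨⟨F (FreeSemigroup.of t), ⟨_, rfl⟩⟩, ?_⟩
    change FreeSemigroup.lift (id : T → T) (g _) = t
    rw [hg2 (FreeSemigroup.of t) _ rfl]
    simp

theorem lift_coe {S T : Type} [Semigroup S] (φ : T → S) (α : FreeSemigroup T) :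
    ((FreeSemigroup.lift φ α : S) : WithOne S) =
      ((α.head :: α.tail).map fun x => (φ x : WithOne S)).prod := by
  induction α using FreeSemigroup.recOnMul with
  | ih1 x => simp
  | ih2 x y h1 h2 =>
    rw [map_mul, WithOne.coe_mul, h1, h2]
    simp [mul_assoc]

theorem words {S : Type} [Semigroup S] [Fintype S] [Nonempty S] (hS : V.mem S) {T : Type}
    [Semigroup T] [Fintype T] (hT : ¬ V.mem T) : ∃ a b : List T,
      (∀ φ : T → S, (a.map fun x => (φ x : WithOne S)).prod = (b.map fun x => (φ x : WithOne S)).prod) ∧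
      (a.map fun x : T => (x : WithOne T)).prod ≠ (b.map fun x : T => (x : WithOne T)).prod := by
  by_contra! hc
  apply hT
  apply birkhoff V hS
  intro α β h
  have := hc (α.head :: α.tail) (β.head :: β.tail) (by
    intro φ; rw [← lift_coe, ← lift_coe, h])
  rw [← WithOne.coe_inj, lift_coe, lift_coe]
  exact this
end birkhoff

section tnil

theorem tnil_prod {T : Type} [Semigroup T] {z : T} (h0 : ∀ s : T, z * s = z ∧ s * z = z)
    (h1 : ∀ x : T, x * x = z) (h2 : ∀ x y : T, x * y * x = z) (a : List T) (ha : ¬ a.Nodup) :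
    (a.map fun x : T => (x : WithOne T)).prod = (z : WithOne T) := by
  rw [List.nodup_iff_sublist] at ha
  push Not at ha
  obtain ⟨x, hx⟩ := ha
  have zl : ∀ u : WithOne T, (z : WithOne T) * u = z := by
    intro u; cases u with
    | one => simp
    | coe s => rw [← WithOne.coe_mul, (h0 s).1]
  have zr : ∀ u : WithOne T, u * (z : WithOne T) = z := by
    intro u; cases u with
    | one => simp
    | coe s => rw [← WithOne.coe_mul, (h0 s).2]
  have xux : ∀ u : WithOne T, (x : WithOne T) * (u * x) = z := by
    intro u; cases u with
    | one => rw [one_mul, ← WithOne.coe_mul, h1]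
    | coe s => rw [← WithOne.coe_mul, ← WithOne.coe_mul, ← mul_assoc, h2]
  obtain ⟨r1, r2, rfl, hr1, hr2⟩ := List.cons_sublist_iff.1 hx
  obtain ⟨u, v, rfl⟩ := List.append_of_mem hr1
  obtain ⟨u', v', rfl⟩ := List.append_of_mem (List.singleton_sublist.1 hr2)
  simp only [List.map_append, List.map_cons, List.prod_append, List.prod_cons]
  generalize (u.map fun x : T => (x : WithOne T)).prod = U
  generalize (v.map fun x : T => (x : WithOne T)).prod = W
  generalize (u'.map fun x : T => (x : WithOne T)).prod = U'
  generalize (v'.map fun x : T => (x : WithOne T)).prod = W'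
  calc _ = U * ((x : WithOne T) * ((W * U') * x) * W') := by simp only [mul_assoc]
    _ = _ := by rw [xux, zl, zr]

theorem tnil_ident (V : Pseudovariety) {T : Type} [Semigroup T] [Fintype T] (hT : IsTNil T)
    (hTV : ¬ V.mem T) {S : Type} [Semigroup S] [Fintype S] [Nonempty S] (hS : V.mem S) :
    ∃ v : List ℕ, (∀ i ∈ v, i < Fintype.card T) ∧ v ≠ List.range (Fintype.card T) ∧
      Ident (WithOne S) (Fintype.card T) v := by
  classical
  obtain ⟨z, h0, h1, h2⟩ := hT
  have : ∃ a b : List T, a.Nodup ∧ a ≠ b ∧ (∀ φ : T → S,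
      (a.map fun x => (φ x : WithOne S)).prod = (b.map fun x => (φ x : WithOne S)).prod) := by
    obtain ⟨a, b, hab, hne⟩ := words V hS hTV
    by_cases ha : a.Nodup
    · exact ⟨a, b, ha, fun h => hne (by rw [h]), hab⟩
    · by_cases hb : b.Nodup
      · exact ⟨b, a, hb, fun h => hne (by rw [h]), fun φ => (hab φ).symm⟩
      · exact absurd ((tnil_prod h0 h1 h2 a ha).trans (tnil_prod h0 h1 h2 b hb).symm) hne
  obtain ⟨a, b, nd, hne, hab⟩ := this
  obtain ⟨r, hr⟩ : ∃ r : List T, r = (Finset.univ.filter fun x => x ∉ a).toList := ⟨_, rfl⟩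
  have nd' : (a ++ r).Nodup := by
    rw [List.nodup_append']
    refine ⟨nd, by rw [hr]; exact Finset.nodup_toList _, ?_⟩
    intro x hx hx'
    rw [hr] at hx'
    simp at hx'
    exact hx' hx
  have hall : ∀ x, x ∈ a ++ r := by
    intro x
    rw [hr]; simp
    tauto
  have hab' : ∀ φ : T → S, ((a ++ r).map fun x => (φ x : WithOne S)).prod =
      ((b ++ r).map fun x => (φ x : WithOne S)).prod := by
    intro φ; rw [List.map_append, List.map_append, List.prod_append, List.prod_append, hab]
  have hne' : a ++ r ≠ b ++ r := fun h => hne (List.append_cancel_right h)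
  generalize a ++ r = a at *
  generalize b ++ r = b at *
  have hlen : a.length = Fintype.card T := by
    rw [← List.toFinset_card_of_nodup nd']
    have : a.toFinset = Finset.univ := by ext x; simp [hall]
    rw [this, Finset.card_univ]
  have hrange : a.map (fun x => a.idxOf x) = List.range (Fintype.card T) := by
    apply List.ext_getElem
    · simp [hlen]
    · intro i h1 h2
      simp [nd'.idxOf_getElem]
  refine ⟨b.map (fun x => a.idxOf x), ?_, ?_, ?_⟩
  · intro i hi
    obtain ⟨x, _, rfl⟩ := List.mem_map.1 hi
    rw [← hlen]
    exact List.idxOf_lt_length_of_mem (hall x)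
  · intro h
    rw [← hrange] at h
    apply hne'
    symm
    refine List.map_injective_iff.2 ?_ h
    intro x y hxy
    exact (List.idxOf_inj (hall x)).1 hxy
  · intro φ hφ
    have : ∀ i, ∃ s : S, (s : WithOne S) = φ i := fun i => WithOne.ne_one_iff_exists.1 (hφ i)
    choose ψ hψ using this
    have := hab' (fun x => ψ (a.idxOf x))
    simp only [hψ] at this
    rw [← hrange, List.map_map, List.map_map]
    exact this
end tnil

section lrb

def NoLS (S : Type) [Semigroup S] : Prop := ∀ e a b : S,
  e * e = e → e * a = a → a * e = a → e * b = b → b * e = b → a * b = a → b * a = b → a = b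

theorem left_zero_prod {M X : Type} [Monoid M] {e a b : M} (ha : a * e = a) (haa : a * a = a) (hab : a * b = a)
    (φ : X → M) (hφ : ∀ x, φ x = e ∨ φ x = a ∨ φ x = b) (l : List X) : a * (l.map φ).prod = a := by
  induction l with
  | nil => simp
  | cons x l ih =>
    rw [List.map_cons, List.prod_cons, ← mul_assoc]
    have : a * φ x = a := by rcases hφ x with h | h | h <;> rw [h] <;> assumption
    rw [this, ih]

theorem lrb_words {M N X : Type} [Monoid M] [Monoid N] {e a b : M} (hee : e * e = e) (hea : e * a = a)
    (hae : a * e = a) (heb : e * b = b) (hbe : b * e = b) (hab : a * b = a) (hba : b * a = b)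
    (hne : a ≠ b) (g : X → N) (N1 : ∀ x : N, x * x = x) (N2 : ∀ x y : N, x * y * x = x * y) (k : ℕ) :
    ∀ (α β : List X), α.length + β.length ≤ k → ∀ (c : Set X) (z : N), (∀ x ∈ c, z * g x = z) →
    (∀ φ : X → M, (∀ x, φ x = e ∨ φ x = a ∨ φ x = b) → (∀ x ∈ c, φ x = e) →
      e * (α.map φ).prod = e * (β.map φ).prod) → z * (α.map g).prod = z * (β.map g).prod := by
  classical
  have haa : a * a = a := by
    calc a * a = (a * b) * a := by rw [hab]
      _ = a * (b * a) := mul_assoc _ _ _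
      _ = a := by rw [hba, hab]
  have hbb : b * b = b := by
    calc b * b = (b * a) * b := by rw [hba]
      _ = b * (a * b) := mul_assoc _ _ _
      _ = b := by rw [hab, hba]
  have pa : ∀ φ : X → M, (∀ x, φ x = e ∨ φ x = a ∨ φ x = b) → ∀ l : List X,
      a * (l.map φ).prod = a := fun φ h l => left_zero_prod hae haa hab φ h l
  have pb : ∀ φ : X → M, (∀ x, φ x = e ∨ φ x = a ∨ φ x = b) → ∀ l : List X,
      b * (l.map φ).prod = b := fun φ h l => left_zero_prod hbe hbb hba φ (fun x => by
        rcases h x with h | h | h <;> simp [h]) l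
  have single : ∀ (c : Set X) (y : X), y ∉ c → ∀ l : List X,
      (∀ φ : X → M, (∀ x, φ x = e ∨ φ x = a ∨ φ x = b) → (∀ x ∈ c, φ x = e) →
      e = e * ((y :: l).map φ).prod) → False := by
    intro c y hy l h
    have h1 := h (fun x => if x = y then a else e) (fun x => by split_ifs <;> simp)
      (fun x hx => if_neg (by rintro rfl; exact hy hx))
    have h2 := h (fun x => if x = y then b else e) (fun x => by split_ifs <;> simp)
      (fun x hx => if_neg (by rintro rfl; exact hy hx))
    rw [List.map_cons, List.prod_cons, if_pos rfl, ← mul_assoc, hea, pa _ (fun x => by split_ifs <;> simp)] at h1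
    rw [List.map_cons, List.prod_cons, if_pos rfl, ← mul_assoc, heb, pb _ (fun x => by split_ifs <;> simp)] at h2
    exact hne (h1.symm.trans h2)
  induction k with
  | zero =>
    intro α β hk c z _ _
    have h1 : α = [] := List.length_eq_zero_iff.1 (by omega)
    have h2 : β = [] := List.length_eq_zero_iff.1 (by omega)
    rw [h1, h2]
  | succ k ih =>
    intro α β hk c z hc h
    rcases α with _ | ⟨x, α⟩
    · rcases β with _ | ⟨y, β⟩
      · rfl
      · by_cases hy : y ∈ c
        · rw [List.map_cons, List.prod_cons, ← mul_assoc, hc y hy]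
          apply ih [] β (by simp at hk ⊢; omega) c z hc
          intro φ h1 h2
          rw [h φ h1 h2, List.map_cons, List.prod_cons, h2 y hy, ← mul_assoc, hee]
        · exact (single c y hy β (fun φ h1 h2 => by simpa using h φ h1 h2)).elim
    · by_cases hx : x ∈ c
      · rw [List.map_cons, List.prod_cons, ← mul_assoc, hc x hx]
        apply ih α β (by simp at hk ⊢; omega) c z hc
        intro φ h1 h2
        rw [← h φ h1 h2, List.map_cons, List.prod_cons, h2 x hx, ← mul_assoc, hee]
      · rcases β with _ | ⟨y, β⟩
        · exact (single c x hx α (fun φ h1 h2 => by simpa using (h φ h1 h2).symm)).elim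
        · by_cases hy : y ∈ c
          · rw [List.map_cons (l := β), List.prod_cons (l := β.map g), ← mul_assoc (b := g y), hc y hy]
            apply ih (x :: α) β (by simp at hk ⊢; omega) c z hc
            intro φ h1 h2
            rw [h φ h1 h2, List.map_cons, List.prod_cons, h2 y hy, ← mul_assoc, hee]
          · by_cases hxy : x = y
            · subst hxy
              rw [List.map_cons, List.prod_cons, List.map_cons, List.prod_cons, ← mul_assoc, ← mul_assoc]
              apply ih α β (by simp at hk ⊢; omega) (insert x c) (z * g x)
              · intro u hu
                rcases hu with rfl | hu
                · rw [mul_assoc, N1]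
                · calc z * g x * g u = (z * g u) * g x * g u := by rw [hc u hu]
                    _ = z * (g u * g x * g u) := by simp only [mul_assoc]
                    _ = z * g u * g x := by rw [N2, mul_assoc]
                    _ = z * g x := by rw [hc u hu]
              · intro φ h1 h2
                have := h φ h1 (fun u hu => h2 u (by simp [hu]))
                rw [List.map_cons, List.prod_cons, List.map_cons, List.prod_cons, h2 x (by simp),
                  ← mul_assoc, ← mul_assoc, hee] at this
                exact this
            · exfalso
              have hv : ∀ u, (if u = x then a else if u = y then b else e) = e ∨
                  (if u = x then a else if u = y then b else e) = a ∨
                  (if u = x then a else if u = y then b else e) = b := by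
                intro u; split_ifs <;> simp
              have := h (fun u => if u = x then a else if u = y then b else e) hv (by
                intro u hu
                rw [if_neg (by rintro rfl; exact hx hu), if_neg (by rintro rfl; exact hy hu)])
              rw [List.map_cons, List.prod_cons, List.map_cons, List.prod_cons, if_pos rfl,
                if_neg (Ne.symm hxy), if_pos rfl, ← mul_assoc, ← mul_assoc, hea, heb, pa _ hv, pb _ hv] at this
              exact hne this

theorem noLS (V : Pseudovariety) {T : Type} [Semigroup T] [Fintype T] (hT : IsLRB T)
    (hTV : ¬ V.mem T) {S : Type} [Semigroup S] [Fintype S] (hS : V.mem S) : NoLS S := by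
  intro e a b hee hea hae heb hbe hab hba
  by_contra hne
  have : Nonempty S := ⟨e⟩
  obtain ⟨α, β, h1, h2⟩ := words V hS hTV
  apply h2
  have N1 : ∀ x : WithOne T, x * x = x := by
    intro x; cases x with
    | one => simp
    | coe s => rw [← WithOne.coe_mul, hT.1]
  have N2 : ∀ x y : WithOne T, x * y * x = x * y := by
    intro x y
    cases x with
    | one => simp
    | coe s => cases y with
      | one => simp [N1]
      | coe u => rw [← WithOne.coe_mul, ← WithOne.coe_mul, hT.2]
  have := lrb_words (M := WithOne S) (N := WithOne T) (e := e) (a := a) (b := b) (by rw [← WithOne.coe_mul, hee])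
    (by rw [← WithOne.coe_mul, hea]) (by rw [← WithOne.coe_mul, hae]) (by rw [← WithOne.coe_mul, heb])
    (by rw [← WithOne.coe_mul, hbe]) (by rw [← WithOne.coe_mul, hab]) (by rw [← WithOne.coe_mul, hba])
    (by rwa [Ne, WithOne.coe_inj]) (fun x : T => (x : WithOne T)) N1 N2 _ α β le_rfl ∅ 1 (by simp) (by
      intro φ h3 _
      have : ∀ x, ∃ s : S, (s : WithOne S) = φ x := by
        intro x
        rcases h3 x with h | h | h <;> exact ⟨_, h.symm⟩
      choose ψ hψ using this
      have h4 := h1 ψ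
      simp only [hψ] at h4
      exact congrArg _ h4)
  simpa using this

theorem noL (V : Pseudovariety) {T : Type} [Semigroup T] [Fintype T] (hT : IsLRB T)
    (hTV : ¬ V.mem T) {S : Type} [Semigroup S] [Fintype S] (hS : V.mem S) : NoL (WithOne S) := by
  intro e a b he ha hb h1 h2 h3 h4 h5 h6 h7
  obtain ⟨e, rfl⟩ := WithOne.ne_one_iff_exists.1 he
  obtain ⟨a, rfl⟩ := WithOne.ne_one_iff_exists.1 ha
  obtain ⟨b, rfl⟩ := WithOne.ne_one_iff_exists.1 hb
  simp only [← WithOne.coe_mul, WithOne.coe_inj] at *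
  exact noLS V hT hTV hS e a b h1 h2 h3 h4 h5 h6 h7

instance opFintype {S : Type} [Fintype S] : Fintype Sᵐᵒᵖ := Fintype.ofEquiv S MulOpposite.opEquiv

/-- the opposite pseudovariety -/
def opV (V : Pseudovariety) : Pseudovariety where
  mem S _ _ := V.mem Sᵐᵒᵖ
  closed_sub S T _ _ _ _ f hf h := by
    refine V.closed_sub Sᵐᵒᵖ Tᵐᵒᵖ (MulHom.op f) ?_ h
    intro x y hxy
    apply MulOpposite.unop_injective
    apply hf
    exact MulOpposite.op_injective hxy
  closed_hom S T _ _ _ _ f hf h := by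
    refine V.closed_hom Sᵐᵒᵖ Tᵐᵒᵖ (MulHom.op f) ?_ h
    intro y
    obtain ⟨x, hx⟩ := hf y.unop
    exact ⟨MulOpposite.op x, MulOpposite.unop_injective hx⟩
  closed_prod S T _ _ _ _ h1 h2 := by
    refine V.closed_hom (Sᵐᵒᵖ × Tᵐᵒᵖ) (S × T)ᵐᵒᵖ ⟨fun p => MulOpposite.op (p.1.unop, p.2.unop), ?_⟩ ?_
      (V.closed_prod _ _ h1 h2)
    · intro x y; rfl
    · intro y; exact ⟨(MulOpposite.op y.unop.1, MulOpposite.op y.unop.2), rfl⟩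

theorem noR (V : Pseudovariety) {T : Type} [Semigroup T] [Fintype T] (hT : IsRRB T)
    (hTV : ¬ V.mem T) {S : Type} [Semigroup S] [Fintype S] (hS : V.mem S) : NoR (WithOne S) := by
  have hL : NoLS Sᵐᵒᵖ := by
    refine noLS (opV V) (T := Tᵐᵒᵖ) ⟨?_, ?_⟩ ?_ ?_
    · intro x; exact MulOpposite.unop_injective (hT.1 x.unop)
    · intro x y
      apply MulOpposite.unop_injective
      simp only [MulOpposite.unop_mul]
      rw [← mul_assoc, hT.2]
    · intro h
      apply hTV
      refine V.closed_hom Tᵐᵒᵖᵐᵒᵖ T ⟨fun x => x.unop.unop, fun x y => rfl⟩ ?_ h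
      intro x; exact ⟨MulOpposite.op (MulOpposite.op x), rfl⟩
    · refine V.closed_hom S Sᵐᵒᵖᵐᵒᵖ ⟨fun x => MulOpposite.op (MulOpposite.op x), fun x y => rfl⟩ ?_ hS
      intro x; exact ⟨x.unop.unop, rfl⟩
  intro e a b he ha hb h1 h2 h3 h4 h5 h6 h7
  obtain ⟨e, rfl⟩ := WithOne.ne_one_iff_exists.1 he
  obtain ⟨a, rfl⟩ := WithOne.ne_one_iff_exists.1 ha
  obtain ⟨b, rfl⟩ := WithOne.ne_one_iff_exists.1 hb
  simp only [← WithOne.coe_mul, WithOne.coe_inj] at *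
  have := hL (MulOpposite.op e) (MulOpposite.op a) (MulOpposite.op b)
    (by rw [← MulOpposite.op_mul, h1]) (by rw [← MulOpposite.op_mul, h3])
    (by rw [← MulOpposite.op_mul, h2]) (by rw [← MulOpposite.op_mul, h5])
    (by rw [← MulOpposite.op_mul, h4]) (by rw [← MulOpposite.op_mul, h7])
    (by rw [← MulOpposite.op_mul, h6])
  exact MulOpposite.op_injective this
end lrb
end SLC


namespace SLC

theorem exists_seq_of_can {S : Type*} [Semigroup S] {Sig : Set S} {k : ℕ} {t : S}
    (h : Can (insert 1 ((fun s : S => (s : WithOne S)) '' Sig)) k {(t : WithOne S)}) :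
    ∃ L : List S, IsSLSeq Sig L ∧ t ∈ L := by
  obtain ⟨L, h1, h2, h3⟩ := can_to_seq (Sig := Sig) h [] isSLSeq_nil (by
    rintro x (rfl | ⟨s, hs, rfl⟩)
    · simp
    · exact Or.inr ⟨s, rfl, Or.inl hs⟩)
  rcases h3 _ rfl with h3 | ⟨s, h3, h4⟩
  · exact absurd h3 (WithOne.coe_ne_one)
  obtain rfl := WithOne.coe_inj.1 h3
  obtain ⟨L', c1, c2, c3, c4⟩ := isSLSeq_ensure h1 h4
  exact ⟨L', c1, c3⟩

theorem short_word {M : Type*} [Monoid M] [Finite M] {Sig : Set M} (k : ℕ) :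
    ∀ l : List M, l.length ≤ k → (∀ x ∈ l, x ∈ Sig) →
      ∃ l' : List M, l'.length ≤ Nat.card M ∧ (∀ x ∈ l', x ∈ Sig) ∧ l'.prod = l.prod := by
  induction k with
  | zero => intro l hl h; exact ⟨l, by omega, h, rfl⟩
  | succ k ih =>
    intro l hl h
    by_cases hc : l.length ≤ Nat.card M
    · exact ⟨l, hc, h, rfl⟩
    have := Fintype.ofFinite M
    obtain ⟨i, j, hij, he⟩ := Fintype.exists_ne_map_eq_of_card_lt
      (fun i : Fin l.length => (l.take i).prod) (by simpa [Nat.card_eq_fintype_card] using hc)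
    wlog hlt : i < j generalizing i j
    · exact this j i hij.symm he.symm (lt_of_le_of_ne (not_lt.1 hlt) hij.symm)
    obtain ⟨l', a, b, c⟩ := ih (l.take i ++ l.drop j) (by
      have := j.2
      have : (i : ℕ) < j := hlt
      simp; omega) (by
      intro x hx
      rcases List.mem_append.1 hx with hx | hx
      · exact h x (List.mem_of_mem_take hx)
      · exact h x (List.mem_of_mem_drop hx))
    refine ⟨l', a, b, ?_⟩
    rw [c, List.prod_append, he, ← List.prod_append, List.take_append_drop]

/-- the embedding into the monoid -/
def co (S : Type) [Semigroup S] : S →ₙ* WithOne S := ⟨fun s => (s : WithOne S), fun _ _ => rfl⟩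

theorem closure_co {S : Type} [Semigroup S] {Sig : Set S} {t : S} (ht : t ∈ Subsemigroup.closure Sig) :
    (t : WithOne S) ∈ Subsemigroup.closure ((fun s : S => (s : WithOne S)) '' Sig) := by
  have : co S t ∈ (Subsemigroup.closure Sig).map (co S) := Subsemigroup.mem_map_of_mem _ ht
  rw [MulHom.map_mclosure] at this
  exact this

theorem one_notMem {S : Type} [Semigroup S] (Sig : Set S) :
    (1 : WithOne S) ∉ Subsemigroup.closure ((fun s : S => (s : WithOne S)) '' Sig) := by
  have : Subsemigroup.closure ((fun s : S => (s : WithOne S)) '' Sig) =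
    (Subsemigroup.closure Sig).map (co S) := (MulHom.map_mclosure (co S) Sig).symm
  rw [this]
  rintro ⟨s, _, h⟩
  exact WithOne.coe_ne_one h

theorem trivial_can {S : Type} [Semigroup S] [Finite (WithOne S)] {Sig : Set S} {t : S}
    (ht : t ∈ Subsemigroup.closure Sig) :
    Can (insert 1 ((fun s : S => (s : WithOne S)) '' Sig)) (Nat.card (WithOne S)) {(t : WithOne S)} := by
  obtain ⟨l, -, hl, hp⟩ := closure_list (closure_co ht)
  obtain ⟨l', a, b, c⟩ := short_word _ l le_rfl hl
  rw [← hp, ← c]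
  exact (can_list (by simp) l' fun x hx => by right; exact b x hx).mono_k a

theorem card_withOne (S : Type) [Fintype S] : Nat.card (WithOne S) = Fintype.card S + 1 := by
  change Nat.card (Option S) = _
  simp [Nat.card_eq_fintype_card]

theorem finite_withOne (S : Type) [Finite S] : Finite (WithOne S) :=
  inferInstanceAs (Finite (Option S))

theorem slCost_le_groupCost (V : Pseudovariety) {N : ℕ} {G : Type} [iG : Group G] [fG : Fintype G]
    (hV : V.mem G) (hN : Fintype.card G ≤ N) {Γ : Set G} {t : G} (ht : t ∈ Subsemigroup.closure Γ) :
    slCost Γ t ≤ groupCost V N := by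
  refine le_csSup ⟨3 * (N + 1) + 1, ?_⟩ ⟨G, iG, fG, hV, hN, Γ, t, ht, rfl⟩
  rintro m ⟨G, iG, fG, hV, hN, Γ, t, ht, rfl⟩
  have := finite_withOne G
  have h := slCost_le_of_can (trivial_can ht)
  rw [card_withOne] at h
  omega

theorem gb_withOne (V : Pseudovariety) {S : Type} [Semigroup S] [Fintype S] (hS : V.mem S) :
    GB (WithOne S) (groupCost V (Fintype.card S)) := by
  intro G _ ι hι h1 Γ t ht
  have : ∀ x, ∃ s : S, (s : WithOne S) = ι x := fun x => WithOne.ne_one_iff_exists.1 (h1 x)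
  choose f hf using this
  let F : G →ₙ* S := ⟨f, by
    intro x y
    rw [← WithOne.coe_inj, WithOne.coe_mul, hf, hf, hf, map_mul]⟩
  have hF : Function.Injective F := by
    intro x y hxy
    apply hι
    rw [← hf, ← hf]
    exact congrArg _ hxy
  have : Finite G := Finite.of_injective F hF
  have := Fintype.ofFinite G
  have hG : V.mem G := V.closed_sub G S F hF hS
  have hc := slCost_le_groupCost V hG (Fintype.card_le_of_injective F hF) ht
  have := finite_withOne G
  obtain ⟨L, a, b⟩ := exists_seq_of_can (trivial_can ht)
  have := Nat.sInf_mem (s := { n : ℕ | ∃ L : List G, IsSLSeq Γ L ∧ t ∈ L ∧ L.length = n }) ⟨_, L, a, b, rfl⟩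
  obtain ⟨L, a, b, c⟩ := this
  exact ⟨L, a, b, c.trans_le hc⟩

theorem rep_of_not_nodup {v : List ℕ} (hv : ¬ v.Nodup) : ∃ i ∈ v, Rep v i := by
  rw [List.nodup_iff_sublist] at hv
  push Not at hv
  obtain ⟨x, hx⟩ := hv
  obtain ⟨r1, r2, rfl, hr1, hr2⟩ := List.cons_sublist_iff.1 hx
  obtain ⟨u, w, rfl⟩ := List.append_of_mem hr1
  obtain ⟨u', w', rfl⟩ := List.append_of_mem (List.singleton_sublist.1 hr2)
  exact ⟨x, by simp, u, w ++ u', w', by simp⟩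

theorem normalise {M : Type*} [Monoid M] (irr : OneIrr M) {n : ℕ} {v : List ℕ} (hv : ∀ i ∈ v, i < n)
    (idt : Ident M n v) : v.Perm (List.range n) ∨ ∃ v' i, (∀ i ∈ v', i < n) ∧ n < v'.length ∧
      i < n ∧ Rep v' i ∧ Ident M n v' := by
  by_cases hall : ∀ i < n, i ∈ v
  · by_cases nd : v.Nodup
    · left
      rw [List.perm_ext_iff_of_nodup nd List.nodup_range]
      intro a
      rw [List.mem_range]
      exact ⟨hv a, hall a⟩
    · right
      obtain ⟨i, hi, hr⟩ := rep_of_not_nodup nd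
      refine ⟨v, i, hv, ?_, hv i hi, hr, idt⟩
      have h1 : v.toFinset = Finset.range n := by
        ext a; rw [List.mem_toFinset, Finset.mem_range]; exact ⟨hv a, hall a⟩
      have h2 : v.toFinset.card ≠ v.length := fun h => nd (Multiset.coe_nodup.1 (Multiset.toFinset_card_eq_card_iff_nodup.1 h))
      have h3 := List.toFinset_card_le v
      rw [h1, Finset.card_range] at h2 h3
      omega
  · right
    push Not at hall
    obtain ⟨i, hi, hiv⟩ := hall
    have hr : List.range n = List.range i ++ i :: (List.range (n - (i + 1))).map (i + 1 + ·) := by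
      conv_lhs => rw [show n = i + (1 + (n - (i + 1))) by omega, List.range_add, List.range_add]
      simp [Function.comp_def, add_assoc]
    refine ⟨List.range i ++ i :: ([] ++ i :: (List.range (n - (i + 1))).map (i + 1 + ·)), i, ?_, ?_, hi,
      ⟨_, _, _, rfl⟩, ?_⟩
    · intro j hj
      simp at hj
      rcases hj with h | h | ⟨a, h1, h2⟩ <;> omega
    · simp; omega
    · intro φ hφ
      have e1 := idt φ hφ
      have e2 := idt (Function.update φ i (φ i * φ i)) (by
        intro j
        by_cases h : j = i
        · subst h; simpa using irr.ne_left _ (hφ j)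
        · simpa [h] using hφ j)
      have up : ∀ (w : List ℕ) (z : M), i ∉ w → w.map (Function.update φ i z) = w.map φ := by
        intro w z ha
        apply List.map_congr_left
        intro j hj
        rw [Function.update_of_ne]
        rintro rfl; exact ha hj
      rw [up v _ hiv, ← e1, hr] at e2
      rw [hr, ← e2]
      simp only [List.map_append, List.map_cons, List.prod_append, List.prod_cons, List.nil_append]
      rw [up _ _ (by simp), up _ _ (by simp; omega)]
      simp [mul_assoc]

theorem oneIrr_withOne (S : Type) [Semigroup S] : OneIrr (WithOne S) := by
  intro x y h
  cases x with
  | one => simpa using h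
  | coe a => cases y with
    | one => simp at h
    | coe b => rw [← WithOne.coe_mul] at h; exact absurd h WithOne.coe_ne_one

theorem final_bound (V : Pseudovariety) {T1 T2 T3 : Type} [Semigroup T1] [Fintype T1] [Semigroup T2]
    [Fintype T2] [Semigroup T3] [Fintype T3] (h1 : IsLRB T1) (n1 : ¬ V.mem T1) (h2 : IsRRB T2)
    (n2 : ¬ V.mem T2) (h3 : IsTNil T3) (n3 : ¬ V.mem T3) (S : Type) [Semigroup S] [Fintype S]
    (hS : V.mem S) (Sig : Set S) (t : S) (ht : t ∈ Subsemigroup.closure Sig) :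
    slCost Sig t ≤ 3 * ((4 * Fintype.card T3 + 6) * groupCost V (Fintype.card S) +
      7 * Nat.log 2 (Fintype.card S + 1) + (6 * Fintype.card T3 + 8)) + 1 := by
  have : Nonempty S := ⟨t⟩
  have fin := finite_withOne S
  have hn0 : 1 ≤ Fintype.card T3 := Fintype.card_pos_iff.2 ⟨h3.choose⟩
  obtain ⟨v, v1, v2, v3⟩ := tnil_ident V h3 n3 hS
  apply slCost_le_of_can
  rw [← card_withOne]
  rcases normalise (oneIrr_withOne S) v1 v3 with hp | ⟨v', i, w1, w2, w3, w4, w5⟩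
  · refine (caseA v3 (one_notMem Sig) hp v2 _ rfl _ (closure_co ht)).mono_k ?_
    have : 0 ≤ (4 * Fintype.card T3 + 6) * groupCost V (Fintype.card S) := Nat.zero_le _
    omega
  · obtain ⟨E, e1, e2⟩ := exists_exp (M := WithOne S)
    have H : Hyp (WithOne S) (Fintype.card T3) v' i E :=
      ⟨oneIrr_withOne S, w5, w3, w4, noL V h1 n1 hS, noR V h2 n2 hS, e1, e2⟩
    exact H.caseB ⟨w5, one_notMem Sig, w1, w2⟩ hn0 (gb_withOne V hS) _ rfl _ (closure_co ht)

end SLC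

theorem pseudovariety_excluding_obstructions_cost_group_reduction
    (V : Pseudovariety)
    (hLRB : ∃ (S : Type) (iS : Semigroup S) (fS : Fintype S),
      @IsLRB S iS ∧ ¬ @Pseudovariety.mem V S iS fS)
    (hRRB : ∃ (S : Type) (iS : Semigroup S) (fS : Fintype S),
      @IsRRB S iS ∧ ¬ @Pseudovariety.mem V S iS fS)
    (hT : ∃ (S : Type) (iS : Semigroup S) (fS : Fintype S),
      @IsTNil S iS ∧ ¬ @Pseudovariety.mem V S iS fS) :
    ∃ c : ℝ, 0 < c ∧
      ∀ (S : Type) [Semigroup S] [Fintype S], V.mem S →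
        ∀ (Sig : Set S) (t : S), t ∈ Subsemigroup.closure Sig →
          (slCost Sig t : ℝ) ≤
            c * ((groupCost V (Fintype.card S) : ℝ) + Real.logb 2 (Fintype.card S) + 1) := by
  obtain ⟨T1, i1, f1, h1, n1⟩ := hLRB
  obtain ⟨T2, i2, f2, h2, n2⟩ := hRRB
  obtain ⟨T3, i3, f3, h3, n3⟩ := hT
  refine ⟨18 * (Fintype.card T3 : ℝ) + 50, by positivity, ?_⟩
  intro S _ _ hS Sig t ht
  have key := SLC.final_bound V h1 n1 h2 n2 h3 n3 S hS Sig t ht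
  have hpos : 1 ≤ Fintype.card S := Fintype.card_pos_iff.2 ⟨t⟩
  have hlog : (Nat.log 2 (Fintype.card S + 1) : ℝ) ≤ Real.logb 2 (Fintype.card S) + 1 := by
    have h := Real.natLog_le_logb (Fintype.card S + 1) 2
    refine h.trans ?_
    have e : Real.logb 2 (Fintype.card S) + 1 = Real.logb 2 ((Fintype.card S : ℝ) * 2) := by
      rw [Real.logb_mul (by positivity) (by norm_num), Real.logb_self_eq_one (by norm_num)]
    rw [e]
    apply Real.logb_le_logb_of_le (by norm_num) (by positivity)
    have : (1 : ℝ) ≤ Fintype.card S := by exact_mod_cast hpos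
    push_cast; linarith
  have hl0 : 0 ≤ Real.logb 2 (Fintype.card S) :=
    Real.logb_nonneg (by norm_num) (by exact_mod_cast hpos)
  have key' : (slCost Sig t : ℝ) ≤ 3 * ((4 * (Fintype.card T3 : ℝ) + 6) * groupCost V (Fintype.card S) +
      7 * (Nat.log 2 (Fintype.card S + 1) : ℝ) + (6 * Fintype.card T3 + 8)) + 1 := by
    exact_mod_cast key
  refine key'.trans ?_
  generalize (Nat.log 2 (Fintype.card S + 1) : ℝ) = l at *
  generalize Real.logb 2 (Fintype.card S) = L at *
  have hC : (0 : ℝ) ≤ groupCost V (Fintype.card S) := Nat.cast_nonneg _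
  have hn : (0 : ℝ) ≤ Fintype.card T3 := Nat.cast_nonneg _
  generalize (groupCost V (Fintype.card S) : ℝ) = C at *
  generalize (Fintype.card T3 : ℝ) = n at *
  nlinarith [mul_nonneg hn hC, mul_nonneg hn hl0]
end

section
/- Let V be a pseudovariety of semigroups. The following are equivalent: (a) there exists D ≥ 1 such that for every S ∈ V and every Σ ⊆ S generating S, every element of S is a product of at most D elements of Σ (V has bounded diameter); (b) there exists k ≥ 1 such that for every S ∈ V the set S^k is a rectangular band, i.e. a·a = a and a·b·c = a·c for all a, b, c ∈ S^k. Moreover, if (a) fails, then there exist a constant ε > 0 and N₀ such that for every N ≥ N₀ there are S ∈ V with |S| ≤ N, a subset Σ ⊆ S, and t in the subsemigroup generated by Σ with c_S(t; Σ) ≥ ε·log₂ N. -/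
/-- Product of a nonempty list of semigroup elements (head times the rest). -/
def listProd₁ {S : Type*} [Semigroup S] : S → List S → S
  | a, [] => a
  | a, b :: l => listProd₁ (a * b) l

/-- `Σ^{≤k}`: elements expressible as a nonempty product of at most `k` elements of `Sig`. -/
def ProdLE {S : Type*} [Semigroup S] (Sig : Set S) (k : ℕ) : Set S :=
  { t | ∃ (a : S) (L : List S),
      a ∈ Sig ∧ (∀ x ∈ L, x ∈ Sig) ∧ L.length + 1 ≤ k ∧ listProd₁ a L = t }

/-- `S^k`: the set of all products of exactly `k` elements of `S`. -/
def powSet (S : Type*) [Semigroup S] (k : ℕ) : Set S :=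
  { t | ∃ (a : S) (L : List S), L.length + 1 = k ∧ listProd₁ a L = t }

/-- Auxiliary witness for the lower bound in STATEMENT 5. -/
def LogLowerWitness (V : Pseudovariety) (ε : ℝ) (N : ℕ)
    (S : Type) [Semigroup S] [Fintype S] : Prop :=
  V.mem S ∧ Fintype.card S ≤ N ∧
    ∃ (Sig : Set S) (t : S),
      t ∈ Subsemigroup.closure Sig ∧ ε * Real.logb 2 N ≤ (slCost Sig t : ℝ)


namespace BD

/-! ### Products of lists and powers of a semigroup -/

section basics
variable {S : Type} [Semigroup S]

theorem listProd_append (a : S) (L : List S) (b : S) (M : List S) :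
    listProd₁ a (L ++ b :: M) = listProd₁ a L * listProd₁ b M := by
  have key : ∀ (M : List S) (a b : S), listProd₁ (a * b) M = a * listProd₁ b M := by
    intro M
    induction M with
    | nil => intro a b; rfl
    | cons c M ih => intro a b; simp only [listProd₁]; rw [mul_assoc, ih]
  induction L generalizing a with
  | nil => simp only [List.nil_append, listProd₁]; exact key M a b
  | cons c L ih => simp only [List.cons_append, listProd₁]; exact ih _

theorem mem_powSet_mul {m n : ℕ} {a b : S} (ha : a ∈ powSet S m) (hb : b ∈ powSet S n) :
    a * b ∈ powSet S (m + n) := by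
  obtain ⟨x, L, hL, rfl⟩ := ha
  obtain ⟨y, M, hM, rfl⟩ := hb
  refine ⟨x, L ++ y :: M, ?_, listProd_append _ _ _ _⟩
  simp; omega

theorem mem_powSet_one (a : S) : a ∈ powSet S 1 := ⟨a, [], rfl, rfl⟩

theorem powSet_succ_subset {n : ℕ} (hn : 1 ≤ n) : powSet S (n + 1) ⊆ powSet S n := by
  rintro t ⟨a, L, hL, rfl⟩
  cases L with
  | nil => simp at hL; omega
  | cons b L => exact ⟨a * b, L, by simp at hL; omega, rfl⟩

theorem powSet_anti {m n : ℕ} (hm : 1 ≤ m) (h : m ≤ n) : powSet S n ⊆ powSet S m := by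
  induction n, h using Nat.le_induction with
  | base => exact subset_rfl
  | succ n hmn ih => exact (powSet_succ_subset (by omega)).trans ih

theorem powSet_split {m n : ℕ} (hm : 1 ≤ m) (hn : 1 ≤ n) {t : S} (ht : t ∈ powSet S (m + n)) :
    ∃ a ∈ powSet S m, ∃ b ∈ powSet S n, t = a * b := by
  obtain ⟨a, L, hL, rfl⟩ := ht
  obtain ⟨m, rfl⟩ : ∃ m', m = m' + 1 := ⟨m - 1, by omega⟩
  have h : L = L.take m ++ L.drop m := (List.take_append_drop m L).symm
  cases hd : L.drop m with
  | nil => simp at hd; omega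
  | cons b M =>
    have hl : (L.drop m).length = M.length + 1 := by rw [hd]; rfl
    simp at hl
    refine ⟨_, ⟨a, L.take m, ?_, rfl⟩, _, ⟨b, M, ?_, rfl⟩, ?_⟩
    · simp; omega
    · omega
    · rw [← listProd_append, ← hd, ← h]

theorem powSet_grow {n : ℕ} (hn : 1 ≤ n) (h : powSet S n ⊆ powSet S (n + 1)) (j : ℕ) :
    powSet S n ⊆ powSet S (n + j) := by
  induction j with
  | zero => exact subset_rfl
  | succ j ih =>
    intro t ht
    obtain ⟨a, ha, b, hb, rfl⟩ := powSet_split hn le_rfl (h ht)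
    have := mem_powSet_mul (ih ha) hb
    exact this

/-! ### Words -/

/-- underlying list of a word -/
def wl {α : Type} (w : FreeSemigroup α) : List α := w.head :: w.tail

theorem wl_of_mul {α : Type} (x : α) (y : FreeSemigroup α) :
    wl (FreeSemigroup.of x * y) = x :: wl y := rfl

theorem wl_of {α : Type} (x : α) : wl (FreeSemigroup.of x) = [x] := rfl

theorem wl_mul {α : Type} (x y : FreeSemigroup α) : wl (x * y) = wl x ++ wl y := by
  simp [wl]

theorem lift_eq_listProd {α : Type} (f : α → S) (w : FreeSemigroup α) :
    FreeSemigroup.lift f w = listProd₁ (f w.head) (w.tail.map f) := by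
  obtain ⟨a, L⟩ := w
  induction L using List.reverseRecOn with
  | nil => rfl
  | append_singleton L b ih =>
    have : (⟨a, L ++ [b]⟩ : FreeSemigroup α) = ⟨a, L⟩ * FreeSemigroup.of b := rfl
    rw [this, map_mul, ih]
    simp [listProd_append, listProd₁]

theorem lift_mem_powSet {α : Type} (f : α → S) (w : FreeSemigroup α) :
    FreeSemigroup.lift f w ∈ powSet S (wl w).length := by
  rw [lift_eq_listProd]
  exact ⟨_, _, by simp [wl], rfl⟩

theorem lift_congr {α : Type} (f g : α → S) (w : FreeSemigroup α) (h : ∀ i ∈ wl w, f i = g i) :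
    FreeSemigroup.lift f w = FreeSemigroup.lift g w := by
  induction w using FreeSemigroup.recOnMul with
  | ih1 x => simpa [wl_of] using h
  | ih2 x y _ ihy =>
    rw [wl_of_mul] at h
    rw [FreeSemigroup.lift_of_mul, FreeSemigroup.lift_of_mul, h x (by simp),
      ihy (fun i hi => h i (by simp [hi]))]

theorem lift_mem_ideal {α : Type} (f : α → S) (I : Set S) (hl : ∀ a, ∀ b ∈ I, a * b ∈ I)
    (hr : ∀ a, ∀ b ∈ I, b * a ∈ I) (w : FreeSemigroup α) (i : α) (hi : i ∈ wl w)
    (hf : f i ∈ I) : FreeSemigroup.lift f w ∈ I := by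
  induction w using FreeSemigroup.recOnMul with
  | ih1 x =>
    simp [wl_of] at hi
    subst hi
    simpa using hf
  | ih2 x y _ ihy =>
    rw [wl_of_mul] at hi
    rw [FreeSemigroup.lift_of_mul]
    rcases List.mem_cons.1 hi with rfl | hi
    · exact hr _ _ hf
    · exact hl _ _ (ihy hi)

theorem exists_map_eq {α β : Type} [Nonempty β] (l : List α) (hl : l.Nodup) (m : List β)
    (h : l.length = m.length) : ∃ f : α → β, l.map f = m := by
  classical
  induction l generalizing m with
  | nil =>
    refine ⟨fun _ => Classical.arbitrary β, ?_⟩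
    cases m with
    | nil => rfl
    | cons => simp at h
  | cons a l ih =>
    cases m with
    | nil => simp at h
    | cons b m =>
      obtain ⟨ha, hl⟩ := List.nodup_cons.1 hl
      obtain ⟨f, hf⟩ := ih hl m (by simpa using h)
      refine ⟨Function.update f a b, ?_⟩
      simp only [List.map_cons, Function.update_self]
      congr 1
      rw [← hf]
      apply List.map_congr_left
      intro x hx
      rw [Function.update_of_ne]
      rintro rfl
      exact ha hx

theorem exists_lift_eq {α : Type} (w : FreeSemigroup α) (hw : (wl w).Nodup) {t : S}
    (ht : t ∈ powSet S (wl w).length) : ∃ f : α → S, FreeSemigroup.lift f w = t := by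
  obtain ⟨a, L, hL, rfl⟩ := ht
  have : Nonempty S := ⟨a⟩
  obtain ⟨f, hf⟩ := exists_map_eq (wl w) hw (a :: L) (by simp [hL])
  refine ⟨f, ?_⟩
  rw [lift_eq_listProd]
  simp only [wl, List.map_cons, List.cons.injEq] at hf
  rw [hf.1, hf.2]

/-! ### Direction (b) implies (a) -/

theorem mem_closure_word (Sig : Set S) (t : S) (ht : t ∈ Subsemigroup.closure Sig) :
    ∃ a L, a ∈ Sig ∧ (∀ x ∈ L, x ∈ Sig) ∧ listProd₁ a L = t := by
  induction ht using Subsemigroup.closure_induction with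
  | mem x hx => exact ⟨x, [], hx, by simp, rfl⟩
  | mul x y _ _ hx hy =>
    obtain ⟨a, L, ha, hL, rfl⟩ := hx
    obtain ⟨b, M, hb, hM, rfl⟩ := hy
    refine ⟨a, L ++ b :: M, ha, ?_, listProd_append _ _ _ _⟩
    intro x hx
    simp at hx
    rcases hx with h | rfl | h
    exacts [hL _ h, hb, hM _ h]

theorem split_word (Sig : Set S) (a : S) (L : List S) (ha : a ∈ Sig) (hL : ∀ x ∈ L, x ∈ Sig)
    (m n : ℕ) (hm : 1 ≤ m) (hn : 1 ≤ n) (h : L.length + 1 = m + n) :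
    ∃ a₁ L₁ a₂ L₂, a₁ ∈ Sig ∧ (∀ x ∈ L₁, x ∈ Sig) ∧ a₂ ∈ Sig ∧ (∀ x ∈ L₂, x ∈ Sig) ∧
      L₁.length + 1 = m ∧ L₂.length + 1 = n ∧
      listProd₁ a L = listProd₁ a₁ L₁ * listProd₁ a₂ L₂ := by
  obtain ⟨m, rfl⟩ : ∃ m', m = m' + 1 := ⟨m - 1, by omega⟩
  have h' : L = L.take m ++ L.drop m := (List.take_append_drop m L).symm
  cases hd : L.drop m with
  | nil => simp at hd; omega
  | cons b M =>
    have hl : (L.drop m).length = M.length + 1 := by rw [hd]; rfl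
    simp at hl
    have hdm : ∀ x ∈ b :: M, x ∈ Sig := fun x hx =>
      hL x (List.mem_of_mem_drop (by rw [hd]; exact hx))
    refine ⟨a, L.take m, b, M, ha, fun x hx => hL x (List.mem_of_mem_take hx),
      hdm b (by simp), fun x hx => hdm x (by simp [hx]), ?_, ?_, ?_⟩
    · simp; omega
    · omega
    · rw [← listProd_append, ← hd, ← h']

theorem b_to_a (k : ℕ) (hk : 1 ≤ k)
    (h : ∀ a ∈ powSet S k, ∀ b ∈ powSet S k, ∀ c ∈ powSet S k, a * b * c = a * c)
    (Sig : Set S) (t : S) (ht : t ∈ Subsemigroup.closure Sig) : t ∈ ProdLE Sig (3 * k) := by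
  obtain ⟨a, L, ha, hL, rfl⟩ := mem_closure_word Sig t ht
  by_cases hlen : L.length + 1 ≤ 3 * k
  · exact ⟨a, L, ha, hL, hlen, rfl⟩
  obtain ⟨a₁, L₁, a₂, L₂, h1, h2, h3, h4, h5, h6, h7⟩ :=
    split_word Sig a L ha hL k (L.length + 1 - k) hk (by omega) (by omega)
  obtain ⟨b₁, M₁, b₂, M₂, g1, g2, g3, g4, g5, g6, g7⟩ :=
    split_word Sig a₂ L₂ h3 h4 (L.length + 1 - k - k) k (by omega) (by omega) (by omega)
  have e : listProd₁ a L = listProd₁ a₁ L₁ * listProd₁ b₂ M₂ := by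
    rw [h7, g7, ← mul_assoc]
    apply h
    · exact ⟨a₁, L₁, h5, rfl⟩
    · exact powSet_anti hk (by omega) ⟨b₁, M₁, g5, rfl⟩
    · exact ⟨b₂, M₂, g6, rfl⟩
  refine ⟨a₁, L₁ ++ b₂ :: M₂, h1, ?_, ?_, ?_⟩
  · intro x hx
    simp at hx
    rcases hx with h | rfl | h
    exacts [h2 _ h, g3, g4 _ h]
  · simp; omega
  · rw [listProd_append, e]

/-! ### The ideal generated by idempotents -/

/-- elements with an idempotent factor -/
def idI (S : Type) [Semigroup S] : Set S := {a | ∃ p e q : S, e * e = e ∧ a = p * e * q}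

theorem idI_left (a b : S) (hb : b ∈ idI S) : a * b ∈ idI S := by
  obtain ⟨p, e, q, he, rfl⟩ := hb
  exact ⟨a * p, e, q, he, by simp only [mul_assoc]⟩

theorem idI_right (a b : S) (hb : b ∈ idI S) : b * a ∈ idI S := by
  obtain ⟨p, e, q, he, rfl⟩ := hb
  exact ⟨p, e, q * a, he, by simp only [mul_assoc]⟩

theorem powSet_card_subset [Fintype S] : powSet S (Fintype.card S + 1) ⊆ idI S := by
  rintro t ⟨a, L, hL, rfl⟩
  have hlen : L.length = Fintype.card S := by omega
  obtain ⟨i, j, hij, hp⟩ := Fintype.exists_ne_map_eq_of_card_lt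
    (fun j : Fin (Fintype.card S + 1) => listProd₁ a (L.take j)) (by simp)
  wlog hlt : i < j generalizing i j
  · exact this j i hij.symm hp.symm (lt_of_le_of_ne (not_lt.1 hlt) hij.symm)
  replace hp : listProd₁ a (L.take i) = listProd₁ a (L.take j) := hp
  have hlt' : (i : ℕ) < j := hlt
  have hj : (j : ℕ) ≤ L.length := by have := j.2; omega
  have hsplit : L.take j = L.take i ++ (L.take j).drop i := by
    conv_lhs => rw [← List.take_append_drop (i : ℕ) (L.take j)]
    rw [List.take_take, min_eq_left hlt'.le]
  set p := listProd₁ a (L.take i) with hpdef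
  have hpI : p ∈ idI S := by
    cases hd : (L.take j).drop i with
    | nil => simp at hd; omega
    | cons b M =>
      rw [hd] at hsplit
      rw [hsplit, listProd_append, ← hpdef] at hp
      let : TopologicalSpace S := ⊥
      have : DiscreteTopology S := ⟨rfl⟩
      obtain ⟨e, he, hee⟩ := exists_idempotent_in_compact_subsemigroup
        (fun r : S => continuous_of_discreteTopology) {x : S | p * x = p}
        ⟨listProd₁ b M, hp.symm⟩ (Set.toFinite _).isCompact (by
          intro x hx y hy
          simp only [Set.mem_ofPred_eq] at *
          rw [← mul_assoc, hx, hy])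
      refine ⟨p, e, e, hee, ?_⟩
      have he' : p * e = p := he
      rw [he', he']
  have hL2 := List.take_append_drop (i : ℕ) L
  cases hd : L.drop i with
  | nil => simp at hd; omega
  | cons b M =>
    rw [hd] at hL2
    rw [← hL2, listProd_append]
    exact idI_right _ _ hpI

theorem ese (hB : ∀ e g : S, e * e = e → e * g = g → g * e = g → g = e)
    (e s : S) (he : e * e = e) : e * s * e = e := by
  apply hB e _ he
  · rw [← mul_assoc, ← mul_assoc, he]
  · rw [mul_assoc, he]

theorem idI_rect (hB : ∀ e g : S, e * e = e → e * g = g → g * e = g → g = e)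
    (a : S) (ha : a ∈ idI S) : a * a = a := by
  obtain ⟨p, e, q, he, rfl⟩ := ha
  calc p * e * q * (p * e * q) = p * (e * (q * p) * e) * q := by simp only [mul_assoc]
    _ = _ := by rw [ese hB e _ he]

theorem idI_rect3 (hB : ∀ e g : S, e * e = e → e * g = g → g * e = g → g = e)
    (a b c : S) (ha : a ∈ idI S) (hc : c ∈ idI S) : a * b * c = a * c := by
  obtain ⟨p, e, q, he, rfl⟩ := ha
  obtain ⟨p', f, q', hf, rfl⟩ := hc
  have key : ∀ x, e * x * f = e * f := by
    intro x
    calc e * x * f = e * x * (f * e * f) := by rw [ese hB f e hf]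
      _ = e * (x * f) * e * f := by simp only [mul_assoc]
      _ = e * f := by rw [ese hB e _ he]
  calc p * e * q * b * (p' * f * q') = p * (e * (q * b * p') * f) * q' := by simp only [mul_assoc]
    _ = p * (e * (q * p') * f) * q' := by rw [key, key]
    _ = _ := by simp only [mul_assoc]

end basics

/-! ### Pseudovarieties -/

/-- membership for a finite semigroup, with a canonical `Fintype` instance -/
def memF (V : Pseudovariety) (S : Type) [Semigroup S] [Finite S] : Prop :=
  @Pseudovariety.mem V S _ (Fintype.ofFinite S)

theorem memF_iff (V : Pseudovariety) (S : Type) [Semigroup S] [i : Fintype S] :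
    memF V S ↔ V.mem S := by
  unfold memF
  rw [Subsingleton.elim (Fintype.ofFinite S) i]

theorem memF_sub (V : Pseudovariety) {S T : Type} [Semigroup S] [Finite S] [Semigroup T] [Finite T]
    (f : S →ₙ* T) (hf : Function.Injective f) (h : memF V T) : memF V S :=
  let := Fintype.ofFinite S
  let := Fintype.ofFinite T
  V.closed_sub S T f hf h

theorem memF_hom (V : Pseudovariety) {S T : Type} [Semigroup S] [Finite S] [Semigroup T] [Finite T]
    (f : S →ₙ* T) (hf : Function.Surjective f) (h : memF V S) : memF V T :=
  let := Fintype.ofFinite S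
  let := Fintype.ofFinite T
  V.closed_hom S T f hf h

theorem memF_prod (V : Pseudovariety) {S T : Type} [Semigroup S] [Finite S] [Semigroup T] [Finite T]
    (hS : memF V S) (hT : memF V T) : memF V (S × T) := by
  let := Fintype.ofFinite S
  let := Fintype.ofFinite T
  rw [memF_iff]
  exact V.closed_prod S T hS hT

theorem memF_pow (V : Pseudovariety) {S : Type} [Semigroup S] [Finite S] [Nonempty S]
    (hS : memF V S) (ι : Type) [Finite ι] : memF V (ι → S) := by
  let := Fintype.ofFinite ι
  refine Fintype.induction_empty_option (P := fun ι _ => memF V (ι → S)) ?_ ?_ ?_ ι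
  · intro α β _ e h
    let := Fintype.ofEquiv β e.symm
    refine memF_sub V (T := α → S) ⟨fun f a => f (e a), fun _ _ => rfl⟩ ?_ h
    intro f g hfg
    funext b
    simpa using congrFun hfg (e.symm b)
  · refine memF_hom V (S := S) ⟨fun _ => PEmpty.elim, fun _ _ => Subsingleton.elim _ _⟩ ?_ hS
    intro f
    exact ⟨Classical.arbitrary S, Subsingleton.elim _ _⟩
  · intro α _ h
    refine memF_sub V (T := S × (α → S)) ⟨fun f => (f none, fun a => f (some a)), fun _ _ => rfl⟩
      ?_ (memF_prod V hS h)
    intro f g hfg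
    simp only [MulHom.coe_mk, Prod.mk.injEq] at hfg
    funext b
    cases b with
    | none => exact hfg.1
    | some a => exact congrFun hfg.2 a

/-! ### Witnesses -/

/-- A `k`-generated member of `V` of size at most `C ^ k` with an element all of whose expressions
need all the generators. -/
def Wit (V : Pseudovariety) (C k : ℕ) : Prop :=
  ∃ (T : Type) (_ : Semigroup T) (_ : Finite T), memF V T ∧ Nat.card T ≤ C ^ k ∧
    ∃ (x : Fin k → T) (t : T), Function.Injective x ∧
      Function.Surjective (FreeSemigroup.lift x) ∧
      ∀ w, FreeSemigroup.lift x w = t → ∀ i, i ∈ wl w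

theorem wit_of (V : Pseudovariety) (C k : ℕ) (U : Type) [Semigroup U] [Finite U]
    (x : Fin k → U) (hV : memF V (FreeSemigroup.lift x).srange) (hC : Nat.card U ≤ C ^ k)
    (t : U) (ht : ∃ w, FreeSemigroup.lift x w = t) (hx : Function.Injective x)
    (h : ∀ w, FreeSemigroup.lift x w = t → ∀ i, i ∈ wl w) : Wit V C k := by
  have key : ∀ w, ((FreeSemigroup.lift (fun i => (FreeSemigroup.lift x).srangeRestrict
      (FreeSemigroup.of i))) w) = (FreeSemigroup.lift x).srangeRestrict w := by
    intro w
    exact DFunLike.congr_fun (FreeSemigroup.lift_comp_of' ((FreeSemigroup.lift x).srangeRestrict)) w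
  refine ⟨(FreeSemigroup.lift x).srange, inferInstance, inferInstance, hV, ?_,
    fun i => (FreeSemigroup.lift x).srangeRestrict (FreeSemigroup.of i), ⟨t, ht⟩, ?_, ?_, ?_⟩
  · exact (Nat.card_le_card_of_injective _ Subtype.val_injective).trans hC
  · intro i j hij
    apply hx
    have := congrArg Subtype.val hij
    simpa using this
  · intro y
    obtain ⟨w, hw⟩ := MulHom.srangeRestrict_surjective _ y
    exact ⟨w, by rw [key, hw]⟩
  · intro w hw
    apply h
    rw [key] at hw
    exact congrArg Subtype.val hw

theorem lift_apply_pi {ι α S : Type} [Semigroup S] (x : α → ι → S) (w : FreeSemigroup α) (c : ι) :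
    FreeSemigroup.lift x w c = FreeSemigroup.lift (fun a => x a c) w := by
  induction w using FreeSemigroup.recOnMul with
  | ih1 a => simp
  | ih2 a y _ ih => rw [FreeSemigroup.lift_of_mul, FreeSemigroup.lift_of_mul, Pi.mul_apply, ih]

/-- a word containing each letter of `Fin k` exactly once -/
theorem full_word (k : ℕ) (hk : 1 ≤ k) : ∃ w : FreeSemigroup (Fin k), wl w = List.finRange k := by
  obtain ⟨k, rfl⟩ : ∃ m, k = m + 1 := ⟨k - 1, by omega⟩
  refine ⟨⟨0, (List.finRange k).map Fin.succ⟩, ?_⟩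
  simp [wl, List.finRange_succ]

/-- evaluating a word at a local identity and an element -/
theorem lift_eg {α S : Type} [Semigroup S] [DecidableEq α] (e g : S) (he : e * e = e)
    (h1 : e * g = g) (h2 : g * e = g) (w : FreeSemigroup α) (hw : (wl w).Nodup) (c : α) :
    FreeSemigroup.lift (fun a => if a = c then g else e) w = if c ∈ wl w then g else e := by
  induction w using FreeSemigroup.recOnMul with
  | ih1 a => simp [wl_of, eq_comm]
  | ih2 a y _ ih =>
    rw [wl_of_mul] at hw ⊢
    obtain ⟨ha, hy⟩ := List.nodup_cons.1 hw
    rw [FreeSemigroup.lift_of_mul, ih hy]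
    by_cases hac : a = c
    · subst hac; simp [ha, h2]
    · have : ¬ c = a := fun h => hac h.symm
      by_cases hc : c ∈ wl y <;> simp [hac, this, hc, h1, he]

theorem wit_caseA (V : Pseudovariety) (S : Type) [Semigroup S] [Fintype S] (hS : V.mem S)
    (e g : S) (he : e * e = e) (h1 : e * g = g) (h2 : g * e = g) (hne : g ≠ e)
    (k : ℕ) (hk : 1 ≤ k) : Wit V (Fintype.card S) k := by
  have : Nonempty S := ⟨e⟩
  have hU : memF V (Fin k → S) := memF_pow V ((memF_iff V S).2 hS) _
  let x : Fin k → Fin k → S := fun a c => if a = c then g else e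
  refine wit_of V _ k (Fin k → S) x ?_ (by simp) (fun _ => g) ?_ ?_ ?_
  · exact memF_sub V (MulMemClass.subtype _) Subtype.val_injective hU
  · obtain ⟨w, hw⟩ := full_word k hk
    refine ⟨w, ?_⟩
    funext c
    rw [lift_apply_pi, lift_eg e g he h1 h2 w (by rw [hw]; exact List.nodup_finRange k)]
    simp [hw]
  · intro i j hij
    by_contra hne'
    have := congrFun hij i
    simp only [x, if_true] at this
    rw [if_neg (fun h => hne' h.symm)] at this
    exact hne this
  · intro w hw i
    by_contra hi
    have := congrFun hw i
    rw [lift_apply_pi] at this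
    have h3 : FreeSemigroup.lift (fun a => x a i) w = FreeSemigroup.lift (fun _ => e) w := by
      apply lift_congr
      intro j hj
      have : j ≠ i := fun h => hi (h ▸ hj)
      simp [x, this]
    have h4 : ∀ w : FreeSemigroup (Fin k), FreeSemigroup.lift (fun _ => e) w = e := by
      intro w
      induction w using FreeSemigroup.recOnMul with
      | ih1 a => simp
      | ih2 a y _ ih => rw [FreeSemigroup.lift_of_mul, ih, he]
    rw [h3, h4] at this
    exact hne this.symm

/-! ### The semigroup of subsets under disjoint union -/

/-- subsets of `Fin k` with an added zero -/
inductive Bk (k : ℕ) : Type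
  | zero : Bk k
  | set (A : Finset (Fin k)) : Bk k

/-- the underlying type -/
def Bk.equiv (k : ℕ) : Bk k ≃ Option (Finset (Fin k)) where
  toFun b := match b with
    | .zero => none
    | .set A => some A
  invFun b := match b with
    | none => .zero
    | some A => .set A
  left_inv b := by cases b <;> rfl
  right_inv b := by cases b <;> rfl

instance (k : ℕ) : Finite (Bk k) := Finite.of_equiv _ (Bk.equiv k).symm

/-- disjoint union, or zero -/
def Bk.op {k : ℕ} : Bk k → Bk k → Bk k
  | .set A, .set B => if Disjoint A B then .set (A ∪ B) else .zero
  | _, _ => .zero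

theorem Bk.op_set {k : ℕ} (A B : Finset (Fin k)) :
    Bk.op (.set A) (.set B) = if Disjoint A B then .set (A ∪ B) else .zero := rfl

theorem Bk.zero_op {k : ℕ} (a : Bk k) : Bk.op .zero a = .zero := rfl

theorem Bk.op_zero {k : ℕ} (a : Bk k) : Bk.op a .zero = .zero := by cases a <;> rfl

instance (k : ℕ) : Semigroup (Bk k) where
  mul := Bk.op
  mul_assoc := by
    intro a b c
    show Bk.op (Bk.op a b) c = Bk.op a (Bk.op b c)
    rcases a with _ | A
    · simp only [Bk.zero_op]
    rcases b with _ | B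
    · simp only [Bk.zero_op, Bk.op_zero]
    rcases c with _ | C
    · simp only [Bk.op_zero]
    rw [Bk.op_set, Bk.op_set]
    by_cases h1 : Disjoint A B <;> by_cases h2 : Disjoint B C
    · simp [Bk.op_set, Finset.disjoint_union_left, Finset.disjoint_union_right, h1, h2]
    · simp [Bk.op_set, Bk.op_zero, Finset.disjoint_union_left, h1, h2]
    · simp [Bk.op_set, Bk.zero_op, Finset.disjoint_union_right, h1, h2]
    · simp [Bk.zero_op, Bk.op_zero, h1, h2]

/-- the generators -/
def Bk.gen {k : ℕ} (i : Fin k) : Bk k := .set {i}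

theorem Bk.lift_gen {k : ℕ} (w : FreeSemigroup (Fin k)) :
    FreeSemigroup.lift (Bk.gen (k := k)) w =
      if (wl w).Nodup then .set (wl w).toFinset else .zero := by
  induction w using FreeSemigroup.recOnMul with
  | ih1 a => simp [wl_of, Bk.gen]
  | ih2 a y _ ih =>
    rw [FreeSemigroup.lift_of_mul, ih, wl_of_mul]
    change Bk.op (.set {a}) _ = _
    by_cases hy : (wl y).Nodup
    · rw [if_pos hy, Bk.op_set]
      by_cases ha : a ∈ wl y
      · simp [ha]
      · simp [ha, hy]
    · rw [if_neg hy, Bk.op_zero]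
      simp [hy]

theorem Bk.card (k : ℕ) (hk : 1 ≤ k) : Nat.card (Bk k) ≤ 3 ^ k := by
  have h : Nat.card (Bk k) = 2 ^ k + 1 := by
    rw [Nat.card_congr (Bk.equiv k)]
    simp
  rw [h]
  clear h
  induction k, hk using Nat.le_induction with
  | base => norm_num
  | succ n hn ih =>
    rw [pow_succ, pow_succ]; omega

/-- key separation lemma -/
theorem sep {S : Type} [Semigroup S] [Fintype S] (k : ℕ)
    (hk : ¬ powSet S k ⊆ idI S) (w w' : FreeSemigroup (Fin k))
    (hww : ∀ f : Fin k → S, FreeSemigroup.lift f w = FreeSemigroup.lift f w')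
    (hw : (wl w).Nodup) : (wl w').Nodup ∧ (wl w).toFinset = (wl w').toFinset := by
  classical
  have hn : ¬ powSet S (wl w).length ⊆ idI S := by
    intro h
    apply hk
    refine (powSet_anti (by simp [wl]) ?_).trans h
    have := hw.length_le_card
    simpa using this
  obtain ⟨s, hs, hsI⟩ := Set.not_subset.1 hn
  obtain ⟨f, hf⟩ := exists_lift_eq w hw hs
  have hz : ∃ z, z ∈ idI S := by
    obtain ⟨f0⟩ : Nonempty S := ⟨s⟩
    exact ⟨_, powSet_card_subset ⟨s, List.replicate (Fintype.card S) s, by simp, rfl⟩⟩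
  obtain ⟨z, hz⟩ := hz
  have hset : (wl w).toFinset = (wl w').toFinset := by
    ext i
    simp only [List.mem_toFinset]
    constructor
    · intro hi
      by_contra hi'
      apply hsI
      have h1 : FreeSemigroup.lift f w' = FreeSemigroup.lift (Function.update f i z) w' := by
        apply lift_congr
        intro j hj
        rw [Function.update_of_ne]
        rintro rfl
        exact hi' hj
      rw [← hf, hww, h1, ← hww]
      exact lift_mem_ideal _ _ idI_left idI_right w i hi (by simpa using hz)
    · intro hi'
      by_contra hi
      apply hsI
      have h1 : FreeSemigroup.lift f w = FreeSemigroup.lift (Function.update f i z) w := by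
        apply lift_congr
        intro j hj
        rw [Function.update_of_ne]
        rintro rfl
        exact hi hj
      rw [← hf, h1, hww]
      exact lift_mem_ideal _ _ idI_left idI_right w' i hi' (by simpa using hz)
  refine ⟨?_, hset⟩
  by_contra hnd
  have hlt : (wl w).length < (wl w').length := by
    rw [← List.toFinset_card_of_nodup hw, hset]
    refine lt_of_le_of_ne (List.toFinset_card_le _) ?_
    intro h
    exact hnd (Multiset.toFinset_card_eq_card_iff_nodup (m := ((wl w' : List (Fin k)) : Multiset (Fin k))).1 h)
  apply hn
  have hgrow : powSet S (wl w).length ⊆ powSet S ((wl w).length + 1) := by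
    intro t ht
    obtain ⟨g, rfl⟩ := exists_lift_eq w hw ht
    rw [hww]
    exact powSet_anti (by omega) hlt (lift_mem_powSet g w')
  refine (powSet_grow (by simp [wl]) hgrow (Fintype.card S + 1)).trans ?_
  exact (powSet_anti (by omega) (by omega)).trans powSet_card_subset

theorem wit_caseB (V : Pseudovariety) (S : Type) [Semigroup S] [Fintype S] (hS : V.mem S)
    (k : ℕ) (hk : 1 ≤ k) (hI : ¬ powSet S k ⊆ idI S) : Wit V 3 k := by
  classical
  obtain ⟨s, hs, hsI⟩ := Set.not_subset.1 hI
  have : Nonempty S := ⟨s⟩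
  have hU : memF V ((Fin k → S) → S) := memF_pow V ((memF_iff V S).2 hS) _
  let x : Fin k → (Fin k → S) → S := fun i f => f i
  have heval : ∀ w f, FreeSemigroup.lift x w f = FreeSemigroup.lift f w := by
    intro w f
    rw [lift_apply_pi]
  have hwd : ∀ w w', FreeSemigroup.lift x w = FreeSemigroup.lift x w' →
      FreeSemigroup.lift (Bk.gen (k := k)) w = FreeSemigroup.lift Bk.gen w' := by
    intro w w' h
    have h' : ∀ f : Fin k → S, FreeSemigroup.lift f w = FreeSemigroup.lift f w' := by
      intro f
      rw [← heval, ← heval, h]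
    rw [Bk.lift_gen, Bk.lift_gen]
    by_cases hw : (wl w).Nodup
    · obtain ⟨h1, h2⟩ := sep k hI w w' h' hw
      rw [if_pos hw, if_pos h1, h2]
    · have hw' : ¬ (wl w').Nodup := fun hw' => hw (sep k hI w' w (fun f => (h' f).symm) hw').1
      rw [if_neg hw, if_neg hw']
  refine wit_of V 3 k (Bk k) Bk.gen ?_ (Bk.card k hk) (.set Finset.univ) ?_ ?_ ?_
  · have hR : memF V (FreeSemigroup.lift x).srange :=
      memF_sub V (MulMemClass.subtype _) Subtype.val_injective hU
    choose c hc using fun y : (FreeSemigroup.lift x).srange =>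
      MulHom.srangeRestrict_surjective (FreeSemigroup.lift x) y
    have hc' : ∀ y, FreeSemigroup.lift x (c y) = y := fun y => congrArg Subtype.val (hc y)
    refine memF_hom V (S := (FreeSemigroup.lift x).srange)
      ⟨fun y => (FreeSemigroup.lift (Bk.gen (k := k))).srangeRestrict (c y), ?_⟩ ?_ hR
    · intro y y'
      apply Subtype.ext
      simp only [MulHom.coe_srangeRestrict, MulMemClass.coe_mul]
      rw [← map_mul]
      apply hwd
      rw [hc', map_mul, hc', hc']
      rfl
    · intro b
      obtain ⟨w, rfl⟩ := MulHom.srangeRestrict_surjective _ b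
      refine ⟨(FreeSemigroup.lift x).srangeRestrict w, ?_⟩
      apply Subtype.ext
      simp only [MulHom.coe_srangeRestrict, MulHom.coe_mk]
      apply hwd
      rw [hc']
      rfl
  · obtain ⟨w, hw⟩ := full_word k hk
    refine ⟨w, ?_⟩
    rw [Bk.lift_gen, hw, if_pos (List.nodup_finRange k)]
    congr 1
    ext i; simp
  · intro i j hij
    simpa [Bk.gen] using hij
  · intro w hw i
    rw [Bk.lift_gen] at hw
    split_ifs at hw
    · have : (wl w).toFinset = Finset.univ := Bk.set.inj hw
      have hi : i ∈ (wl w).toFinset := by rw [this]; simp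
      simpa using hi

/-! ### Straight-line cost -/

theorem slseq_append {S : Type} [Semigroup S] (Sig : Set S) (L M : List S) (hL : IsSLSeq Sig L)
    (hM : IsSLSeq Sig M) : IsSLSeq Sig (L ++ M) := by
  rintro ⟨m, hm⟩
  simp only [List.length_append] at hm
  by_cases h : m < L.length
  · rcases hL ⟨m, h⟩ with h1 | ⟨i, j, hi, hj, h1⟩
    · left
      simpa [List.getElem_append_left h] using h1
    · right
      refine ⟨⟨i, by rw [List.length_append]; omega⟩, ⟨j, by rw [List.length_append]; omega⟩,
        hi, hj, ?_⟩
      simpa [List.getElem_append_left, h, i.2, j.2] using h1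
  · have h' : L.length ≤ m := not_lt.1 h
    rcases hM ⟨m - L.length, by omega⟩ with h1 | ⟨i, j, hi, hj, h1⟩
    · left
      simpa [List.getElem_append_right h'] using h1
    · right
      simp only at hi hj
      refine ⟨⟨L.length + i, by simp⟩, ⟨L.length + j, by simp⟩, by simp; omega, by simp; omega, ?_⟩
      simpa [List.getElem_append_right, h'] using h1

theorem slseq_snoc {S : Type} [Semigroup S] (Sig : Set S) (L : List S) (hL : IsSLSeq Sig L)
    (a b : S) (ha : a ∈ L) (hb : b ∈ L) : IsSLSeq Sig (L ++ [a * b]) := by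
  rintro ⟨m, hm⟩
  simp only [List.length_append, List.length_singleton] at hm
  by_cases h : m < L.length
  · rcases hL ⟨m, h⟩ with h1 | ⟨i, j, hi, hj, h1⟩
    · left
      simpa [List.getElem_append_left h] using h1
    · right
      refine ⟨⟨i, by rw [List.length_append]; omega⟩, ⟨j, by rw [List.length_append]; omega⟩,
        hi, hj, ?_⟩
      simpa [List.getElem_append_left, h, i.2, j.2] using h1
  · have h' : m = L.length := by omega
    subst h'
    right
    obtain ⟨i, hi, rfl⟩ := List.getElem_of_mem ha
    obtain ⟨j, hj, rfl⟩ := List.getElem_of_mem hb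
    refine ⟨⟨i, by rw [List.length_append]; omega⟩, ⟨j, by rw [List.length_append]; omega⟩,
        hi, hj, ?_⟩
    simp [List.getElem_append_left, hi, hj]

theorem exists_slseq {S : Type} [Semigroup S] (Sig : Set S) (t : S)
    (ht : t ∈ Subsemigroup.closure Sig) : ∃ L, IsSLSeq Sig L ∧ t ∈ L := by
  induction ht using Subsemigroup.closure_induction with
  | mem x hx =>
    refine ⟨[x], ?_, by simp⟩
    rintro ⟨m, hm⟩
    left
    simp at hm
    subst hm
    simpa using hx
  | mul x y _ _ hx hy =>
    obtain ⟨L, hL, hxL⟩ := hx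
    obtain ⟨M, hM, hyM⟩ := hy
    exact ⟨(L ++ M) ++ [x * y], slseq_snoc Sig _ (slseq_append Sig L M hL hM) x y (by simp [hxL])
      (by simp [hyM]), by simp⟩

theorem slseq_word {T : Type} [Semigroup T] {k : ℕ} (x : Fin k → T) (L : List T)
    (hL : IsSLSeq (Set.range x) L) (m : ℕ) : ∀ (hm : m < L.length),
    ∃ w, FreeSemigroup.lift x w = L[m] ∧ ∀ i ∈ wl w, x i ∈ L := by
  induction m using Nat.strong_induction_on with
  | _ m ih =>
    intro hm
    rcases hL ⟨m, hm⟩ with ⟨i, hi⟩ | ⟨i, j, hi, hj, h1⟩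
    · refine ⟨FreeSemigroup.of i, ?_, ?_⟩
      · simpa using hi
      · intro j hj
        simp [wl_of] at hj
        subst hj
        rw [hi]
        exact List.get_mem _ _
    · obtain ⟨u, hu, hu'⟩ := ih i hi i.2
      obtain ⟨v, hv, hv'⟩ := ih j hj j.2
      refine ⟨u * v, ?_, ?_⟩
      · rw [map_mul, hu, hv]
        simpa using h1.symm
      · intro c hc
        rw [wl_mul, List.mem_append] at hc
        rcases hc with hc | hc
        exacts [hu' _ hc, hv' _ hc]

theorem closure_range_eq {T : Type} [Semigroup T] {k : ℕ} (x : Fin k → T)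
    (hs : Function.Surjective (FreeSemigroup.lift x)) :
    Subsemigroup.closure (Set.range x) = ⊤ := by
  rw [eq_top_iff]
  rintro t -
  obtain ⟨w, rfl⟩ := hs t
  induction w using FreeSemigroup.recOnMul with
  | ih1 a => simpa using Subsemigroup.subset_closure (Set.mem_range_self a)
  | ih2 a y _ ih =>
    rw [FreeSemigroup.lift_of_mul]
    exact mul_mem (Subsemigroup.subset_closure (Set.mem_range_self a)) ih

theorem le_slCost {T : Type} [Semigroup T] {k : ℕ} (x : Fin k → T) (t : T)
    (hx : Function.Injective x) (hs : Function.Surjective (FreeSemigroup.lift x))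
    (h : ∀ w, FreeSemigroup.lift x w = t → ∀ i, i ∈ wl w) : k ≤ slCost (Set.range x) t := by
  classical
  apply le_csInf
  · obtain ⟨L, hL, ht⟩ := exists_slseq (Set.range x) t (by rw [closure_range_eq x hs]; trivial)
    exact ⟨_, L, hL, ht, rfl⟩
  · rintro n ⟨L, hL, ht, rfl⟩
    obtain ⟨m, hm, hmt⟩ := List.getElem_of_mem ht
    obtain ⟨w, hw, hw'⟩ := slseq_word x L hL m hm
    have hall : ∀ i, x i ∈ L := fun i => hw' i (h w (hw.trans hmt) i)
    calc k = (Finset.univ.image x).card := by rw [Finset.card_image_of_injective _ hx]; simp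
      _ ≤ L.toFinset.card := Finset.card_le_card (by
          intro y hy
          simp at hy
          obtain ⟨i, rfl⟩ := hy
          simpa using hall i)
      _ ≤ L.length := List.toFinset_card_le L

/-! ### Conclusion -/

theorem wit_of_not_b (V : Pseudovariety)
    (hb : ¬ ∃ k : ℕ, 1 ≤ k ∧ ∀ (S : Type) [Semigroup S] [Fintype S], V.mem S →
        (∀ a ∈ powSet S k, a * a = a) ∧
        (∀ a ∈ powSet S k, ∀ b ∈ powSet S k, ∀ c ∈ powSet S k, a * b * c = a * c)) :
    ∃ C : ℕ, 2 ≤ C ∧ ∀ k, 1 ≤ k → Wit V C k := by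
  by_cases hA : ∃ (S : Type) (_ : Semigroup S) (_ : Fintype S), V.mem S ∧
      ∃ e g : S, e * e = e ∧ e * g = g ∧ g * e = g ∧ g ≠ e
  · obtain ⟨S, _, _, hS, e, g, he, h1, h2, hne⟩ := hA
    exact ⟨Fintype.card S, Fintype.one_lt_card_iff.2 ⟨g, e, hne⟩,
      fun k hk => wit_caseA V S hS e g he h1 h2 hne k hk⟩
  · refine ⟨3, by norm_num, fun k hk => ?_⟩
    by_contra hW
    apply hb
    refine ⟨k, hk, fun S _ _ hS => ?_⟩
    have hsub : powSet S k ⊆ idI S := by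
      by_contra hI
      exact hW (wit_caseB V S hS k hk hI)
    have hB : ∀ e g : S, e * e = e → e * g = g → g * e = g → g = e := by
      intro e g he h1 h2
      by_contra hne
      exact hA ⟨S, _, _, hS, e, g, he, h1, h2, hne⟩
    exact ⟨fun a ha => idI_rect hB a (hsub ha),
      fun a ha b _ c hc => idI_rect3 hB a b c (hsub ha) (hsub hc)⟩

theorem not_a_of_wit (V : Pseudovariety) (C : ℕ) (h : ∀ k, 1 ≤ k → Wit V C k) (D : ℕ)
    (ha : ∀ (S : Type) [Semigroup S] [Fintype S], V.mem S →
        ∀ Sig : Set S, Subsemigroup.closure Sig = ⊤ → ∀ t : S, t ∈ ProdLE Sig D) : False := by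
  classical
  obtain ⟨T, _, _, hT, -, x, t, hx, hs, hw⟩ := h (D + 1) (by omega)
  let := Fintype.ofFinite T
  obtain ⟨a, L, haS, hLS, hlen, rfl⟩ :=
    ha T ((memF_iff V T).1 hT) (Set.range x) (closure_range_eq x hs) t
  obtain ⟨i, rfl⟩ := haS
  choose! c hc using hLS
  have hL : (L.map c).map x = L := by
    rw [List.map_map]
    conv_rhs => rw [← List.map_id L]
    exact List.map_congr_left (fun y hy => hc y hy)
  have hall := hw ⟨i, L.map c⟩ (by rw [lift_eq_listProd]; simp only; rw [hL])
  have h1 : (Finset.univ : Finset (Fin (D + 1))) ⊆ (i :: L.map c).toFinset := by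
    intro j _
    have := hall j
    simpa [wl] using this
  have h2 := (Finset.card_le_card h1).trans (List.toFinset_card_le _)
  simp at h2
  omega

theorem log_of_wit (V : Pseudovariety) (C : ℕ) (hC : 2 ≤ C) (h : ∀ k, 1 ≤ k → Wit V C k) :
    ∃ ε : ℝ, 0 < ε ∧ ∃ N₀ : ℕ, ∀ N : ℕ, N₀ ≤ N →
        ∃ (S : Type) (iS : Semigroup S) (fS : Fintype S),
          @LogLowerWitness V ε N S iS fS := by
  have hlC : 0 < Real.logb 2 C := Real.logb_pos (by norm_num) (by exact_mod_cast hC)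
  refine ⟨1 / (2 * Real.logb 2 C), by positivity, C, fun N hN => ?_⟩
  have hk : 1 ≤ Nat.log C N := Nat.log_pos (by omega) hN
  obtain ⟨T, iT, _, hT, hcard, x, t, hx, hs, hw⟩ := h (Nat.log C N) hk
  let fT := Fintype.ofFinite T
  refine ⟨T, iT, fT, (memF_iff V T).1 hT, ?_, Set.range x, t, ?_, ?_⟩
  · rw [← Nat.card_eq_fintype_card]
    exact hcard.trans (Nat.pow_log_le_self C (by omega))
  · rw [closure_range_eq x hs]; trivial
  · have h1 : ((Nat.log C N : ℕ) : ℝ) ≤ (slCost (Set.range x) t : ℝ) := by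
      exact_mod_cast le_slCost x t hx hs hw
    refine le_trans ?_ h1
    have h2 : (N : ℝ) ≤ (C : ℝ) ^ (Nat.log C N + 1) := by
      exact_mod_cast (Nat.lt_pow_succ_log_self (by omega) N).le
    have hNpos : (0 : ℝ) < N := by exact_mod_cast (by omega : 0 < N)
    have h3 : Real.logb 2 N ≤ (Nat.log C N + 1 : ℕ) * Real.logb 2 C := by
      rw [← Real.logb_pow]
      exact Real.logb_le_logb_of_le (by norm_num) hNpos h2
    have h4 : (1 : ℝ) ≤ (Nat.log C N : ℕ) := by exact_mod_cast hk
    push_cast at h3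
    rw [one_div, inv_mul_le_iff₀ (by positivity)]
    nlinarith

end BD

/-- a pseudovariety has bounded diameter iff for some `k ≥ 1` the set `S^k`
is always a rectangular band; if not, a logarithmic lower bound on straight-line cost holds. -/
theorem bounded_diameter_iff_rectangular_band_power
    (V : Pseudovariety) :
    ((∃ D : ℕ, 1 ≤ D ∧ ∀ (S : Type) [Semigroup S] [Fintype S], V.mem S →
        ∀ Sig : Set S, Subsemigroup.closure Sig = ⊤ → ∀ t : S, t ∈ ProdLE Sig D) ↔
      (∃ k : ℕ, 1 ≤ k ∧ ∀ (S : Type) [Semigroup S] [Fintype S], V.mem S →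
        (∀ a ∈ powSet S k, a * a = a) ∧
        (∀ a ∈ powSet S k, ∀ b ∈ powSet S k, ∀ c ∈ powSet S k, a * b * c = a * c))) ∧
    (¬ (∃ D : ℕ, 1 ≤ D ∧ ∀ (S : Type) [Semigroup S] [Fintype S], V.mem S →
        ∀ Sig : Set S, Subsemigroup.closure Sig = ⊤ → ∀ t : S, t ∈ ProdLE Sig D) →
      ∃ ε : ℝ, 0 < ε ∧ ∃ N₀ : ℕ, ∀ N : ℕ, N₀ ≤ N →
        ∃ (S : Type) (iS : Semigroup S) (fS : Fintype S),
          @LogLowerWitness V ε N S iS fS) := by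
  refine ⟨⟨?_, ?_⟩, ?_⟩
  · rintro ⟨D, _, ha⟩
    by_contra hb
    obtain ⟨C, _, hW⟩ := BD.wit_of_not_b V hb
    exact BD.not_a_of_wit V C hW D ha
  · rintro ⟨k, hk, hb⟩
    refine ⟨3 * k, by omega, fun S _ _ hS Sig hSig t => ?_⟩
    exact BD.b_to_a k hk (hb S hS).2 Sig t (by rw [hSig]; trivial)
  · intro hna
    have hb : ¬ ∃ k : ℕ, 1 ≤ k ∧ ∀ (S : Type) [Semigroup S] [Fintype S], V.mem S →
        (∀ a ∈ powSet S k, a * a = a) ∧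
        (∀ a ∈ powSet S k, ∀ b ∈ powSet S k, ∀ c ∈ powSet S k, a * b * c = a * c) := by
      rintro ⟨k, hk, hb⟩
      apply hna
      refine ⟨3 * k, by omega, fun S _ _ hS Sig hSig t => ?_⟩
      exact BD.b_to_a k hk (hb S hS).2 Sig t (by rw [hSig]; trivial)
    obtain ⟨C, hC, hW⟩ := BD.wit_of_not_b V hb
    exact BD.log_of_wit V C hC hW
end
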